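/- There exists ε > 0 depending only on n, Λ and C₀ with the following property. Assume the blow-up framework with bounded T_i: for each i ∈ ℕ, K_i satisfies (K1) with constant C₀, (K2) with constant Λ and (K3), with K_i(x_i) → n(n−2); each c_i is a constant with c_i → c₀ and c₀ < ε; u_i is a positive solution of the boundary Yamabe system on B₁⁺ with coefficients (K_i, c_i); x_i ∈ cl(ℝⁿ₊) ∩ B(0,1/2) is a selected local maximum point, i.e. M_i := u_i(x_i), Γ_i := M_i^{2/(n−2)}, there is σ_i → 0 with u_i(x_i) ≥ u_i on B(x_i,σ_i) ∩ ℝⁿ₊ and Γ_i·σ_i → ∞, and u_i(x_i) · (min over cl(B_{2/3}⁺) of u_i) > i; moreover T_i := x_{i,n}·Γ_i converges to some T̄ ∈ [0,∞), and with x_i' the orthogonal projection of x_i onto {xₙ = 0}, the rescalings v_i(y) = M_i^{−1}·u_i(x_i' + Γ_i^{−1}y) converge in C²_loc(cl(ℝⁿ₊)) to U(y) = (γ/(γ² + |y − t₀·eₙ|²))^{(n−2)/2}, where γ = (1 + c₀²/(n−2)²)^{−1} if c₀ ≤ 0, γ = 1 if c₀ > 0, and t₀ = γ·c₀/(n−2).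 Then lim inf over i of ‖∇K_i(x_i')‖ = 0, i.e. there is a subsequence along which ‖∇K_i(x_i')‖ → 0. -/

import Mathlib

open Metric Set MeasureTheory Filter Topology

noncomputable section

abbrev Euc (n : ℕ) := EuclideanSpace ℝ (Fin n)

/-- Index of the last coordinate. -/
def lastIdx (n : ℕ) (h0 : 0 < n) : Fin n := ⟨n - 1, by omega⟩

/-- The open upper half-space `ℝⁿ₊ = {x : xₙ > 0}`. -/
def upperHalf (n : ℕ) (h0 : 0 < n) : Set (Euc n) := {x | 0 < x (lastIdx n h0)}

/-- The upper half-ball `B_r⁺ = B(0,r) ∩ ℝⁿ₊`. -/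
def halfBall (n : ℕ) (h0 : 0 < n) (r : ℝ) : Set (Euc n) :=
  Metric.ball (0 : Euc n) r ∩ upperHalf n h0

/-- The flat boundary portion `∂'B_r⁺ = B(0,r) ∩ {xₙ = 0}`. -/
def flatBdry (n : ℕ) (h0 : 0 < n) (r : ℝ) : Set (Euc n) :=
  Metric.ball (0 : Euc n) r ∩ {x | x (lastIdx n h0) = 0}

/-- Laplacian (within a set `s`) as the sum of pure second partial derivatives. -/
def lapWithin (n : ℕ) (s : Set (Euc n)) (u : Euc n → ℝ) (x : Euc n) : ℝ :=
  ∑ i : Fin n, iteratedFDerivWithin ℝ 2 u s x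
    ![EuclideanSpace.single i (1 : ℝ), EuclideanSpace.single i (1 : ℝ)]

/-- Normal derivative `∂u/∂xₙ` (within a set `s`). -/
def normalDerivWithin (n : ℕ) (h0 : 0 < n) (s : Set (Euc n)) (u : Euc n → ℝ) (x : Euc n) : ℝ :=
  fderivWithin ℝ u s x (EuclideanSpace.single (lastIdx n h0) (1 : ℝ))

/-- Positive solution of the boundary Yamabe system on `B₁⁺` with coefficients `(K, c)`. -/
def IsYamabeSol (n : ℕ) (h0 : 0 < n) (K c u : Euc n → ℝ) : Prop :=
  ContDiffOn ℝ 2 u (closure (halfBall n h0 1)) ∧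
  (∀ x ∈ closure (halfBall n h0 1), 0 < u x) ∧
  (∀ x ∈ halfBall n h0 1,
    lapWithin n (closure (halfBall n h0 1)) u x
      + K x * u x ^ (((n : ℝ) + 2) / ((n : ℝ) - 2)) = 0) ∧
  (∀ x ∈ flatBdry n h0 1,
    normalDerivWithin n h0 (closure (halfBall n h0 1)) u x
      = c x * u x ^ ((n : ℝ) / ((n : ℝ) - 2)))

/-- Condition (K1) with constant `C₀`. -/
def CondK1 (n : ℕ) (h0 : 0 < n) (C₀ : ℝ) (K : Euc n → ℝ) : Prop :=
  ContDiffOn ℝ (n - 2 : ℕ) K (closure (halfBall n h0 1)) ∧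
  ∀ x ∈ closure (halfBall n h0 1), ∀ j : ℕ, 1 ≤ j → j ≤ n - 2 →
    ‖iteratedFDerivWithin ℝ j K (closure (halfBall n h0 1)) x‖ ≤
      C₀ * ‖iteratedFDerivWithin ℝ 1 K (closure (halfBall n h0 1)) x‖ ^
        (((n : ℝ) - 2 - (j : ℝ)) / ((n : ℝ) - 3))

/-- Condition (K2) with constant `Λ`. -/
def CondK2 (n : ℕ) (h0 : 0 < n) (Λ : ℝ) (K : Euc n → ℝ) : Prop :=
  ∀ x ∈ closure (halfBall n h0 1),
    1 / Λ ≤ K x ∧ ∀ j : ℕ, 1 ≤ j → j ≤ n - 2 →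
      ‖iteratedFDerivWithin ℝ j K (closure (halfBall n h0 1)) x‖ ≤ Λ

/-- Condition (K3): `K` depends only on the first `n - 1` coordinates. -/
def CondK3 (n : ℕ) (h0 : 0 < n) (K : Euc n → ℝ) : Prop :=
  ∀ x ∈ closure (halfBall n h0 1), ∀ y ∈ closure (halfBall n h0 1),
    (∀ i : Fin n, i ≠ lastIdx n h0 → x i = y i) → K x = K y

/-- `C²_loc` convergence of `v i` to `U` on the region `D`: uniform convergence of the
functions and their first and second derivatives on every compact subset of `D`. -/
def TendstoC2LocOn (n : ℕ) (v : ℕ → Euc n → ℝ) (U : Euc n → ℝ) (D : Set (Euc n)) : Prop :=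
  ∀ s : Set (Euc n), IsCompact s → s ⊆ D →
    TendstoUniformlyOn (fun i => v i) U Filter.atTop s ∧
    TendstoUniformlyOn (fun i y => fderivWithin ℝ (v i) D y)
      (fun y => fderivWithin ℝ U D y) Filter.atTop s ∧
    TendstoUniformlyOn (fun i y => iteratedFDerivWithin ℝ 2 (v i) D y)
      (fun y => iteratedFDerivWithin ℝ 2 U D y) Filter.atTop s

section

/-- `g` is differentiable near `0`, with `g'(0) = a` and `g''(0) = b`. -/
def HasD2 (g : ℝ → ℝ) (a b : ℝ) : Prop :=
  ∃ g' : ℝ → ℝ, (∀ᶠ t in 𝓝 0, HasDerivAt g (g' t) t) ∧ g' 0 = a ∧ HasDerivAt g' b 0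

namespace HasD2

variable {f g : ℝ → ℝ} {a b a' b' : ℝ}

theorem hasDerivAt (h : HasD2 f a b) : HasDerivAt f a 0 := by
  obtain ⟨g', h1, rfl, -⟩ := h
  exact h1.self_of_nhds

theorem const (k : ℝ) : HasD2 (fun _ => k) 0 0 :=
  ⟨fun _ => 0, .of_forall fun t => hasDerivAt_const t k, rfl, hasDerivAt_const 0 0⟩

theorem add (hf : HasD2 f a b) (hg : HasD2 g a' b') :
    HasD2 (fun t => f t + g t) (a + a') (b + b') := by
  obtain ⟨f', h1, rfl, h2⟩ := hf
  obtain ⟨g', k1, rfl, k2⟩ := hg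
  refine ⟨fun t => f' t + g' t, ?_, rfl, h2.add k2⟩
  filter_upwards [h1, k1] with t ht kt using ht.add kt

theorem mul (hf : HasD2 f a b) (hg : HasD2 g a' b') :
    HasD2 (fun t => f t * g t) (a * g 0 + f 0 * a') (b * g 0 + 2 * (a * a') + f 0 * b') := by
  have hf0 := hf.hasDerivAt
  have hg0 := hg.hasDerivAt
  obtain ⟨f', h1, rfl, h2⟩ := hf
  obtain ⟨g', k1, rfl, k2⟩ := hg
  refine ⟨fun t => f' t * g t + f t * g' t, ?_, rfl, ?_⟩
  · filter_upwards [h1, k1] with t ht kt using ht.mul kt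
  · exact ((h2.mul hg0).add (hf0.mul k2)).congr_deriv (by ring)

theorem rpow (hf : HasD2 f a b) (h0 : 0 < f 0) (r : ℝ) :
    HasD2 (fun t => f t ^ r) (r * f 0 ^ (r - 1) * a)
      (r * f 0 ^ (r - 1) * b + r * (r - 1) * f 0 ^ (r - 2) * a ^ 2) := by
  have hf0 := hf.hasDerivAt
  obtain ⟨f', h1, rfl, h2⟩ := hf
  refine ⟨fun t => r * f t ^ (r - 1) * f' t, ?_, rfl, ?_⟩
  · filter_upwards [h1, hf0.continuousAt.eventually_ne h0.ne'] with t ht kt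
    have := ht.rpow_const (p := r) (Or.inl kt)
    exact this.congr_deriv (by ring)
  · have h3 := (hf0.rpow_const (p := r - 1) (Or.inl h0.ne')).const_mul r
    refine (h3.mul h2).congr_deriv ?_
    rw [show r - 1 - 1 = r - 2 by ring]
    ring

theorem exp (hf : HasD2 f a b) :
    HasD2 (fun t => Real.exp (f t)) (Real.exp (f 0) * a)
      (Real.exp (f 0) * b + Real.exp (f 0) * a ^ 2) := by
  have hf0 := hf.hasDerivAt
  obtain ⟨f', h1, rfl, h2⟩ := hf
  refine ⟨fun t => Real.exp (f t) * f' t, ?_, rfl, ?_⟩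
  · filter_upwards [h1] with t ht using ht.exp
  · exact (hf0.exp.mul h2).congr_deriv (by ring)

theorem quadratic (α β δ : ℝ) : HasD2 (fun t => α + β * t + δ * t ^ 2) β (2 * δ) := by
  refine ⟨fun t => β + δ * (2 * t), .of_forall fun t => ?_, by simp, ?_⟩
  · have h := (((hasDerivAt_id t).const_mul β).const_add α).add
      (((hasDerivAt_id t).pow 2).const_mul δ)
    exact h.congr_deriv (by simp)
  · have h := ((((hasDerivAt_id (0:ℝ)).const_mul 2).const_mul δ).const_add β)
    exact h.congr_deriv (by ring)

theorem nonneg_of_min (hf : HasD2 f a b) (hm : IsLocalMin f 0) : 0 ≤ b := by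
  by_contra! hb
  have hf0 := hf.hasDerivAt
  obtain ⟨f', h1, rfl, h2⟩ := hf
  have ha : f' 0 = 0 := hm.hasDerivAt_eq_zero hf0
  have hd : deriv f =ᶠ[𝓝 0] f' := h1.mono fun t ht => ht.deriv
  have hdd : deriv (deriv f) 0 = b := by rw [hd.deriv_eq]; exact h2.deriv
  have hM : IsLocalMax f 0 :=
    isLocalMax_of_deriv_deriv_neg (by rw [hdd]; exact hb) (by rw [hf0.deriv, ha]) hf0.continuousAt
  have hc : f =ᶠ[𝓝 0] fun _ => f 0 := by
    filter_upwards [hm, hM] with t h1 h2 using le_antisymm h2 h1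
  have hz : deriv f =ᶠ[𝓝 0] fun _ => 0 := by
    have := hc.deriv
    simpa using this
  have : deriv (deriv f) 0 = 0 := by rw [hz.deriv_eq]; simp
  linarith [hdd]

end HasD2

/-- `f` has, at `z`, pure second partial derivatives with sum `ℓ`, and partial derivatives `a`. -/
def HasLap {n : ℕ} (f : Euc n → ℝ) (z : Euc n) (a : Fin n → ℝ) (ℓ : ℝ) : Prop :=
  ∃ a2 : Fin n → ℝ,
    (∀ i, HasD2 (fun t => f (z + t • EuclideanSpace.single i (1:ℝ))) (a i) (a2 i)) ∧ ∑ i, a2 i = ℓ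

theorem HasD2.normSq_line {n : ℕ} (w : Euc n) (k : ℝ) (z : Euc n) (i : Fin n) :
    HasD2 (fun t => k + ‖z + t • EuclideanSpace.single i (1:ℝ) - w‖ ^ 2) (2 * (z - w) i) 2 := by
  have h := HasD2.quadratic (k + ‖z - w‖ ^ 2) (2 * (z - w) i) 1
  have e : (fun t : ℝ => k + ‖z + t • EuclideanSpace.single i (1:ℝ) - w‖ ^ 2) =
      fun t => (k + ‖z - w‖ ^ 2) + (2 * (z - w) i) * t + 1 * t ^ 2 := by
    funext t
    rw [show z + t • EuclideanSpace.single i (1:ℝ) - w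
      = (z - w) + t • EuclideanSpace.single i (1:ℝ) by abel, norm_add_sq_real]
    rw [inner_smul_right, EuclideanSpace.inner_single_right, norm_smul]
    simp
    ring
  rw [e]
  simpa using h

namespace HasLap

variable {n : ℕ} {f g : Euc n → ℝ} {z : Euc n} {a a' : Fin n → ℝ} {ℓ ℓ' : ℝ}

theorem const (k : ℝ) : HasLap (fun _ : Euc n => k) z (fun _ => 0) 0 :=
  ⟨fun _ => 0, fun _ => HasD2.const k, by simp⟩

theorem add (hf : HasLap f z a ℓ) (hg : HasLap g z a' ℓ') :
    HasLap (fun y => f y + g y) z (fun i => a i + a' i) (ℓ + ℓ') := by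
  obtain ⟨a2, h1, rfl⟩ := hf
  obtain ⟨b2, k1, rfl⟩ := hg
  exact ⟨fun i => a2 i + b2 i, fun i => (h1 i).add (k1 i), Finset.sum_add_distrib⟩

theorem mul (hf : HasLap f z a ℓ) (hg : HasLap g z a' ℓ') :
    HasLap (fun y => f y * g y) z (fun i => a i * g z + f z * a' i)
      (ℓ * g z + 2 * (∑ i, a i * a' i) + f z * ℓ') := by
  obtain ⟨a2, h1, rfl⟩ := hf
  obtain ⟨b2, k1, rfl⟩ := hg
  refine ⟨fun i => a2 i * g z + 2 * (a i * a' i) + f z * b2 i, fun i => ?_, ?_⟩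
  · simpa using (h1 i).mul (k1 i)
  · simp only [Finset.sum_add_distrib, Finset.mul_sum, Finset.sum_mul]

theorem const_mul (k : ℝ) (hf : HasLap f z a ℓ) :
    HasLap (fun y => k * f y) z (fun i => k * a i) (k * ℓ) := by
  have := (HasLap.const (z := z) k).mul hf
  simpa using this

theorem sub (hf : HasLap f z a ℓ) (hg : HasLap g z a' ℓ') :
    HasLap (fun y => f y - g y) z (fun i => a i - a' i) (ℓ - ℓ') := by
  have := hf.add (hg.const_mul (-1))
  convert this using 2
  all_goals ring

theorem rpow (hf : HasLap f z a ℓ) (h0 : 0 < f z) (r : ℝ) :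
    HasLap (fun y => f y ^ r) z (fun i => r * f z ^ (r - 1) * a i)
      (r * f z ^ (r - 1) * ℓ + r * (r - 1) * f z ^ (r - 2) * ∑ i, a i ^ 2) := by
  obtain ⟨a2, h1, rfl⟩ := hf
  refine ⟨fun i => r * f z ^ (r - 1) * a2 i + r * (r - 1) * f z ^ (r - 2) * a i ^ 2,
    fun i => ?_, ?_⟩
  · simpa using (h1 i).rpow (by simpa using h0) r
  · simp only [Finset.sum_add_distrib, Finset.mul_sum]

theorem exp (hf : HasLap f z a ℓ) :
    HasLap (fun y => Real.exp (f y)) z (fun i => Real.exp (f z) * a i)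
      (Real.exp (f z) * ℓ + Real.exp (f z) * ∑ i, a i ^ 2) := by
  obtain ⟨a2, h1, rfl⟩ := hf
  refine ⟨fun i => Real.exp (f z) * a2 i + Real.exp (f z) * a i ^ 2, fun i => ?_, ?_⟩
  · simpa using (h1 i).exp
  · simp only [Finset.sum_add_distrib, Finset.mul_sum]

theorem normSq (w : Euc n) (k : ℝ) :
    HasLap (fun y => k + ‖y - w‖ ^ 2) z (fun i => 2 * (z - w) i) (2 * n) :=
  ⟨fun _ => 2, fun i => HasD2.normSq_line w k z i, by simp [mul_comm]⟩

theorem coord (j : Fin n) (k : ℝ) :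
    HasLap (fun y : Euc n => k * y j) z (fun i => k * (EuclideanSpace.single i (1:ℝ) : Euc n) j) 0 := by
  refine ⟨fun _ => 0, fun i => ?_, by simp⟩
  have h := HasD2.quadratic (k * z j) (k * (EuclideanSpace.single i (1:ℝ) : Euc n) j) 0
  convert h using 1
  · funext t
    simp [PiLp.add_apply, PiLp.smul_apply]
    split_ifs <;> ring
  · ring

theorem nonneg_of_min (hf : HasLap f z a ℓ) (hm : IsLocalMin f z) : 0 ≤ ℓ := by
  obtain ⟨a2, h1, rfl⟩ := hf
  refine Finset.sum_nonneg fun i _ => (h1 i).nonneg_of_min ?_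
  have hc : Tendsto (fun t : ℝ => z + t • (EuclideanSpace.single i (1:ℝ) : Euc n)) (𝓝 0) (𝓝 z) := by
    have : Continuous (fun t : ℝ => z + t • (EuclideanSpace.single i (1:ℝ) : Euc n)) := by fun_prop
    simpa using this.tendsto 0
  have := hc.eventually hm
  simpa [IsLocalMin, IsMinFilter] using this

end HasLap

end

section

theorem HasD2.comp_smul_line {E : Type*} [NormedAddCommGroup E] [NormedSpace ℝ E]
    {V : E → ℝ} {V' : E → E →L[ℝ] ℝ} {H : E →L[ℝ] E →L[ℝ] ℝ} {r : ℝ → ℝ} {r1 r2 : ℝ} {z b w : E}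
    (hr : HasD2 r r1 r2) (hw : w = r 0 • z)
    (h1 : ∀ᶠ y in 𝓝 w, HasFDerivAt V (V' y) y) (h2 : HasFDerivAt V' H w) :
    HasD2 (fun t => V (r t • (z + t • b))) (V' w (r1 • z + r 0 • b))
      (H (r1 • z + r 0 • b) (r1 • z + r 0 • b) + V' w (r2 • z + (2 * r1) • b)) := by
  have hr0 := hr.hasDerivAt
  obtain ⟨r', hr1, rfl, hr2⟩ := hr
  have hl : ∀ t : ℝ, HasDerivAt (fun t : ℝ => z + t • b) b t := fun t => by
    simpa using ((hasDerivAt_id t).smul_const b).const_add z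
  have hc : ∀ᶠ t in 𝓝 (0:ℝ), HasDerivAt (fun t => r t • (z + t • b))
      (r t • b + r' t • (z + t • b)) t := hr1.mono fun t ht => ht.smul (hl t)
  have hw' : w = r 0 • (z + (0:ℝ) • b) := by simp [hw]
  have hc0 : HasDerivAt (fun t => r t • (z + t • b)) (r' 0 • z + r 0 • b) 0 := by
    refine hc.self_of_nhds.congr_deriv ?_
    rw [zero_smul, add_zero, add_comm]
  refine ⟨fun t => V' (r t • (z + t • b)) (r t • b + r' t • (z + t • b)), ?_, ?_, ?_⟩
  · have hcc : Tendsto (fun t => r t • (z + t • b)) (𝓝 0) (𝓝 w) := by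
      rw [hw']; exact hc0.continuousAt.tendsto
    filter_upwards [hc, hcc.eventually h1] with t ht kt
    exact kt.comp_hasDerivAt t ht
  · simp only [zero_smul, add_zero]
    rw [← hw, add_comm]
  · have k1 : HasDerivAt (fun t => V' (r t • (z + t • b))) (H (r' 0 • z + r 0 • b)) 0 := by
      rw [hw'] at h2
      exact h2.comp_hasDerivAt 0 hc0
    have k2 : HasDerivAt (fun t => r t • b + r' t • (z + t • b))
        (r' 0 • b + (r' 0 • b + r2 • z)) 0 := by
      refine ((hr0.smul_const b).add (hr2.smul (hl 0))).congr_deriv ?_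
      simp
    refine (k1.clm_apply k2).congr_deriv ?_
    simp only [zero_smul, add_zero]
    rw [← hw, add_comm (r 0 • b) (r' 0 • z)]
    congr 2
    rw [two_mul, add_smul]
    abel

variable {n : ℕ}

theorem Euc.sum_single (z : Euc n) : ∑ i, z i • (EuclideanSpace.single i (1:ℝ) : Euc n) = z := by
  ext j
  simp [Finset.sum_apply, Pi.single_apply]

theorem Euc.sum_sq (z : Euc n) : ∑ i, z i ^ 2 = ‖z‖ ^ 2 := by
  rw [EuclideanSpace.norm_sq_eq]; simp

theorem Euc.sum_mul (z w : Euc n) : ∑ i, z i * w i = inner ℝ z w := by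
  simp [PiLp.inner_apply, mul_comm]

/-- The Kelvin transform of `V` with respect to the sphere of squared radius `l`. -/
def kel (m l : ℝ) (V : Euc n → ℝ) (z : Euc n) : ℝ :=
  (l / ‖z‖ ^ 2) ^ m * V ((l / ‖z‖ ^ 2) • z)

theorem HasLap.of_hessian {V : Euc n → ℝ} {z : Euc n} {V' : Euc n → Euc n →L[ℝ] ℝ}
    {H : Euc n →L[ℝ] Euc n →L[ℝ] ℝ}
    (h1 : ∀ᶠ y in 𝓝 z, HasFDerivAt V (V' y) y) (h2 : HasFDerivAt V' H z) :
    HasLap V z (fun i => V' z (EuclideanSpace.single i (1:ℝ)))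
      (∑ i, H (EuclideanSpace.single i (1:ℝ)) (EuclideanSpace.single i (1:ℝ))) := by
  refine ⟨_, fun i => ?_, rfl⟩
  have := (HasD2.const 1).comp_smul_line (z := z) (b := EuclideanSpace.single i (1:ℝ))
    (w := z) (by simp) h1 h2
  simpa using this

theorem HasLap.comp_inversion {V : Euc n → ℝ} {z w : Euc n} {l : ℝ} {V' : Euc n → Euc n →L[ℝ] ℝ}
    {H : Euc n →L[ℝ] Euc n →L[ℝ] ℝ} (hz : z ≠ 0) (hw : w = (l / ‖z‖ ^ 2) • z)
    (h1 : ∀ᶠ y in 𝓝 w, HasFDerivAt V (V' y) y) (h2 : HasFDerivAt V' H w) :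
    HasLap (fun y => V ((l / ‖y‖ ^ 2) • y)) z
      (fun i => (l / ‖z‖ ^ 2) * V' w (EuclideanSpace.single i (1:ℝ))
        - 2 * z i * l / (‖z‖ ^ 2) ^ 2 * V' w z)
      ((l / ‖z‖ ^ 2) ^ 2 *
        (∑ i, H (EuclideanSpace.single i (1:ℝ)) (EuclideanSpace.single i (1:ℝ)))
        + l / (‖z‖ ^ 2) ^ 2 * (4 - 2 * n) * V' w z) := by
  have hN : 0 < ‖z‖ ^ 2 := by positivity
  have hs : ∀ i, HasD2 _ _ _ := fun i => HasD2.normSq_line (0 : Euc n) 0 z i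
  have key : ∀ i, HasD2 (fun t : ℝ => l / ‖z + t • EuclideanSpace.single i (1:ℝ)‖ ^ 2)
      (- l * (2 * z i) / (‖z‖ ^ 2) ^ 2)
      (l * (-2 / (‖z‖ ^ 2) ^ 2 + 8 * z i ^ 2 / (‖z‖ ^ 2) ^ 3)) := by
    intro i
    have h := (HasD2.const l).mul (((hs i).rpow (by simpa using hN) (-1)))
    have e : (fun t : ℝ => l / ‖z + t • EuclideanSpace.single i (1:ℝ)‖ ^ 2) =
        fun t => l * (0 + ‖z + t • EuclideanSpace.single i (1:ℝ) - 0‖ ^ 2) ^ (-1:ℝ) := by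
      funext t
      rw [zero_add, sub_zero, Real.rpow_neg_one, div_eq_mul_inv]
    rw [e]
    convert h using 1
    · simp only [zero_mul, zero_add, sub_zero, zero_smul, add_zero]
      rw [show (-1 - 1 : ℝ) = -((2:ℕ):ℝ) by norm_num, Real.rpow_neg hN.le, Real.rpow_natCast]
      field_simp
    · simp only [zero_mul, zero_add, sub_zero, zero_smul, add_zero, mul_zero]
      rw [show (-1 - 1 : ℝ) = -((2:ℕ):ℝ) by norm_num, show (-1 - 2 : ℝ) = -((3:ℕ):ℝ) by norm_num,
        Real.rpow_neg hN.le, Real.rpow_natCast, Real.rpow_neg hN.le, Real.rpow_natCast]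
      field_simp
      ring
  refine ⟨fun i => (-l * (2 * z i) / (‖z‖ ^ 2) ^ 2 *
      (-l * (2 * z i) / (‖z‖ ^ 2) ^ 2 * H z z
        + l / ‖z‖ ^ 2 * H (EuclideanSpace.single i (1:ℝ)) z)
      + l / ‖z‖ ^ 2 * (-l * (2 * z i) / (‖z‖ ^ 2) ^ 2 * H z (EuclideanSpace.single i (1:ℝ)) +
        l / ‖z‖ ^ 2 * H (EuclideanSpace.single i (1:ℝ)) (EuclideanSpace.single i (1:ℝ))))
      + (l * (-2 / (‖z‖ ^ 2) ^ 2 + 8 * z i ^ 2 / (‖z‖ ^ 2) ^ 3) * V' w z +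
        2 * (-l * (2 * z i) / (‖z‖ ^ 2) ^ 2) * V' w (EuclideanSpace.single i (1:ℝ))),
    fun i => ?_, ?_⟩
  · have := (key i).comp_smul_line (z := z) (b := EuclideanSpace.single i (1:ℝ)) (w := w)
      (by simpa using hw) h1 h2
    simp only [map_add, map_smul, smul_eq_mul, zero_smul, add_zero,
      add_apply, smul_apply] at this
    convert this using 1 <;> ring
  · have e1 : ∑ i, z i * H (EuclideanSpace.single i (1:ℝ)) z = H z z := by
      have h : H (∑ i, z i • (EuclideanSpace.single i (1:ℝ) : Euc n)) z = H z z := by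
        rw [Euc.sum_single]
      rw [← h, map_sum, sum_apply]
      simp
    have e2 : ∑ i, z i * H z (EuclideanSpace.single i (1:ℝ)) = H z z := by
      conv_rhs => rhs; rw [← Euc.sum_single z]
      rw [map_sum]
      simp
    have e3 : ∑ i, z i * V' w (EuclideanSpace.single i (1:ℝ)) = V' w z := by
      conv_rhs => rhs; rw [← Euc.sum_single z]
      rw [map_sum]
      simp
    have e4 := Euc.sum_sq z
    have : ∀ N : ℝ, N = ‖z‖ ^ 2 → (∑ i, (( -l * (2 * z i) / N ^ 2 *
        (-l * (2 * z i) / N ^ 2 * H z z + l / N * H (EuclideanSpace.single i (1:ℝ)) z)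
        + l / N * (-l * (2 * z i) / N ^ 2 * H z (EuclideanSpace.single i (1:ℝ)) +
          l / N * H (EuclideanSpace.single i (1:ℝ)) (EuclideanSpace.single i (1:ℝ))))
        + (l * (-2 / N ^ 2 + 8 * z i ^ 2 / N ^ 3) * V' w z +
            2 * (-l * (2 * z i) / N ^ 2) * V' w (EuclideanSpace.single i (1:ℝ)))))
      = (l / N) ^ 2 * (∑ i, H (EuclideanSpace.single i (1:ℝ)) (EuclideanSpace.single i (1:ℝ)))
        + l / N ^ 2 * (4 - 2 * n) * V' w z := by
      intro N hNz
      have : ∀ i, (( -l * (2 * z i) / N ^ 2 *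
        (-l * (2 * z i) / N ^ 2 * H z z + l / N * H (EuclideanSpace.single i (1:ℝ)) z)
        + l / N * (-l * (2 * z i) / N ^ 2 * H z (EuclideanSpace.single i (1:ℝ)) +
          l / N * H (EuclideanSpace.single i (1:ℝ)) (EuclideanSpace.single i (1:ℝ))))
        + (l * (-2 / N ^ 2 + 8 * z i ^ 2 / N ^ 3) * V' w z +
            2 * (-l * (2 * z i) / N ^ 2) * V' w (EuclideanSpace.single i (1:ℝ))))
        = (4 * l ^ 2 / N ^ 4 * H z z + 8 * l / N ^ 3 * V' w z) * z i ^ 2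
          + (- 2 * l ^ 2 / N ^ 3) * (z i * H (EuclideanSpace.single i (1:ℝ)) z)
          + (- 2 * l ^ 2 / N ^ 3) * (z i * H z (EuclideanSpace.single i (1:ℝ)))
          + (-4 * l / N ^ 2) * (z i * V' w (EuclideanSpace.single i (1:ℝ)))
          + (l / N) ^ 2 * H (EuclideanSpace.single i (1:ℝ)) (EuclideanSpace.single i (1:ℝ))
          + (-2 * l / N ^ 2 * V' w z) := by
        intro i; field_simp; ring
      rw [Finset.sum_congr rfl fun i _ => this i]
      simp only [Finset.sum_add_distrib, ← Finset.mul_sum, e1, e2, e3, e4]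
      simp only [Finset.sum_const, Finset.card_univ, Fintype.card_fin, nsmul_eq_mul, ← hNz]
      have : N ≠ 0 := by rw [hNz]; exact hN.ne'
      field_simp
      ring
    exact this _ rfl

theorem HasLap.kel {V : Euc n → ℝ} {z w : Euc n} {m l : ℝ} {V' : Euc n → Euc n →L[ℝ] ℝ}
    {H : Euc n →L[ℝ] Euc n →L[ℝ] ℝ} (hm : (n:ℝ) = 2 * m + 2) (hl : 0 < l)
    (hz : z ≠ 0) (hw : w = (l / ‖z‖ ^ 2) • z)
    (h1 : ∀ᶠ y in 𝓝 w, HasFDerivAt V (V' y) y) (h2 : HasFDerivAt V' H w) :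
    ∃ a, HasLap (kel m l V) z a
      ((l / ‖z‖ ^ 2) ^ (m + 2) *
        (∑ i, H (EuclideanSpace.single i (1:ℝ)) (EuclideanSpace.single i (1:ℝ)))) := by
  have hN : 0 < ‖z‖ ^ 2 := by positivity
  have k1 := HasLap.comp_inversion hz hw h1 h2
  have k2 := ((HasLap.normSq (z := z) 0 0).rpow (by simpa using hN) (-m)).const_mul (l ^ m)
  have k3 := k2.mul k1
  have e : _root_.kel m l V = fun y => l ^ m * (0 + ‖y - 0‖ ^ 2) ^ (-m) * V ((l / ‖y‖ ^ 2) • y) := by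
    funext y
    rw [_root_.kel, zero_add, sub_zero, Real.rpow_neg (by positivity), Real.div_rpow hl.le (by positivity)]
    rfl
  rw [e]
  have key : ∀ {a ℓ ℓ'}, HasLap (fun y => l ^ m * (0 + ‖y - 0‖ ^ 2) ^ (-m) *
      V ((l / ‖y‖ ^ 2) • y)) z a ℓ → ℓ = ℓ' → ∃ a, HasLap (fun y => l ^ m * (0 + ‖y - 0‖ ^ 2) ^ (-m) *
      V ((l / ‖y‖ ^ 2) • y)) z a ℓ' := fun h e => ⟨_, e ▸ h⟩
  refine key k3 ?_
  simp only [zero_add, sub_zero]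
  rw [← hw]
  have e3 : ∑ i, z i * V' w (EuclideanSpace.single i (1:ℝ)) = V' w z := by
    conv_rhs => rhs; rw [← Euc.sum_single z]
    rw [map_sum]
    simp
  have e4 := Euc.sum_sq z
  set N := ‖z‖ ^ 2 with hNdef
  set D := ∑ i, H (EuclideanSpace.single i (1:ℝ)) (EuclideanSpace.single i (1:ℝ))
  have s1 : ∑ i, (2 * z i) ^ 2 = 4 * N := by
    simp only [mul_pow]; rw [← Finset.mul_sum, e4]; norm_num
  have s2 : ∑ i, l ^ m * (-m * N ^ (-m - 1) * (2 * z i)) *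
      (l / N * V' w (EuclideanSpace.single i 1) - 2 * z i * l / N ^ 2 * V' w z)
      = 2 * m * l ^ m * N ^ (-m - 1) * (l / N) * V' w z := by
    have : ∀ i, l ^ m * (-m * N ^ (-m - 1) * (2 * z i)) *
      (l / N * V' w (EuclideanSpace.single i 1) - 2 * z i * l / N ^ 2 * V' w z)
      = (l ^ m * (-m * N ^ (-m - 1) * 2) * (l / N)) * (z i * V' w (EuclideanSpace.single i 1))
        - (l ^ m * (-m * N ^ (-m - 1) * 2) * (2 * l / N ^ 2) * V' w z) * z i ^ 2 := by
      intro i; ring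
    rw [Finset.sum_congr rfl fun i _ => this i, Finset.sum_sub_distrib, ← Finset.mul_sum,
      ← Finset.mul_sum, e3, e4]
    field_simp
    ring
  rw [s1, s2]
  have r1 : N ^ (-m - 1) = N ^ (-m) / N := Real.rpow_sub_one hN.ne' _
  have r2 : N ^ (-m - 2) = N ^ (-m) / N ^ 2 := by
    have := Real.rpow_sub_natCast hN.ne' (-m) 2
    simpa using this
  have r3 : (l / N) ^ (m + 2) = l ^ m * N ^ (-m) * (l / N) ^ 2 := by
    rw [Real.rpow_add (by positivity), Real.div_rpow hl.le hN.le, Real.rpow_neg hN.le]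
    norm_cast
  rw [r1, r2, r3, hm]
  field_simp
  ring

end

section

/-- `d` is the one-sided derivative of `f` at `z` in the direction `e`. -/
def HasNd {n : ℕ} (f : Euc n → ℝ) (e z : Euc n) (d : ℝ) : Prop :=
  HasDerivWithinAt (fun t : ℝ => f (z + t • e)) d (Ici 0) 0

theorem HasDerivWithinAt.nonneg_of_min {g : ℝ → ℝ} {d : ℝ} (h : HasDerivWithinAt g d (Ici 0) 0)
    (hm : ∀ᶠ t in 𝓝[>] (0:ℝ), g 0 ≤ g t) : 0 ≤ d := by
  have h1 := (hasDerivWithinAt_iff_tendsto_slope.1 h)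
  have h2 : Tendsto (slope g 0) (𝓝[>] 0) (𝓝 d) :=
    h1.mono_left (nhdsWithin_mono _ fun x (hx : 0 < x) => ⟨hx.le, hx.ne'⟩)
  refine ge_of_tendsto h2 ?_
  filter_upwards [hm, self_mem_nhdsWithin] with t ht (h0 : 0 < t)
  rw [slope_def_field]
  exact div_nonneg (by linarith) (by linarith)

theorem rpow_tangent {W V p : ℝ} (hW : 0 < W) (hV : 0 < V) (hp : 1 ≤ p) :
    W ^ p + p * W ^ (p - 1) * (V - W) ≤ V ^ p := by
  have h := one_add_mul_self_le_rpow_one_add (s := V / W - 1)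
    (by have := div_pos hV hW; linarith) hp
  have hWp : 0 < W ^ p := Real.rpow_pos_of_pos hW p
  have e1 : V ^ p = W ^ p * (1 + (V / W - 1)) ^ p := by
    rw [show 1 + (V / W - 1) = V / W by ring, Real.div_rpow hV.le hW.le]
    field_simp
  rw [e1, Real.rpow_sub_one hW.ne']
  calc _ = W ^ p * (1 + p * (V / W - 1)) := by field_simp
    _ ≤ _ := mul_le_mul_of_nonneg_left h hWp.le

variable {n : ℕ}

theorem norm_add_smul_single_sq (z : Euc n) (j : Fin n) (t : ℝ) :
    ‖z + t • (EuclideanSpace.single j (1:ℝ) : Euc n)‖ ^ 2 = ‖z‖ ^ 2 + 2 * t * z j + t ^ 2 := by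
  rw [norm_add_sq_real, inner_smul_right, EuclideanSpace.inner_single_right, norm_smul]
  simp
  ring

theorem HasNd.kel {V : Euc n → ℝ} {z w : Euc n} {m l : ℝ} {G : Euc n →L[ℝ] ℝ} {j : Fin n}
    (hl : 0 < l) (hz : z ≠ 0) (hzj : z j = 0) (hw : w = (l / ‖z‖ ^ 2) • z)
    (hG : HasFDerivWithinAt V G {y | 0 ≤ y j} w) :
    HasNd (kel m l V) (EuclideanSpace.single j (1:ℝ)) z
      ((l / ‖z‖ ^ 2) ^ (m + 1) * G (EuclideanSpace.single j (1:ℝ))) := by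
  have hN : 0 < ‖z‖ ^ 2 := by positivity
  have hr : HasDerivAt (fun t : ℝ => l / (‖z‖ ^ 2 + t ^ 2)) 0 0 := by
    have h1 : HasDerivAt (fun t : ℝ => ‖z‖ ^ 2 + t ^ 2) 0 0 := by
      simpa using ((hasDerivAt_id (0:ℝ)).pow 2).const_add (‖z‖ ^ 2)
    have := (hasDerivAt_const (0:ℝ) l).div h1 (by simpa using hN.ne')
    exact this.congr_deriv (by simp)
  have hl' : HasDerivAt (fun t : ℝ => z + t • (EuclideanSpace.single j (1:ℝ) : Euc n))
      (EuclideanSpace.single j (1:ℝ)) 0 := by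
    simpa using ((hasDerivAt_id (0:ℝ)).smul_const _).const_add z
  have hc := hr.smul hl'
  have hcw : HasDerivWithinAt (fun t : ℝ => V ((l / (‖z‖ ^ 2 + t ^ 2)) •
      (z + t • (EuclideanSpace.single j (1:ℝ) : Euc n))))
      (G ((l / ‖z‖ ^ 2) • EuclideanSpace.single j (1:ℝ))) (Ici 0) 0 := by
    have hc2 : HasDerivWithinAt (fun t : ℝ => (l / (‖z‖ ^ 2 + t ^ 2)) •
        (z + t • (EuclideanSpace.single j (1:ℝ) : Euc n)))
        ((l / ‖z‖ ^ 2) • EuclideanSpace.single j (1:ℝ)) (Ici 0) 0 := by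
      refine hc.hasDerivWithinAt.congr_deriv ?_
      simp
    have hG' : HasFDerivWithinAt V G {y | 0 ≤ y j} ((l / (‖z‖ ^ 2 + (0:ℝ) ^ 2)) •
        (z + (0:ℝ) • (EuclideanSpace.single j (1:ℝ) : Euc n))) := by
      simpa [hw] using hG
    refine hG'.comp_hasDerivWithinAt 0 hc2 ?_
    intro t ht
    have ht' : 0 ≤ t := ht
    simp only [mem_ofPred_eq, PiLp.smul_apply, PiLp.add_apply, hzj, smul_eq_mul]
    simp
    positivity
  have hp : HasDerivAt (fun t : ℝ => (l / (‖z‖ ^ 2 + t ^ 2)) ^ m) 0 0 := by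
    have := hr.rpow_const (p := m) (Or.inl (by simp; exact ⟨hl.ne', by simpa using hz⟩))
    simpa using this
  have := hp.hasDerivWithinAt.mul hcw
  unfold HasNd
  refine (this.congr_of_eventuallyEq (Eventually.of_forall fun t => ?_) ?_).congr_deriv ?_
  · simp only [_root_.kel, Pi.mul_apply]
    rw [norm_add_smul_single_sq, hzj]; simp
  · simp only [_root_.kel, Pi.mul_apply]
    rw [norm_add_smul_single_sq, hzj]; simp
  · rw [Real.rpow_add_one (by positivity)]
    simp
    ring

/-- A positive solution of the rescaled problem on the closed half ball of radius `L`. -/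
structure RescaledSol (n : ℕ) (j : Fin n) (m c L : ℝ) (V Kh : Euc n → ℝ) : Prop where
  cont : ContinuousOn V {z | 0 ≤ z j ∧ ‖z‖ ≤ L}
  pos : ∀ z : Euc n, 0 ≤ z j → ‖z‖ ≤ L → 0 < V z
  hess : ∀ z : Euc n, 0 < z j → ‖z‖ < L → ∃ (V' : Euc n → Euc n →L[ℝ] ℝ)
    (H : Euc n →L[ℝ] Euc n →L[ℝ] ℝ), (∀ᶠ y in 𝓝 z, HasFDerivAt V (V' y) y) ∧
      HasFDerivAt V' H z ∧
      ∑ i, H (EuclideanSpace.single i (1:ℝ)) (EuclideanSpace.single i (1:ℝ))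
        = - Kh z * V z ^ ((m + 2) / m)
  flat : ∀ z : Euc n, z j = 0 → ‖z‖ < L → ∃ G : Euc n →L[ℝ] ℝ,
    HasFDerivWithinAt V G {y | 0 ≤ y j} z ∧
      G (EuclideanSpace.single j (1:ℝ)) = c * V z ^ ((m + 1) / m)

theorem inv_mem {l L : ℝ} {z : Euc n} (hl : 0 < l) (hlL : l < L ^ 2) (hL : 0 < L)
    (hz : l ≤ ‖z‖ ^ 2) : ‖(l / ‖z‖ ^ 2) • z‖ ^ 2 ≤ l ∧ ‖(l / ‖z‖ ^ 2) • z‖ < L := by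
  have h1 : ‖(l / ‖z‖ ^ 2) • z‖ ^ 2 ≤ l := by
    have hN : 0 < ‖z‖ ^ 2 := lt_of_lt_of_le hl hz
    rw [norm_smul, mul_pow, Real.norm_of_nonneg (by positivity), div_pow]
    rw [show l ^ 2 / (‖z‖ ^ 2) ^ 2 * ‖z‖ ^ 2 = l * (l / ‖z‖ ^ 2) by field_simp]
    exact mul_le_of_le_one_right hl.le ((div_le_one hN).2 hz)
  exact ⟨h1, lt_of_pow_lt_pow_left₀ 2 hL.le (by linarith)⟩

theorem kel_rpow {m l x : ℝ} {V : Euc n → ℝ} {z : Euc n} (hm : 0 < m) (hl : 0 < l)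
    (hV : 0 < V ((l / ‖z‖ ^ 2) • z)) :
    kel m l V z ^ ((m + x) / m) =
      (l / ‖z‖ ^ 2) ^ (m + x) * V ((l / ‖z‖ ^ 2) • z) ^ ((m + x) / m) := by
  rw [kel, Real.mul_rpow (by positivity) hV.le, ← Real.rpow_mul (by positivity)]
  congr 2
  field_simp

set_option maxHeartbeats 1600000 in
theorem RescaledSol.moving_spheres {j : Fin n} {m c L : ℝ} {V Kh : Euc n → ℝ}
    (hV : RescaledSol n j m c L V Kh) (hm : (n : ℝ) = 2 * m + 2) (hm0 : 0 < m) (hL : 0 < L)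
    {l0 l1 Kmax μ Wmax : ℝ} (hl0 : 0 < l0) (hl1L : l1 < L ^ 2)
    (hμ : 0 < μ) (hWm : 0 < Wmax)
    (hK : ∀ z : Euc n, 0 < z j → ‖z‖ < L → 0 ≤ Kh z ∧ Kh z ≤ Kmax)
    (f : ℝ → Euc n → ℝ)
    (hf0 : ∀ l ∈ Icc l0 l1, ∀ z : Euc n, 0 ≤ z j → l ≤ ‖z‖ ^ 2 → ‖z‖ ≤ L → 0 ≤ f l z)
    (hfs : ∀ l ∈ Icc l0 l1, ∀ z : Euc n, 0 ≤ z j → ‖z‖ ^ 2 = l → f l z = 0)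
    (hfc : ContinuousOn (fun p : ℝ × Euc n => f p.1 p.2)
      {p | p.1 ∈ Icc l0 l1 ∧ 0 ≤ p.2 j ∧ p.1 ≤ ‖p.2‖ ^ 2 ∧ ‖p.2‖ ≤ L})
    (hfl : ∀ l ∈ Icc l0 l1, ∀ z : Euc n, 0 < z j → l < ‖z‖ ^ 2 → ‖z‖ < L → ∃ a ℓ,
      HasLap (f l) z a ℓ ∧
        (Kh ((l / ‖z‖ ^ 2) • z) - Kh z) * kel m l V z ^ ((m + 2) / m) + μ ≤ ℓ)
    (hfn : ∀ l ∈ Icc l0 l1, ∀ z : Euc n, z j = 0 → l < ‖z‖ ^ 2 → ‖z‖ < L → ∃ d,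
      HasNd (f l) (EuclideanSpace.single j (1:ℝ)) z d ∧ 0 ≤ d ∧
        c * ((kel m l V z + f l z) ^ ((m + 1) / m) - kel m l V z ^ ((m + 1) / m)) ≤ d)
    (hW : ∀ l ∈ Icc l0 l1, ∀ z : Euc n, 0 ≤ z j → l ≤ ‖z‖ ^ 2 → ‖z‖ ≤ L → kel m l V z ≤ Wmax)
    (hout : ∀ l ∈ Icc l0 l1, ∀ z : Euc n, 0 ≤ z j → ‖z‖ = L → kel m l V z + f l z < V z)
    (hstart : ∀ z : Euc n, 0 ≤ z j → l0 ≤ ‖z‖ ^ 2 → ‖z‖ ≤ L → kel m l0 V z + f l0 z ≤ V z)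
    {l : ℝ} (hl : l ∈ Icc l0 l1) {z : Euc n} (hz0 : 0 ≤ z j) (hz1 : l ≤ ‖z‖ ^ 2) (hz2 : ‖z‖ ≤ L) :
    kel m l V z + f l z ≤ V z := by
  set p : ℝ := (m + 2) / m with hp
  set q : ℝ := (m + 1) / m with hq
  have hp1 : 1 ≤ p := by rw [hp, le_div_iff₀ hm0]; linarith
  have hq1 : 1 ≤ q := by rw [hq, le_div_iff₀ hm0]; linarith
  set Bc : ℝ := |c| * q * Wmax ^ (q - 1) + 1 with hBc
  have hBc0 : 0 < Bc := by positivity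
  have hK0 : 0 ≤ |Kmax| := abs_nonneg _
  have hJ : 0 < |Kmax| * p * Wmax ^ (p - 1) + Bc ^ 2 := by positivity
  -- positivity of the Kelvin transform
  have hVi : ∀ l ∈ Icc l0 l1, ∀ z : Euc n, 0 ≤ z j → l ≤ ‖z‖ ^ 2 →
      0 < l ∧ 0 < ‖z‖ ^ 2 ∧ 0 ≤ ((l / ‖z‖ ^ 2) • z) j ∧ 
      ‖(l / ‖z‖ ^ 2) • z‖ < L ∧ 0 < V ((l / ‖z‖ ^ 2) • z) ∧ 0 < kel m l V z := by
    intro l hl z hz hzl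
    have hlp : 0 < l := lt_of_lt_of_le hl0 hl.1
    have hN : 0 < ‖z‖ ^ 2 := lt_of_lt_of_le hlp hzl
    have hi := inv_mem hlp (lt_of_le_of_lt hl.2 hl1L) hL hzl
    have h2 : 0 ≤ ((l / ‖z‖ ^ 2) • z) j := by
      rw [PiLp.smul_apply, smul_eq_mul]; positivity
    have h3 := hV.pos _ h2 hi.2.le
    exact ⟨hlp, hN, h2, hi.2, h3, mul_pos (by positivity) h3⟩
  suffices H : ∀ η, 0 < η → η * (|Kmax| * p * Wmax ^ (p - 1) + Bc ^ 2) < μ →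
      0 < V z - kel m l V z - f l z + η * Real.exp (- Bc * z j) by
    have ht : Tendsto (fun η : ℝ => V z - kel m l V z - f l z + η * Real.exp (- Bc * z j)) (𝓝[>] 0)
        (𝓝 (V z - kel m l V z - f l z + 0 * Real.exp (- Bc * z j))) := by
      refine Tendsto.mono_left ?_ nhdsWithin_le_nhds
      have : Continuous fun η : ℝ => V z - kel m l V z - f l z + η * Real.exp (- Bc * z j) := by
        fun_prop
      exact this.tendsto 0
    have ht2 : Tendsto (fun η : ℝ => η * (|Kmax| * p * Wmax ^ (p - 1) + Bc ^ 2)) (𝓝[>] 0)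
        (𝓝 (0 * (|Kmax| * p * Wmax ^ (p - 1) + Bc ^ 2))) :=
      (Continuous.tendsto (by fun_prop) 0).mono_left nhdsWithin_le_nhds
    have := ge_of_tendsto ht (b := 0) (by
      filter_upwards [self_mem_nhdsWithin, ht2.eventually (gt_mem_nhds (by simpa using hμ))]
        with η h1 h2 using (H η h1 h2).le)
    linarith
  intro η hη hημ
  set F : ℝ × Euc n → ℝ := fun x => V x.2 - kel m x.1 V x.2 - f x.1 x.2
    + η * Real.exp (- Bc * x.2 j) with hF
  set Q : Set (ℝ × Euc n) := {p | p.1 ∈ Icc l0 l1 ∧ 0 ≤ p.2 j ∧ p.1 ≤ ‖p.2‖ ^ 2 ∧ ‖p.2‖ ≤ L} with hQ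
  have hcj : Continuous fun p : ℝ × Euc n => p.2 j := by fun_prop
  have hQc : IsCompact Q := by
    have hc : IsCompact (Icc l0 l1 ×ˢ Metric.closedBall (0 : Euc n) L) :=
      isCompact_Icc.prod (isCompact_closedBall _ _)
    refine hc.of_isClosed_subset ?_ ?_
    · have : Q = {p : ℝ × Euc n | p.1 ∈ Icc l0 l1} ∩ ({p | 0 ≤ p.2 j} ∩
        ({p | p.1 ≤ ‖p.2‖ ^ 2} ∩ {p | ‖p.2‖ ≤ L})) := by
        ext p; simp [hQ]
      rw [this]
      refine (isClosed_Icc.preimage continuous_fst).inter ((isClosed_le continuous_const hcj).inter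
        ((isClosed_le continuous_fst (by fun_prop)).inter
          (isClosed_le (by fun_prop) continuous_const)))
    · rintro ⟨a, b⟩ hab
      exact ⟨hab.1, by simpa using hab.2.2.2⟩
  have hFc : ContinuousOn F Q := by
    have h1 : ContinuousOn (fun x : ℝ × Euc n => V x.2) Q :=
      hV.cont.comp continuous_snd.continuousOn fun x hx => ⟨hx.2.1, hx.2.2.2⟩
    have hr : ContinuousOn (fun x : ℝ × Euc n => x.1 / ‖x.2‖ ^ 2) Q :=
      continuous_fst.continuousOn.div (by fun_prop) fun x hx =>
        (hVi x.1 hx.1 x.2 hx.2.1 hx.2.2.1).2.1.ne'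
    have h2 : ContinuousOn (fun x : ℝ × Euc n => kel m x.1 V x.2) Q := by
      refine ContinuousOn.mul (hr.rpow_const fun x hx => Or.inr hm0.le) ?_
      refine hV.cont.comp (hr.smul continuous_snd.continuousOn) fun x hx => ?_
      obtain ⟨-, -, a, b, -⟩ := hVi x.1 hx.1 x.2 hx.2.1 hx.2.2.1
      exact ⟨a, b.le⟩
    exact ((h1.sub h2).sub hfc).add (by fun_prop)
  by_contra! hneg
  have hS : IsCompact {x ∈ Q | F x ≤ 0} := by
    have : {x ∈ Q | F x ≤ 0} = Q ∩ F ⁻¹' Iic 0 := rfl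
    rw [this]
    exact hQc.of_isClosed_subset (hFc.preimage_isClosed_of_isClosed hQc.isClosed isClosed_Iic)
      inter_subset_left
  obtain ⟨⟨lb, zb⟩, hmem, hmin⟩ := hS.exists_isMinOn ⟨(l, z), ⟨hl, hz0, hz1, hz2⟩, hneg⟩
    continuous_fst.continuousOn
  obtain ⟨⟨hlb, hzb0, hzb1, hzb2⟩, hFb⟩ := hmem
  simp only at hlb hzb0 hzb1 hzb2
  have hless : ∀ l' ∈ Icc l0 l1, l' < lb → ∀ z' : Euc n, 0 ≤ z' j → l' ≤ ‖z'‖ ^ 2 → ‖z'‖ ≤ L →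
      0 < F (l', z') := by
    intro l' hl' hlt z' a b c
    by_contra! h
    have := hmin (show (l', z') ∈ {x ∈ Q | F x ≤ 0} from ⟨⟨hl', a, b, c⟩, h⟩)
    simp only [mem_ofPred_eq] at this
    linarith
  have hexp : ∀ y : Euc n, 0 < Real.exp (- Bc * y j) := fun y => Real.exp_pos _
  have hlb0 : l0 < lb := by
    rcases hlb.1.eq_or_lt with h | h
    · exfalso
      subst h
      have := hstart zb hzb0 hzb1 hzb2
      have h2 := mul_pos hη (hexp zb)
      simp only [hF] at hFb
      linarith
    · exact h
  have hsph : ∀ z' : Euc n, 0 ≤ z' j → ‖z'‖ ^ 2 = lb → ‖z'‖ ≤ L → 0 < F (lb, z') := by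
    intro z' h1 h2 h3
    have h4 := hfs lb hlb z' h1 h2
    have h5 : kel m lb V z' = V z' := by
      have : lb / ‖z'‖ ^ 2 = 1 := by rw [h2]; exact div_self (by linarith)
      simp [kel, this]
    have := mul_pos hη (hexp z')
    simp only [hF, h4, h5]
    linarith
  have hslice : ∀ z' : Euc n, 0 ≤ z' j → lb ≤ ‖z'‖ ^ 2 → ‖z'‖ ≤ L → 0 ≤ F (lb, z') := by
    intro z' h1 h2 h3
    have hc : ContinuousOn (fun l' => F (l', z')) (Icc l0 lb) := by
      refine hFc.comp (by fun_prop) fun l' hl' => ?_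
      exact ⟨⟨hl'.1, hl'.2.trans hlb.2⟩, h1, hl'.2.trans h2, h3⟩
    have ht : Tendsto (fun l' => F (l', z')) (𝓝[Ico l0 lb] lb) (𝓝 (F (lb, z'))) :=
      (hc lb ⟨hlb0.le, le_rfl⟩).mono Ico_subset_Icc_self
    have hne : (𝓝[Ico l0 lb] lb).NeBot := by
      rw [← mem_closure_iff_nhdsWithin_neBot, closure_Ico hlb0.ne]
      exact ⟨hlb0.le, le_rfl⟩
    refine ge_of_tendsto ht ?_
    filter_upwards [self_mem_nhdsWithin] with l' hl'
    exact (hless l' ⟨hl'.1, hl'.2.le.trans hlb.2⟩ hl'.2 z' h1 (hl'.2.le.trans h2) h3).le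
  have hF0 : F (lb, zb) = 0 := le_antisymm hFb (hslice zb hzb0 hzb1 hzb2)
  have hN : lb < ‖zb‖ ^ 2 := by
    rcases hzb1.eq_or_lt with h | h
    · exact absurd hF0 (hsph zb hzb0 h.symm hzb2).ne'
    · exact h
  have hNL : ‖zb‖ < L := by
    rcases hzb2.eq_or_lt with h | h
    · have := hout lb hlb zb hzb0 h
      have h2 := mul_pos hη (hexp zb)
      simp only [hF] at hF0
      linarith
    · exact h
  obtain ⟨hlbp, hNp, hw0, hwL, hVw, hWp⟩ := hVi lb hlb zb hzb0 hzb1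
  have hzne : zb ≠ 0 := by rintro rfl; simp at hNp
  have hWle := hW lb hlb zb hzb0 hzb1 hzb2
  have hfle := hf0 lb hlb zb hzb0 hzb1 hzb2
  have hVp := hV.pos zb hzb0 hzb2
  have hexp1 : Real.exp (- Bc * zb j) ≤ 1 := by
    rw [Real.exp_le_one_iff]
    have := mul_nonneg hBc0.le hzb0
    linarith
  have hVW : kel m lb V zb - η ≤ V zb := by
    simp only [hF] at hF0
    have := mul_le_of_le_one_right hη.le hexp1
    linarith
  set W := kel m lb V zb with hWdef
  have hVW2 : V zb ≤ W + f lb zb := by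
    simp only [hF] at hF0
    have := mul_pos hη (hexp zb)
    linarith
  -- gradient inequality
  have htan : ∀ r : ℝ, 1 ≤ r → W ^ r - r * Wmax ^ (r - 1) * η ≤ V zb ^ r := by
    intro r hr
    have h1 := rpow_tangent hWp hVp hr
    have h2 : W ^ (r - 1) ≤ Wmax ^ (r - 1) := Real.rpow_le_rpow hWp.le hWle (by linarith)
    have h3 : 0 < W ^ (r - 1) := Real.rpow_pos_of_pos hWp _
    have h4 : r * W ^ (r - 1) * (-η) ≤ r * W ^ (r - 1) * (V zb - W) :=
      mul_le_mul_of_nonneg_left (by linarith) (by positivity)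
    have h5 : r * W ^ (r - 1) * η ≤ r * Wmax ^ (r - 1) * η := by gcongr
    linarith
  have hcz : Continuous fun y : Euc n => y j := by fun_prop
  rcases hzb0.eq_or_lt with hzj | hzj
  · -- flat boundary
    obtain ⟨G, hG, hGc⟩ := hV.flat zb hzj.symm hNL
    have hwj : ((lb / ‖zb‖ ^ 2) • zb) j = 0 := by
      rw [PiLp.smul_apply, ← hzj]; simp
    obtain ⟨Gw, hGw, hGwc⟩ := hV.flat _ hwj hwL
    obtain ⟨d, hd, hd0, hdc⟩ := hfn lb hlb zb hzj.symm hN hNL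
    have k1 : HasNd V (EuclideanSpace.single j (1:ℝ)) zb (c * V zb ^ q) := by
      rw [← hGc]
      unfold HasNd
      have hl' : HasDerivWithinAt (fun t : ℝ => zb + t • (EuclideanSpace.single j (1:ℝ) : Euc n))
          (EuclideanSpace.single j (1:ℝ)) (Ici 0) 0 := by
        simpa using (((hasDerivAt_id (0:ℝ)).smul_const
          (EuclideanSpace.single j (1:ℝ) : Euc n)).const_add zb).hasDerivWithinAt
      have hG' : HasFDerivWithinAt V G {y | 0 ≤ y j}
        (zb + (0:ℝ) • (EuclideanSpace.single j (1:ℝ) : Euc n)) := by simpa using hG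
      refine hG'.comp_hasDerivWithinAt 0 hl' ?_
      intro t ht
      have ht' : 0 ≤ t := ht
      simpa [← hzj] using ht'
    have k2 : HasNd (kel m lb V) (EuclideanSpace.single j (1:ℝ)) zb (c * W ^ q) := by
      have := HasNd.kel (m := m) hlbp hzne hzj.symm rfl hGw
      rw [hGwc] at this
      rw [hWdef, hq, kel_rpow hm0 hlbp hVw]
      convert this using 1
      ring
    have k3 : HasDerivWithinAt (fun t : ℝ => η * Real.exp (- Bc * t)) (η * (- Bc)) (Ici 0) 0 := by
      have := (((hasDerivAt_id (0:ℝ)).const_mul (-Bc)).exp.const_mul η).hasDerivWithinAt (s := Ici 0)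
      refine this.congr_deriv ?_
      simp
    have k4 := ((k1.sub k2).sub hd).add k3
    have hD := k4.nonneg_of_min (by
      have hct : Continuous fun t : ℝ => zb + t • (EuclideanSpace.single j (1:ℝ) : Euc n) := by
        fun_prop
      have e1 : ∀ᶠ t : ℝ in 𝓝[>] 0, ‖zb + t • (EuclideanSpace.single j (1:ℝ) : Euc n)‖ < L := by
        refine (hct.norm.tendsto 0).eventually (gt_mem_nhds (by simpa using hNL)) |>.filter_mono
          nhdsWithin_le_nhds
      filter_upwards [e1, self_mem_nhdsWithin] with t ht (ht0 : 0 < t)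
      have hcoord : (zb + t • (EuclideanSpace.single j (1:ℝ) : Euc n)) j = t := by
        simp [← hzj]
      have := hslice (zb + t • (EuclideanSpace.single j (1:ℝ) : Euc n)) (by rw [hcoord]; exact ht0.le)
        (by rw [norm_add_smul_single_sq, ← hzj]; linarith [sq_nonneg t]) ht.le
      simp only [hF] at this hF0
      rw [hcoord] at this
      rw [← hzj] at hF0
      simp only [Pi.add_apply, Pi.sub_apply, zero_smul, add_zero]
      rw [hF0]
      exact this)
    rcases le_or_gt c 0 with hc | hc
    · have h1 := htan q hq1
      have h2 : c * V zb ^ q ≤ c * (W ^ q - q * Wmax ^ (q - 1) * η) :=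
        mul_le_mul_of_nonpos_left h1 hc
      have h3 : |c| = -c := abs_of_nonpos hc
      rw [hBc, h3] at hD
      linarith
    · have h1 : V zb ^ q ≤ (W + f lb zb) ^ q := Real.rpow_le_rpow hVp.le hVW2 (by linarith)
      have h2 := mul_le_mul_of_nonneg_left h1 hc.le
      linarith [mul_pos hη hBc0]
  · -- interior
    obtain ⟨V', H, hV', hH, htr⟩ := hV.hess zb hzj hNL
    have hwj : 0 < ((lb / ‖zb‖ ^ 2) • zb) j := by
      rw [PiLp.smul_apply, smul_eq_mul]; positivity
    obtain ⟨Vw', Hw, hVw', hHw, htrw⟩ := hV.hess _ hwj hwL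
    obtain ⟨a, ℓ, hℓ, hℓb⟩ := hfl lb hlb zb hzj hN hNL
    obtain ⟨a2, k2⟩ := HasLap.kel hm hlbp hzne rfl hVw' hHw
    have k1 := HasLap.of_hessian hV' hH
    have k3 := (HasLap.coord (z := zb) j (-Bc)).exp.const_mul η
    have k4 := (((k1.sub k2).sub hℓ).add k3).nonneg_of_min (by
      have e1 : ∀ᶠ y : Euc n in 𝓝 zb, ‖y‖ < L :=
        (continuous_norm.tendsto zb).eventually (gt_mem_nhds hNL)
      have e2 : ∀ᶠ y : Euc n in 𝓝 zb, lb < ‖y‖ ^ 2 :=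
        ((continuous_norm.pow 2).tendsto zb).eventually (lt_mem_nhds hN)
      have e3 : ∀ᶠ y : Euc n in 𝓝 zb, 0 < y j :=
        (hcz.tendsto zb).eventually (lt_mem_nhds hzj)
      filter_upwards [e1, e2, e3] with y h1 h2 h3
      have := hslice y h3.le h2.le h1.le
      simp only [hF] at this hF0
      rw [hF0]
      exact this)
    rw [htr, htrw] at k4
    have e5 : (lb / ‖zb‖ ^ 2) ^ (m + 2) * (-Kh ((lb / ‖zb‖ ^ 2) • zb) *
        V ((lb / ‖zb‖ ^ 2) • zb) ^ ((m + 2) / m)) = - Kh ((lb / ‖zb‖ ^ 2) • zb) * W ^ p := by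
      rw [hWdef, hp, kel_rpow hm0 hlbp hVw]; ring
    rw [e5] at k4
    have e6 : ∑ i, (-Bc * (EuclideanSpace.single i (1:ℝ) : Euc n) j) ^ 2 = Bc ^ 2 := by
      simp only [PiLp.single_apply, mul_ite, mul_one, mul_zero]
      rw [Finset.sum_eq_single j]
      · simp
      · intro i _ hi; simp [Ne.symm hi]
      · simp
    rw [e6] at k4
    obtain ⟨hKz0, hKz1⟩ := hK zb hzj hNL
    have h1 := htan p hp1
    have h2 : Kh zb * (W ^ p - p * Wmax ^ (p - 1) * η) ≤ Kh zb * V zb ^ p :=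
      mul_le_mul_of_nonneg_left h1 hKz0
    have h3 : Kh zb * (p * Wmax ^ (p - 1) * η) ≤ |Kmax| * (p * Wmax ^ (p - 1) * η) := by
      have := le_abs_self Kmax
      gcongr
      linarith
    have h4 : η * (Real.exp (-Bc * zb j) * 0 + Real.exp (-Bc * zb j) * Bc ^ 2) ≤ η * Bc ^ 2 := by
      rw [mul_zero, zero_add]
      exact mul_le_mul_of_nonneg_left (mul_le_of_le_one_left (by positivity) hexp1) hη.le
    linarith

end

section

variable {n : ℕ}

theorem HasLap.of_eq {f g : Euc n → ℝ} {z : Euc n} {a : Fin n → ℝ} {ℓ ℓ' : ℝ}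
    (h : HasLap f z a ℓ) (hfg : ∀ y, g y = f y) (hl : ℓ = ℓ') : ∃ a, HasLap g z a ℓ' := by
  have : g = f := funext hfg
  subst this hl
  exact ⟨a, h⟩

theorem rpow_sub_two' {x : ℝ} (hx : 0 < x) (r : ℝ) : x ^ (r - 2) = x ^ r / x ^ 2 := by
  have := Real.rpow_sub_natCast hx.ne' r 2
  simpa using this

theorem HasLap.norm_rpow {z : Euc n} {m : ℝ} (hm : (n : ℝ) = 2 * m + 2) (hz : 0 < ‖z‖ ^ 2)
    (s : ℝ) : ∃ a, HasLap (fun y : Euc n => (‖y‖ ^ 2) ^ (-s)) z a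
      (4 * s * (s - m) * (‖z‖ ^ 2) ^ (-s - 1)) := by
  refine ((HasLap.normSq (z := z) 0 0).rpow (by simpa using hz) (-s)).of_eq
    (fun y => by simp) ?_
  simp only [sub_zero, zero_add, mul_pow]
  rw [← Finset.mul_sum, Euc.sum_sq, rpow_sub_two' hz, Real.rpow_sub_one hz.ne', hm]
  field_simp
  ring

theorem HasLap.quad_mul_rpow {z z0 : Euc n} (b l k : ℝ) (hT : 0 < b + ‖z - z0‖ ^ 2) :
    ∃ a, HasLap (fun y : Euc n => (‖y‖ ^ 2 - l) * (b + ‖y - z0‖ ^ 2) ^ (-k)) z a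
      ((b + ‖z - z0‖ ^ 2) ^ (-k - 2) *
        ((b + ‖z - z0‖ ^ 2) * (2 * n * (b + ‖z - z0‖ ^ 2)
          - 4 * k * ((b + ‖z - z0‖ ^ 2) - b + (l - ‖z0‖ ^ 2)))
        + 2 * k * (2 * k - n) * (‖z‖ ^ 2 - l) * (b + ‖z - z0‖ ^ 2)
        - 4 * k * (k + 1) * b * (‖z‖ ^ 2 - l))) := by
  refine ((HasLap.normSq (z := z) 0 (-l)).mul ((HasLap.normSq (z := z) z0 b).rpow hT (-k))).of_eq
    (fun y => by simp; left; ring) ?_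
  simp only [sub_zero, mul_pow]
  have h1 : ∑ i, 2 * z i * (-k * (b + ‖z - z0‖ ^ 2) ^ (-k - 1) * (2 * (z - z0) i))
      = -4 * k * (b + ‖z - z0‖ ^ 2) ^ (-k - 1) * inner ℝ z (z - z0) := by
    rw [← Euc.sum_mul, Finset.mul_sum]
    refine Finset.sum_congr rfl fun i _ => ?_
    ring
  have h2 : inner ℝ z (z - z0) = (‖z‖ ^ 2 + ‖z - z0‖ ^ 2 - ‖z0‖ ^ 2) / 2 := by
    rw [norm_sub_sq_real, inner_sub_right, real_inner_self_eq_norm_sq]; ring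
  rw [h1, h2, ← Finset.mul_sum, Euc.sum_sq]
  set T := b + ‖z - z0‖ ^ 2 with hTd
  have hw : ‖z - z0‖ ^ 2 = T - b := by rw [hTd]; ring
  rw [hw, rpow_sub_two' hT, Real.rpow_sub_one hT.ne']
  have hk : T ^ (-k) = T ^ (-k) / T ^ 2 * T ^ 2 := by field_simp
  rw [show T ^ (-k) / T = T ^ (-k) / T ^ 2 * T by field_simp]
  nth_rewrite 1 [hk]
  ring

/-- The barrier function used in the moving sphere argument. -/
def barrier (m β h0 A1 A2 : ℝ) (z0 : Euc n) (l : ℝ) (z : Euc n) : ℝ :=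
  h0 * ((‖z‖ ^ 2 - l) * (4 + ‖z - z0‖ ^ 2) ^ (-(m + 1))
      - (‖z‖ ^ 2 - l) * (4 + ‖z - z0‖ ^ 2) ^ (-(m + 1 + β)))
    - A1 * (l ^ (-(1/2) : ℝ) * (‖z‖ ^ 2) ^ (-m) - (‖z‖ ^ 2) ^ (-(m + 1/2)))
    - A2 * (l ^ (-β) * (‖z‖ ^ 2) ^ (-m) - (‖z‖ ^ 2) ^ (-(m + β)))

/-- The constraints on the parameters of the barrier. -/
structure BarrierParams (m β h0 A1 A2 R c1 : ℝ) : Prop where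
  m1 : 1 ≤ m
  β0 : 0 < β
  β1 : β ≤ 1/2
  R1 : 1 ≤ R
  h00 : 0 < h0
  A10 : 0 < A1
  A2eq : A2 = 3 * 18 ^ (m + 3) * h0
  near : h0 * β * (16 * (m + 1) * (m + 2) + 4 * (m + 2)) ≤ c1 / (12 * R)
  far : h0 * (16 * (m + 1) * (m + 2)) * 18 ^ (m + 3) ≤ A1
  pos : A1 / R + A2 * R ^ (-(2 * β)) ≤ (1/4) * h0 * 10 ^ (-(m + 1))
  pos' : (1/4) * 10 ^ (-(m + 1)) * R ^ (-(2 * (m + 1)))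
    ≤ (1/2) * (1 - 4 ^ (-β)) * 2 ^ (-((m + 1) / β))

theorem rpow_neg_facts {T β : ℝ} (hT : 4 ≤ T) (hβ : 0 < β) :
    0 < T ^ (-β) ∧ T ^ (-β) ≤ 1 ∧ 1 - T ^ (-β) ≤ β * T ∧ T ^ (-β) * (1 + β) ≤ 1 := by
  have hT0 : 0 < T := by linarith
  have hlog : 1 ≤ Real.log T := by
    rw [Real.le_log_iff_exp_le hT0]
    have := Real.exp_one_lt_d9
    linarith
  have hx : T ^ (-β) = Real.exp (-(β * Real.log T)) := by
    rw [Real.rpow_def_of_pos hT0]; ring_nf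
  have h1 := Real.add_one_le_exp (-(β * Real.log T))
  have h2 := Real.add_one_le_exp (β * Real.log T)
  have h3 : Real.log T ≤ T := by have := Real.log_le_sub_one_of_pos hT0; linarith
  refine ⟨by positivity, Real.rpow_le_one_of_one_le_of_nonpos (by linarith) (by linarith), ?_, ?_⟩
  · rw [hx]; nlinarith
  · rw [hx, Real.exp_neg]
    rw [inv_mul_le_iff₀ (Real.exp_pos _)]
    nlinarith

set_option maxHeartbeats 1600000 in
theorem BarrierParams.lap_ge {m β h0 A1 A2 R c1 : ℝ} (hb : BarrierParams m β h0 A1 A2 R c1)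
    (hm : (n : ℝ) = 2 * m + 2) {z z0 : Euc n} {l E : ℝ} (hl1 : 1 ≤ l) (hlN : l ≤ ‖z‖ ^ 2)
    (hla : l - ‖z0‖ ^ 2 ≤ 4)
    (hE : E ≤ - (‖z‖ ^ 2 - l) / (12 * R) * c1 * (4 + ‖z - z0‖ ^ 2) ^ (-(m + 2)) ∨
      (‖z‖ ^ 2 ≤ 18 * (4 + ‖z - z0‖ ^ 2) ∧ E ≤ A1 * (‖z‖ ^ 2) ^ (-(m + 3/2)))) :
    ∃ a ℓ, HasLap (barrier m β h0 A1 A2 z0 l) z a ℓ ∧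
      E + A1 * (‖z‖ ^ 2) ^ (-(m + 3/2)) ≤ ℓ := by
  have hN : 0 < ‖z‖ ^ 2 := by linarith
  have hT4 : 4 ≤ 4 + ‖z - z0‖ ^ 2 := by have := sq_nonneg ‖z - z0‖; linarith
  have hT : 0 < 4 + ‖z - z0‖ ^ 2 := by linarith
  obtain ⟨a1, k1⟩ := HasLap.quad_mul_rpow 4 l (m + 1) hT
  obtain ⟨a2, k2⟩ := HasLap.quad_mul_rpow 4 l (m + 1 + β) hT
  obtain ⟨a3, k3⟩ := HasLap.norm_rpow hm hN m
  obtain ⟨a4, k4⟩ := HasLap.norm_rpow hm hN (m + 1/2)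
  obtain ⟨a5, k5⟩ := HasLap.norm_rpow hm hN (m + β)
  refine ⟨_, _, (((k1.sub k2).const_mul h0).sub (((k3.const_mul (l ^ (-(1/2) : ℝ))).sub
    k4).const_mul A1)).sub (((k3.const_mul (l ^ (-β))).sub k5).const_mul A2), ?_⟩
  clear k1 k2 k3 k4 k5
  set T := 4 + ‖z - z0‖ ^ 2 with hTd
  set N := ‖z‖ ^ 2 with hNd
  obtain ⟨hx0, hx1, hx2, hx3⟩ := rpow_neg_facts hT4 hb.β0
  have hm1 := hb.m1
  have hβ0 := hb.β0
  have hβ1 := hb.β1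
  have hh0 := hb.h00
  have hR1 := hb.R1
  have hA1 := hb.A10
  set x := T ^ (-β) with hxd
  have hP0 : 0 < T ^ (-(m + 3)) := by positivity
  have e1 : T ^ (-(m + 1) - 2) = T ^ (-(m + 3)) := by ring_nf
  have e2 : T ^ (-(m + 1 + β) - 2) = T ^ (-(m + 3)) * x := by
    rw [hxd, ← Real.rpow_add hT]; ring_nf
  have e3 : T ^ (-(m + 2)) = T ^ (-(m + 3)) * T := by
    rw [← Real.rpow_add_one hT.ne']; ring_nf
  rw [e1, e2, hm]
  rw [e3] at hE
  set P := T ^ (-(m + 3)) with hPd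
  have e4 : N ^ (-(m + 1/2) - 1) = N ^ (-(m + 3/2)) := by ring_nf
  rw [e4]
  set Y := N ^ (-(m + 3/2)) with hY
  have hY0 : 0 < Y := by positivity
  have hZ0 : 0 < N ^ (-(m + β) - 1) := by positivity
  set Z := N ^ (-(m + β) - 1) with hZ
  have hA20 : 0 < A2 := by rw [hb.A2eq]; positivity
  -- the main term
  have key : -(h0 * (N - l) * P * (16 * (m + 1) * (m + 2) * (1 - x) + 4 * (m + 1 + β) * β * (T * x)))
      ≤ h0 * (P * (T * (2 * (2 * m + 2) * T - 4 * (m + 1) * (T - 4 + (l - ‖z0‖ ^ 2))) +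
              2 * (m + 1) * (2 * (m + 1) - (2 * m + 2)) * (N - l) * T -
            4 * (m + 1) * (m + 1 + 1) * 4 * (N - l)) -
        P * x * (T * (2 * (2 * m + 2) * T - 4 * (m + 1 + β) * (T - 4 + (l - ‖z0‖ ^ 2))) +
              2 * (m + 1 + β) * (2 * (m + 1 + β) - (2 * m + 2)) * (N - l) * T -
            4 * (m + 1 + β) * (m + 1 + β + 1) * 4 * (N - l))) := by
    have h1 : 0 ≤ (m + 1) - (m + 1 + β) * x := by nlinarith
    have h2 : 0 ≤ h0 * (P * T) * (4 * (4 - (l - ‖z0‖ ^ 2)) * ((m + 1) - (m + 1 + β) * x)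
        + 4 * β * T * x) := by
      have h3 : 0 ≤ 4 - (l - ‖z0‖ ^ 2) := by linarith
      positivity
    have h4 : 0 ≤ h0 * (16 * (N - l) * P * x) * ((m + 1 + β) * (m + 1 + β + 1)
        - (m + 1) * (m + 2)) := by
      have h5 : 0 ≤ N - l := by linarith
      have h6 : 0 ≤ (m + 1 + β) * (m + 1 + β + 1) - (m + 1) * (m + 2) := by nlinarith
      positivity
    refine le_of_sub_nonneg ?_
    refine (add_nonneg h2 h4).trans_eq ?_
    ring
  have hA1term : 3 * (A1 * Y) ≤ A1 * (4 * (m + 1/2) * (m + 1/2 - m) * Y) := by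
    have : 0 ≤ A1 * Y * (m - 1) := mul_nonneg (by positivity) (by linarith)
    linarith
  have hA2term : A2 * (4 * m * β * Z) ≤ A2 * (4 * (m + β) * (m + β - m) * Z) := by
    have : 0 ≤ A2 * Z * (β * β) := by positivity
    linarith
  have hA2pos : 0 ≤ A2 * (4 * m * β * Z) := by positivity
  suffices hmain : E + A1 * Y + h0 * (N - l) * P *
      (16 * (m + 1) * (m + 2) * (1 - x) + 4 * (m + 1 + β) * β * (T * x))
      ≤ 3 * (A1 * Y) + A2 * (4 * m * β * Z) by
    rw [show (m - m : ℝ) = 0 by ring]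
    linarith
  have hq : 0 ≤ N - l := by linarith
  have hAY : 0 ≤ A1 * Y := by positivity
  rcases hE with hE | ⟨hNT, hE⟩
  · have h1 : 16 * (m + 1) * (m + 2) * (1 - x) + 4 * (m + 1 + β) * β * (T * x)
        ≤ β * T * (16 * (m + 1) * (m + 2) + 4 * (m + 2)) := by
      have h2 : 16 * (m + 1) * (m + 2) * (1 - x) ≤ 16 * (m + 1) * (m + 2) * (β * T) := by gcongr
      have h3 : 4 * (m + 1 + β) * β * (T * x) ≤ 4 * (m + 2) * β * (T * 1) := by
        have hk : 4 * (m + 1 + β) * β ≤ 4 * (m + 2) * β :=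
          mul_le_mul_of_nonneg_right (by linarith) hβ0.le
        have hTx : T * x ≤ T * 1 := mul_le_mul_of_nonneg_left hx1 hT.le
        exact mul_le_mul hk hTx (by positivity) (by positivity)
      linarith
    have h4 : h0 * (N - l) * P * (16 * (m + 1) * (m + 2) * (1 - x) + 4 * (m + 1 + β) * β * (T * x))
        ≤ h0 * (N - l) * P * (β * T * (16 * (m + 1) * (m + 2) + 4 * (m + 2))) := by gcongr
    have h5 := mul_le_mul_of_nonneg_left hb.near (show 0 ≤ (N - l) * (P * T) by positivity)
    have h6 : -(N - l) / (12 * R) * c1 * (P * T) = - ((N - l) * (P * T) * (c1 / (12 * R))) := by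
      field_simp
    linarith
  · have h18 : (0:ℝ) < 18 ^ (m + 3) := by positivity
    have hTN : ∀ r : ℝ, 0 ≤ r → T ^ (-r) ≤ 18 ^ r * N ^ (-r) := by
      intro r hr
      have h1 : N ^ r ≤ (18 * T) ^ r := Real.rpow_le_rpow hN.le hNT hr
      rw [Real.mul_rpow (by norm_num) hT.le] at h1
      rw [Real.rpow_neg hT.le, Real.rpow_neg hN.le]
      have h2 : 0 < T ^ r := by positivity
      have h3 : 0 < N ^ r := by positivity
      rw [← div_eq_mul_inv, inv_eq_one_div, div_le_div_iff₀ h2 h3]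
      linarith
    have t1 : h0 * (N - l) * P * (16 * (m + 1) * (m + 2) * (1 - x)) ≤ A1 * Y := by
      have h1 := hTN (m + 3) (by linarith)
      have h2 : N * N ^ (-(m + 3)) ≤ Y := by
        rw [mul_comm, ← Real.rpow_add_one hN.ne', hY]
        exact Real.rpow_le_rpow_of_exponent_le (by linarith) (by linarith)
      calc h0 * (N - l) * P * (16 * (m + 1) * (m + 2) * (1 - x))
          ≤ h0 * N * (18 ^ (m + 3) * N ^ (-(m + 3))) * (16 * (m + 1) * (m + 2) * 1) := by
            gcongr
            · linarith
            · linarith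
        _ = h0 * (16 * (m + 1) * (m + 2)) * 18 ^ (m + 3) * (N * N ^ (-(m + 3))) := by ring
        _ ≤ A1 * Y := by
            have := hb.far
            gcongr
    have t2 : h0 * (N - l) * P * (4 * (m + 1 + β) * β * (T * x)) ≤ A2 * (4 * m * β * Z) := by
      have h1 : P * (T * x) ≤ 18 ^ (m + 3) * N ^ (-(m + 2 + β)) := by
        have e : P * (T * x) = T ^ (-(m + 2 + β)) := by
          rw [← mul_assoc, ← e3, hxd, ← Real.rpow_add hT]; ring_nf
        rw [e]
        refine (hTN (m + 2 + β) (by linarith)).trans ?_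
        exact mul_le_mul_of_nonneg_right
          (Real.rpow_le_rpow_of_exponent_le (by norm_num) (by linarith)) (by positivity)
      have h2 : N * N ^ (-(m + 2 + β)) = Z := by
        rw [mul_comm, ← Real.rpow_add_one hN.ne', hZ]; ring_nf
      calc h0 * (N - l) * P * (4 * (m + 1 + β) * β * (T * x))
          = h0 * (N - l) * (4 * (m + 1 + β) * β) * (P * (T * x)) := by ring
        _ ≤ h0 * N * (4 * (3 * m) * β) * (18 ^ (m + 3) * N ^ (-(m + 2 + β))) := by
            have hk : 4 * (m + 1 + β) * β ≤ 4 * (3 * m) * β :=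
              mul_le_mul_of_nonneg_right (by linarith) hβ0.le
            have hn : h0 * (N - l) ≤ h0 * N := mul_le_mul_of_nonneg_left (by linarith) hh0.le
            exact mul_le_mul (mul_le_mul hn hk (by positivity) (by positivity)) h1
              (by positivity) (by positivity)
        _ = A2 * (4 * m * β * (N * N ^ (-(m + 2 + β)))) := by rw [hb.A2eq]; ring
        _ = _ := by rw [h2]
    linarith

end

section

variable {n : ℕ}

theorem rpow_diff_bounds {l N m σ : ℝ} (hl : 0 < l) (hlN : l ≤ N) (hσ : 0 < σ) (hσ1 : σ ≤ 1) :
    0 ≤ l ^ (-σ) * N ^ (-m) - N ^ (-(m + σ)) ∧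
      l ^ (-σ) * N ^ (-m) - N ^ (-(m + σ)) ≤ l ^ (-σ) * (N ^ (-(m + 1)) * (N - l)) := by
  have hN : 0 < N := hl.trans_le hlN
  have e1 : N ^ (-(m + σ)) = N ^ (-σ) * N ^ (-m) := by
    rw [← Real.rpow_add hN]; ring_nf
  have e2 : N ^ (-(m + 1)) = N ^ (-m) / N := by
    rw [← Real.rpow_sub_one hN.ne']; ring_nf
  have hm : 0 < N ^ (-m) := by positivity
  have h1 : N ^ (-σ) ≤ l ^ (-σ) := Real.rpow_le_rpow_of_nonpos hl hlN (by linarith)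
  have h2 : l ^ (-σ) * (l / N) ≤ N ^ (-σ) := by
    have h3 : l / N ≤ (l / N) ^ σ := by
      have := Real.rpow_le_rpow_of_exponent_ge (div_pos hl hN) ((div_le_one hN).2 hlN) hσ1
      simpa using this
    calc l ^ (-σ) * (l / N) ≤ l ^ (-σ) * (l / N) ^ σ := by gcongr
      _ = N ^ (-σ) := by
        rw [Real.div_rpow hl.le hN.le, Real.rpow_neg hl.le, Real.rpow_neg hN.le]
        have : 0 < l ^ σ := by positivity
        field_simp
  rw [e1, e2]
  refine ⟨by nlinarith, ?_⟩
  have : l ^ (-σ) * (N ^ (-m) / N * (N - l)) = l ^ (-σ) * N ^ (-m) - l ^ (-σ) * (l / N) * N ^ (-m) := by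
    field_simp
  rw [this]
  nlinarith

theorem BarrierParams.bounds {m β h0 A1 A2 R c1 : ℝ} (hb : BarrierParams m β h0 A1 A2 R c1)
    {z z0 : Euc n} {l : ℝ} (hlR : R ^ 2 ≤ l) (hlN : l ≤ ‖z‖ ^ 2)
    (hTN : 4 + ‖z - z0‖ ^ 2 ≤ 10 * ‖z‖ ^ 2) :
    0 ≤ barrier m β h0 A1 A2 z0 l z ∧ barrier m β h0 A1 A2 z0 l z ≤
      h0 * (‖z‖ ^ 2 - l) * (4 + ‖z - z0‖ ^ 2) ^ (-(m + 1)) *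
        (1 - (4 + ‖z - z0‖ ^ 2) ^ (-β)) := by
  have hm1 := hb.m1
  have hβ0 := hb.β0
  have hβ1 := hb.β1
  have hh0 := hb.h00
  have hR1 := hb.R1
  have hA1 := hb.A10
  have hA2 : 0 < A2 := by rw [hb.A2eq]; positivity
  have hR0 : 0 < R := by linarith
  have hl : 0 < l := lt_of_lt_of_le (by positivity) hlR
  have hN : 0 < ‖z‖ ^ 2 := by linarith
  have hT4 : 4 ≤ 4 + ‖z - z0‖ ^ 2 := by have := sq_nonneg ‖z - z0‖; linarith
  have hT : 0 < 4 + ‖z - z0‖ ^ 2 := by linarith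
  obtain ⟨u0, u1⟩ := rpow_diff_bounds (m := m) hl hlN (σ := 1/2) (by norm_num) (by norm_num)
  obtain ⟨w0, w1⟩ := rpow_diff_bounds (m := m) hl hlN hβ0 (by linarith)
  unfold barrier
  set T := 4 + ‖z - z0‖ ^ 2 with hTd
  set N := ‖z‖ ^ 2 with hNd
  have hq : 0 ≤ N - l := by linarith
  obtain ⟨hx0, hx1, hx2, hx3⟩ := rpow_neg_facts hT4 hb.β0
  have e1 : T ^ (-(m + 1 + β)) = T ^ (-(m + 1)) * T ^ (-β) := by
    rw [← Real.rpow_add hT]; ring_nf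
  rw [e1]
  set x := T ^ (-β) with hxd
  set P := T ^ (-(m + 1)) with hPd
  have hP : 0 < P := by positivity
  set w := l ^ (-(1/2) : ℝ) * N ^ (-m) - N ^ (-(m + 1/2)) with hw
  set w' := l ^ (-β) * N ^ (-m) - N ^ (-(m + β)) with hw'
  have a1 : 0 ≤ A1 * w := mul_nonneg hA1.le u0
  have a2 : 0 ≤ A2 * w' := mul_nonneg hA2.le w0
  refine ⟨?_, by linarith⟩
  have b1 : l ^ (-(1/2) : ℝ) ≤ R⁻¹ := by
    calc l ^ (-(1/2) : ℝ) ≤ (R ^ 2) ^ (-(1/2) : ℝ) :=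
          Real.rpow_le_rpow_of_nonpos (by positivity) hlR (by norm_num)
      _ = R⁻¹ := by
          rw [← Real.rpow_natCast, ← Real.rpow_mul hR0.le, ← Real.rpow_neg_one]; norm_num
  have b2 : l ^ (-β) ≤ R ^ (-(2 * β)) := by
    calc l ^ (-β) ≤ (R ^ 2) ^ (-β) :=
          Real.rpow_le_rpow_of_nonpos (by positivity) hlR (by linarith)
      _ = _ := by
          rw [← Real.rpow_natCast, ← Real.rpow_mul hR0.le]; congr 1; push_cast; ring
  have hNq : 0 ≤ N ^ (-(m + 1)) * (N - l) := by positivity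
  have c1 : A1 * w ≤ A1 * (R⁻¹ * (N ^ (-(m + 1)) * (N - l))) :=
    mul_le_mul_of_nonneg_left (u1.trans (mul_le_mul_of_nonneg_right b1 hNq)) hA1.le
  have c2 : A2 * w' ≤ A2 * (R ^ (-(2 * β)) * (N ^ (-(m + 1)) * (N - l))) :=
    mul_le_mul_of_nonneg_left (w1.trans (mul_le_mul_of_nonneg_right b2 hNq)) hA2.le
  have c3 := mul_le_mul_of_nonneg_right hb.pos hNq
  have c4 : A1 * w + A2 * w' ≤ 1/4 * h0 * 10 ^ (-(m + 1)) * (N ^ (-(m + 1)) * (N - l)) := by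
    rw [div_eq_mul_inv] at c3
    linarith
  suffices hs : 1/4 * h0 * 10 ^ (-(m + 1)) * (N ^ (-(m + 1)) * (N - l))
      ≤ h0 * (N - l) * (P * (1 - x)) by linarith
  suffices hs : 1/4 * 10 ^ (-(m + 1)) * N ^ (-(m + 1)) ≤ P * (1 - x) by
    have := mul_le_mul_of_nonneg_left hs (show 0 ≤ h0 * (N - l) by positivity)
    linarith
  rcases le_or_gt x (1/2) with hx | hx
  · have h1 : (10:ℝ) ^ (-(m + 1)) * N ^ (-(m + 1)) ≤ P := by
      rw [← Real.mul_rpow (by norm_num) hN.le]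
      exact Real.rpow_le_rpow_of_nonpos hT hTN (by linarith)
    nlinarith
  · have h1 : T ≤ 2 ^ (1 / β) := by
      by_contra hcon
      push Not at hcon
      have : x ≤ (2 ^ (1 / β) : ℝ) ^ (-β) :=
        Real.rpow_le_rpow_of_nonpos (by positivity) hcon.le (by linarith)
      rw [← Real.rpow_mul (by norm_num), show 1 / β * -β = -1 by field_simp,
        Real.rpow_neg_one] at this
      linarith
    have h2 : (2:ℝ) ^ (-((m + 1) / β)) ≤ P := by
      have : ((2:ℝ) ^ (1 / β)) ^ (-(m + 1)) ≤ P := Real.rpow_le_rpow_of_nonpos hT h1 (by linarith)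
      rw [← Real.rpow_mul (by norm_num)] at this
      rwa [show 1 / β * -(m + 1) = -((m + 1) / β) by field_simp] at this
    have h3 : x ≤ 4 ^ (-β) := Real.rpow_le_rpow_of_nonpos (by norm_num) hT4 (by linarith)
    have h4 : N ^ (-(m + 1)) ≤ R ^ (-(2 * (m + 1))) := by
      calc N ^ (-(m + 1)) ≤ (R ^ 2) ^ (-(m + 1)) :=
            Real.rpow_le_rpow_of_nonpos (by positivity) (hlR.trans hlN) (by linarith)
        _ = _ := by
          rw [← Real.rpow_natCast, ← Real.rpow_mul hR0.le]; congr 1; push_cast; ring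
    have h5 : 0 ≤ 1 - (4:ℝ) ^ (-β) := by
      have := Real.rpow_le_one_of_one_le_of_nonpos (show (1:ℝ) ≤ 4 by norm_num)
        (show -β ≤ 0 by linarith)
      linarith
    have h10 : (0:ℝ) < 10 ^ (-(m + 1)) := by positivity
    calc 1/4 * 10 ^ (-(m + 1)) * N ^ (-(m + 1)) ≤ 1/4 * 10 ^ (-(m + 1)) * R ^ (-(2 * (m + 1))) := by
          gcongr
      _ ≤ (1/2) * (1 - 4 ^ (-β)) * 2 ^ (-((m + 1) / β)) := hb.pos'
      _ ≤ 1 * (1 - 4 ^ (-β)) * P := by gcongr; norm_num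
      _ ≤ 1 * (1 - x) * P := by gcongr
      _ = _ := by ring

theorem BarrierParams.le_simple {m β h0 A1 A2 R c1 : ℝ} (hb : BarrierParams m β h0 A1 A2 R c1)
    {z z0 : Euc n} {l : ℝ} (hlR : R ^ 2 ≤ l) (hlN : l ≤ ‖z‖ ^ 2)
    (hTN : 4 + ‖z - z0‖ ^ 2 ≤ 10 * ‖z‖ ^ 2) :
    barrier m β h0 A1 A2 z0 l z ≤ h0 * (‖z‖ ^ 2 - l) * (4 + ‖z - z0‖ ^ 2) ^ (-(m + 1)) := by
  refine (hb.bounds hlR hlN hTN).2.trans ?_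
  have hT4 : 4 ≤ 4 + ‖z - z0‖ ^ 2 := by have := sq_nonneg ‖z - z0‖; linarith
  have hx := (rpow_neg_facts hT4 hb.β0).1
  have hh := hb.h00
  refine mul_le_of_le_one_right ?_ (by linarith)
  have : 0 ≤ ‖z‖ ^ 2 - l := by linarith
  positivity

theorem barrier_eq_zero {m β h0 A1 A2 : ℝ} {z z0 : Euc n} {l : ℝ} (hl : 0 < l)
    (hz : ‖z‖ ^ 2 = l) : barrier m β h0 A1 A2 z0 l z = 0 := by
  unfold barrier
  rw [hz, ← Real.rpow_add hl, ← Real.rpow_add hl]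
  rw [show -(1/2) + -m = -(m + 1/2) by ring, show -β + -m = -(m + β) by ring]
  ring

theorem barrier_continuousOn {m β h0 A1 A2 : ℝ} {z0 : Euc n} {S : Set (ℝ × Euc n)}
    (hS : ∀ p ∈ S, 0 < p.1 ∧ p.1 ≤ ‖p.2‖ ^ 2) :
    ContinuousOn (fun p : ℝ × Euc n => barrier m β h0 A1 A2 z0 p.1 p.2) S := by
  have hT : ∀ k : ℝ, Continuous fun p : ℝ × Euc n => (4 + ‖p.2 - z0‖ ^ 2) ^ k := fun k =>
    Continuous.rpow_const (by fun_prop) fun p => Or.inl (by positivity)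
  have hN : ∀ k : ℝ, ContinuousOn (fun p : ℝ × Euc n => (‖p.2‖ ^ 2) ^ k) S := fun k =>
    ContinuousOn.rpow_const (by fun_prop) fun p hp =>
      Or.inl (lt_of_lt_of_le (hS p hp).1 (hS p hp).2).ne'
  have hl : ∀ k : ℝ, ContinuousOn (fun p : ℝ × Euc n => p.1 ^ k) S := fun k =>
    ContinuousOn.rpow_const (by fun_prop) fun p hp => Or.inl (hS p hp).1.ne'
  have hq : Continuous fun p : ℝ × Euc n => ‖p.2‖ ^ 2 - p.1 := by fun_prop
  unfold barrier
  refine ((continuousOn_const.mul ((hq.mul (hT _)).sub (hq.mul (hT _))).continuousOn).sub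
    (continuousOn_const.mul (((hl _).mul (hN _)).sub (hN _)))).sub
    (continuousOn_const.mul (((hl _).mul (hN _)).sub (hN _)))

theorem BarrierParams.hasNd {m β h0 A1 A2 R c1 : ℝ} (hb : BarrierParams m β h0 A1 A2 R c1)
    {j : Fin n} {z z0 : Euc n} {l : ℝ} (hzj : z j = 0) (hz0 : z0 j = 1) (hlR : R ^ 2 ≤ l)
    (hlN : l ≤ ‖z‖ ^ 2) (hTN : 4 + ‖z - z0‖ ^ 2 ≤ 10 * ‖z‖ ^ 2) :
    ∃ d, HasNd (barrier m β h0 A1 A2 z0 l) (EuclideanSpace.single j (1:ℝ)) z d ∧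
      (m + 1) * (barrier m β h0 A1 A2 z0 l z / (4 + ‖z - z0‖ ^ 2)) ≤ d := by
  have hm1 := hb.m1
  have hβ0 := hb.β0
  have hh0 := hb.h00
  have hR1 := hb.R1
  have hl : 0 < l := lt_of_lt_of_le (by positivity) hlR
  have hN : 0 < ‖z‖ ^ 2 := by linarith
  have hT4 : 4 ≤ 4 + ‖z - z0‖ ^ 2 := by have := sq_nonneg ‖z - z0‖; linarith
  have hbd := (hb.bounds hlR hlN hTN).2
  have hq : 0 ≤ ‖z‖ ^ 2 - l := by linarith
  have eN : ∀ t : ℝ, ‖z + t • (EuclideanSpace.single j (1:ℝ) : Euc n)‖ ^ 2 = ‖z‖ ^ 2 + t ^ 2 := by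
    intro t; rw [norm_add_smul_single_sq, hzj]; ring
  have eT : ∀ t : ℝ, 4 + ‖z + t • (EuclideanSpace.single j (1:ℝ) : Euc n) - z0‖ ^ 2
      = (4 + ‖z - z0‖ ^ 2) + (t ^ 2 - 2 * t) := by
    intro t
    rw [show z + t • (EuclideanSpace.single j (1:ℝ) : Euc n) - z0
      = (z - z0) + t • (EuclideanSpace.single j (1:ℝ) : Euc n) by abel, norm_add_smul_single_sq]
    simp only [PiLp.sub_apply, hzj, hz0]
    ring
  set T := 4 + ‖z - z0‖ ^ 2 with hTd
  set N := ‖z‖ ^ 2 with hNd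
  have hT : 0 < T := by linarith
  obtain ⟨hx0, hx1, hx2, hx3⟩ := rpow_neg_facts hT4 hb.β0
  have dN0 : HasDerivAt (fun t : ℝ => N + t ^ 2) 0 0 := by
    simpa using ((hasDerivAt_id (0:ℝ)).pow 2).const_add N
  have dN : ∀ k : ℝ, HasDerivAt (fun t : ℝ => (N + t ^ 2) ^ k) 0 0 := fun k => by
    simpa using dN0.rpow_const (p := k) (Or.inl (by simpa using hN.ne'))
  have dq : HasDerivAt (fun t : ℝ => N + t ^ 2 - l) 0 0 := dN0.sub_const l
  have dT0 : HasDerivAt (fun t : ℝ => T + (t ^ 2 - 2 * t)) (-2) 0 := by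
    simpa using (((hasDerivAt_id (0:ℝ)).pow 2).sub ((hasDerivAt_id (0:ℝ)).const_mul 2)).const_add T
  have dT : ∀ k : ℝ, HasDerivAt (fun t : ℝ => (T + (t ^ 2 - 2 * t)) ^ k)
      (-2 * k * T ^ (k - 1)) 0 := fun k => by
    simpa using dT0.rpow_const (p := k) (Or.inl (by simpa using hT.ne'))
  have main := (((((dq.mul (dT (-(m + 1)))).sub (dq.mul (dT (-(m + 1 + β))))).const_mul h0).sub
    ((((dN (-m)).const_mul (l ^ (-(1/2) : ℝ))).sub (dN (-(m + 1/2)))).const_mul A1)).sub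
    ((((dN (-m)).const_mul (l ^ (-β))).sub (dN (-(m + β)))).const_mul A2))
  refine ⟨_, (main.hasDerivWithinAt (s := Ici 0)).congr_of_eventuallyEq
    (Eventually.of_forall fun t => ?_) ?_, ?_⟩
  · simp only [barrier, eN, eT]; rfl
  · simp only [barrier, eN, eT]; rfl
  · have e1 : T ^ (-(m + 1) - 1) = T ^ (-(m + 1)) / T := Real.rpow_sub_one hT.ne' _
    have e2 : T ^ (-(m + 1 + β) - 1) = T ^ (-(m + 1)) / T * T ^ (-β) := by
      rw [← Real.rpow_sub_one hT.ne', ← Real.rpow_add hT]; ring_nf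
    rw [e1, e2]
    set x := T ^ (-β) with hxd
    set P := T ^ (-(m + 1)) with hPd
    have hP : 0 < P := by positivity
    have h1 : (m + 1) * (barrier m β h0 A1 A2 z0 l z / T) ≤
        (m + 1) * (h0 * (N - l) * P * (1 - x) / T) := by gcongr
    refine h1.trans ?_
    have h2 : 0 ≤ h0 * (N - l) * (P / T) * ((m + 1) - (m + 1 + 2 * β) * x) := by
      have : 0 ≤ (m + 1) - (m + 1 + 2 * β) * x := by nlinarith [mul_pos hβ0 hx0]
      positivity
    refine le_of_sub_nonneg (h2.trans_eq ?_)
    simp only [zero_mul, mul_zero, zero_add, sub_zero]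
    field_simp
    ring

end

section

variable {n : ℕ}

/-- The standard bubble of scale `γ` centred at `zb`. -/
def bubble (m γ : ℝ) (zb z : Euc n) : ℝ := (γ / (γ ^ 2 + ‖z - zb‖ ^ 2)) ^ m

/-- The geometric data of the moving sphere argument. -/
structure Geo (n : ℕ) (j : Fin n) (m γ t0 R : ℝ) (e : Euc n) : Prop where
  hm : (n : ℝ) = 2 * m + 2
  m1 : 1 ≤ m
  γ0 : 0 < γ
  γ1 : γ ≤ 1
  ht : |t0| ≤ 1/2
  hγt : γ ^ 2 + t0 ^ 2 ≤ 5/4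
  R4 : 4 ≤ R
  e1 : ‖e‖ = 1
  ej : e j = 0

/-- The centre of the bubble. -/
def ctrB (j : Fin n) (t0 R : ℝ) (e : Euc n) : Euc n := R • e + t0 • EuclideanSpace.single j (1:ℝ)

/-- The critical squared radius. -/
def lstar (γ t0 R : ℝ) : ℝ := γ ^ 2 + R ^ 2 + t0 ^ 2

/-- The half-width of the interval of squared radii. -/
def lwidth (γ t0 R : ℝ) : ℝ := γ ^ 2 * R ^ 2 / (4 * lstar γ t0 R)

/-- The relative half-width of the interval of squared radii. -/
def lrel (γ t0 R : ℝ) : ℝ := lwidth γ t0 R / (4 * lstar γ t0 R)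

/-- The initial squared radius. -/
def linit (γ t0 R : ℝ) : ℝ := lstar γ t0 R / (1 + 4 * lrel γ t0 R)

namespace Geo

variable {j : Fin n} {m γ t0 R : ℝ} {e : Euc n}

theorem norm_ctr_sq (g : Geo n j m γ t0 R e) (s : ℝ) : ‖ctrB j s R e‖ ^ 2 = R ^ 2 + s ^ 2 := by
  rw [ctrB, norm_add_smul_single_sq]
  simp [norm_smul, g.e1, g.ej]

theorem ctr_j (g : Geo n j m γ t0 R e) (s : ℝ) : ctrB j s R e j = s := by
  simp [ctrB, g.ej]

theorem dist_ctr (s s' : ℝ) : ‖ctrB j s R e - ctrB j s' R e‖ = |s - s'| := by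
  rw [ctrB, ctrB, add_sub_add_left_eq_sub, ← sub_smul, norm_smul]
  simp

theorem lstar_pos (g : Geo n j m γ t0 R e) : R ^ 2 + γ ^ 2 ≤ lstar γ t0 R ∧ 0 < lstar γ t0 R := by
  have h4 := g.R4
  have h5 := g.γ0
  unfold lstar
  constructor
  · linarith [sq_nonneg t0]
  · positivity

theorem lwidth_facts (g : Geo n j m γ t0 R e) :
    0 < lwidth γ t0 R ∧ lwidth γ t0 R ≤ γ ^ 2 / 4 ∧
      lwidth γ t0 R = R ^ 2 * (γ ^ 2 / (4 * lstar γ t0 R)) := by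
  obtain ⟨h1, h2⟩ := g.lstar_pos
  have h5 := g.γ0
  have h4 := g.R4
  refine ⟨by unfold lwidth; positivity, ?_, by unfold lwidth; ring⟩
  unfold lwidth
  rw [div_le_div_iff₀ (by positivity) (by norm_num)]
  have : γ ^ 2 * R ^ 2 ≤ γ ^ 2 * lstar γ t0 R := by
    gcongr; nlinarith
  linarith

theorem lrel_facts (g : Geo n j m γ t0 R e) : 0 < lrel γ t0 R ∧ lrel γ t0 R ≤ 1/64 ∧
    4 * lrel γ t0 R * lstar γ t0 R = lwidth γ t0 R := by
  obtain ⟨h1, h2⟩ := g.lstar_pos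
  obtain ⟨h3, h4, -⟩ := g.lwidth_facts
  have h5 := g.γ0
  have h6 := g.γ1
  have hR := g.R4
  refine ⟨by unfold lrel; positivity, ?_, by unfold lrel; field_simp⟩
  unfold lrel
  rw [div_le_iff₀ (by positivity)]
  nlinarith

theorem linit_facts (g : Geo n j m γ t0 R e) : R ^ 2 ≤ linit γ t0 R ∧
    linit γ t0 R ≤ lstar γ t0 R ∧
    lstar γ t0 R - linit γ t0 R = 4 * lrel γ t0 R * linit γ t0 R ∧
    lstar γ t0 R - linit γ t0 R ≤ lwidth γ t0 R := by
  obtain ⟨h1, h2⟩ := g.lstar_pos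
  obtain ⟨h3, h4, -⟩ := g.lwidth_facts
  obtain ⟨h7, h8, h9⟩ := g.lrel_facts
  have h5 := g.γ0
  have e : linit γ t0 R * (1 + 4 * lrel γ t0 R) = lstar γ t0 R := by
    unfold linit; field_simp
  have hl : linit γ t0 R ≤ lstar γ t0 R := div_le_self h2.le (by linarith)
  have h10 : lrel γ t0 R * linit γ t0 R ≤ lrel γ t0 R * lstar γ t0 R := by gcongr
  refine ⟨by linarith [sq_nonneg γ], hl, by linarith, by linarith⟩

theorem geom (g : Geo n j m γ t0 R e) (z : Euc n) :
    γ ^ 2 + ‖z - ctrB j t0 R e‖ ^ 2 ≤ 2 * (4 + ‖z - ctrB j 1 R e‖ ^ 2) ∧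
    γ ^ 2 * (4 + ‖z - ctrB j 1 R e‖ ^ 2) ≤ 11 * (γ ^ 2 + ‖z - ctrB j t0 R e‖ ^ 2) ∧
    γ ^ 2 * ‖z‖ ^ 2 ≤ 2 * lstar γ t0 R * (γ ^ 2 + ‖z - ctrB j t0 R e‖ ^ 2) ∧
    4 + ‖z - ctrB j 1 R e‖ ^ 2 ≤ 6 + 2 * ‖z‖ ^ 2 + 2 * R ^ 2 := by
  have hγ := g.γ0
  have hγ1 := g.γ1
  have ht := abs_le.1 g.ht
  have d1 : ‖ctrB j t0 R e - ctrB j 1 R e‖ ≤ 3/2 := by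
    rw [dist_ctr, abs_le]; constructor <;> linarith [ht.1, ht.2]
  have d2 : ‖ctrB j 1 R e - ctrB j t0 R e‖ ≤ 3/2 := by rwa [norm_sub_rev]
  have s1 := norm_sub_le_norm_sub_add_norm_sub z (ctrB j t0 R e) (ctrB j 1 R e)
  have s2 := norm_sub_le_norm_sub_add_norm_sub z (ctrB j 1 R e) (ctrB j t0 R e)
  have s3 := norm_sub_le z (ctrB j 1 R e)
  have s4 : ‖z‖ ≤ ‖z - ctrB j t0 R e‖ + ‖ctrB j t0 R e‖ := by
    simpa using norm_add_le (z - ctrB j t0 R e) (ctrB j t0 R e)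
  have n1 := g.norm_ctr_sq 1
  have n2 := g.norm_ctr_sq t0
  have hls : lstar γ t0 R = γ ^ 2 + ‖ctrB j t0 R e‖ ^ 2 := by rw [n2]; unfold lstar; ring
  rw [hls]
  have p1 := norm_nonneg (z - ctrB j t0 R e)
  have p2 := norm_nonneg (z - ctrB j 1 R e)
  have p3 := norm_nonneg (ctrB j t0 R e)
  have p4 := norm_nonneg (ctrB j 1 R e)
  have p5 := norm_nonneg z
  set a := ‖z - ctrB j t0 R e‖
  set b := ‖z - ctrB j 1 R e‖
  set nb := ‖ctrB j t0 R e‖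
  have hg2 : γ ^ 2 ≤ 1 := by nlinarith
  have hg0 : 0 < γ ^ 2 := by positivity
  refine ⟨?_, ?_, ?_, ?_⟩
  · nlinarith [sq_nonneg (b - 3/2)]
  · have : 4 + b ^ 2 ≤ 8.5 + 2 * a ^ 2 := by nlinarith [sq_nonneg (a - 3/2)]
    nlinarith [sq_nonneg a]
  · have : ‖z‖ ^ 2 ≤ 2 * a ^ 2 + 2 * nb ^ 2 := by nlinarith [sq_nonneg (a - nb)]
    nlinarith [mul_nonneg (sq_nonneg a) (sq_nonneg nb), sq_nonneg (γ ^ 2)]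
  · nlinarith [sq_nonneg (‖z‖ - ‖ctrB j 1 R e‖)]

/-- The Kelvin transform of a bubble. -/
theorem kel_bubble (g : Geo n j m γ t0 R e) {l : ℝ} {z : Euc n} (hl : 0 < l)
    (hz : 0 < ‖z‖ ^ 2) :
    kel m l (bubble m γ (ctrB j t0 R e)) z =
      (γ / (γ ^ 2 + ‖z - ctrB j t0 R e‖ ^ 2
        + (lstar γ t0 R - l) * (‖z‖ ^ 2 - l) / l)) ^ m := by
  have n2 := g.norm_ctr_sq t0
  have hγ := g.γ0
  unfold kel bubble
  rw [← Real.mul_rpow (by positivity) (by positivity)]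
  congr 1
  have h1 : ‖(l / ‖z‖ ^ 2) • z - ctrB j t0 R e‖ ^ 2 =
      l ^ 2 / ‖z‖ ^ 2 - 2 * (l / ‖z‖ ^ 2) * inner ℝ z (ctrB j t0 R e) + (R ^ 2 + t0 ^ 2) := by
    rw [norm_sub_sq_real, n2, inner_smul_left, norm_smul, mul_pow, Real.norm_of_nonneg (by positivity)]
    simp
    field_simp
  have h2 : ‖z - ctrB j t0 R e‖ ^ 2 =
      ‖z‖ ^ 2 - 2 * inner ℝ z (ctrB j t0 R e) + (R ^ 2 + t0 ^ 2) := by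
    rw [norm_sub_sq_real, n2]
  have hB : γ ^ 2 + ‖z - ctrB j t0 R e‖ ^ 2 + (lstar γ t0 R - l) * (‖z‖ ^ 2 - l) / l
      = (‖z‖ ^ 2 / l) * (γ ^ 2 + ‖(l / ‖z‖ ^ 2) • z - ctrB j t0 R e‖ ^ 2) := by
    rw [h1, h2]; unfold lstar; clear h1 h2; generalize ‖z‖ ^ 2 = N at hz ⊢; field_simp; ring
  rw [hB]
  have : 0 < γ ^ 2 + ‖(l / ‖z‖ ^ 2) • z - ctrB j t0 R e‖ ^ 2 := by positivity
  field_simp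

theorem shift_bound (g : Geo n j m γ t0 R e) {l : ℝ} {z : Euc n} (hlR : R ^ 2 ≤ l)
    (hlw : |lstar γ t0 R - l| ≤ lwidth γ t0 R) (hlN : l ≤ ‖z‖ ^ 2) :
    |(lstar γ t0 R - l) * (‖z‖ ^ 2 - l) / l| ≤ (γ ^ 2 + ‖z - ctrB j t0 R e‖ ^ 2) / 2 := by
  obtain ⟨-, -, h3, -⟩ := g.geom z
  obtain ⟨w0, -, w1⟩ := g.lwidth_facts
  obtain ⟨-, l0⟩ := g.lstar_pos
  have hR := g.R4
  have hl : 0 < l := lt_of_lt_of_le (by positivity) hlR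
  have hq : 0 ≤ ‖z‖ ^ 2 - l := by linarith
  rw [abs_div, abs_mul, abs_of_nonneg hq, abs_of_pos hl, div_le_iff₀ hl]
  calc |lstar γ t0 R - l| * (‖z‖ ^ 2 - l) ≤ lwidth γ t0 R * ‖z‖ ^ 2 := by
        gcongr; linarith
    _ = R ^ 2 * ((γ ^ 2 * ‖z‖ ^ 2) / (4 * lstar γ t0 R)) := by rw [w1]; ring
    _ ≤ l * ((2 * lstar γ t0 R * (γ ^ 2 + ‖z - ctrB j t0 R e‖ ^ 2)) / (4 * lstar γ t0 R)) := by
        gcongr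
    _ = _ := by field_simp; ring

theorem kel_bounds (g : Geo n j m γ t0 R e) {l : ℝ} {z : Euc n} {V : Euc n → ℝ}
    (hlR : R ^ 2 ≤ l) (hlw : |lstar γ t0 R - l| ≤ lwidth γ t0 R) (hlN : l ≤ ‖z‖ ^ 2)
    (hV1 : 1/2 * bubble m γ (ctrB j t0 R e) ((l / ‖z‖ ^ 2) • z) ≤ V ((l / ‖z‖ ^ 2) • z))
    (hV2 : V ((l / ‖z‖ ^ 2) • z) ≤ 2 * bubble m γ (ctrB j t0 R e) ((l / ‖z‖ ^ 2) • z)) :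
    1/2 * (γ / 4) ^ m * (4 + ‖z - ctrB j 1 R e‖ ^ 2) ^ (-m) ≤ kel m l V z ∧
      kel m l V z ≤ 2 * (22 / γ ^ 2) ^ m * (4 + ‖z - ctrB j 1 R e‖ ^ 2) ^ (-m) := by
  have hR := g.R4
  have hγ := g.γ0
  have hγ1 := g.γ1
  have hm := g.m1
  have hl : 0 < l := lt_of_lt_of_le (by positivity) hlR
  have hN : 0 < ‖z‖ ^ 2 := by linarith
  obtain ⟨g1, g2, -, -⟩ := g.geom z
  have hs := abs_le.1 (g.shift_bound hlR hlw hlN)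
  have hk := g.kel_bubble hl hN
  set B := γ ^ 2 + ‖z - ctrB j t0 R e‖ ^ 2 + (lstar γ t0 R - l) * (‖z‖ ^ 2 - l) / l with hB
  set A := γ ^ 2 + ‖z - ctrB j t0 R e‖ ^ 2 with hA
  have hA0 : 0 < A := by positivity
  set T := 4 + ‖z - ctrB j 1 R e‖ ^ 2 with hT
  have hT0 : 0 < T := by positivity
  have hBA : A / 2 ≤ B := by linarith [hs.1]
  have hBA' : B ≤ 3 / 2 * A := by linarith [hs.2]
  have hB0 : 0 < B := by linarith
  have hlN0 : 0 < (l / ‖z‖ ^ 2) ^ m := by positivity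
  have k1 : 1/2 * kel m l (bubble m γ (ctrB j t0 R e)) z ≤ kel m l V z := by
    unfold kel; nlinarith
  have k2 : kel m l V z ≤ 2 * kel m l (bubble m γ (ctrB j t0 R e)) z := by
    unfold kel; nlinarith
  rw [hk] at k1 k2
  have b1 : (γ / 4) ^ m * T ^ (-m) ≤ (γ / B) ^ m := by
    rw [Real.rpow_neg hT0.le, ← Real.inv_rpow hT0.le, ← Real.mul_rpow (by positivity) (by positivity)]
    refine Real.rpow_le_rpow (by positivity) ?_ (by linarith)
    rw [← div_eq_mul_inv, div_div]
    exact div_le_div_of_nonneg_left hγ.le hB0 (by linarith)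
  have b2 : (γ / B) ^ m ≤ (22 / γ ^ 2) ^ m * T ^ (-m) := by
    rw [Real.rpow_neg hT0.le, ← Real.inv_rpow hT0.le, ← Real.mul_rpow (by positivity) (by positivity)]
    refine Real.rpow_le_rpow (by positivity) ?_ (by linarith)
    rw [← div_eq_mul_inv, div_div, div_le_div_iff₀ hB0 (by positivity)]
    have : γ * (γ ^ 2 * T) ≤ 1 * (γ ^ 2 * T) := by gcongr
    linarith
  constructor
  · linarith
  · linarith

end Geo

end

section

variable {n : ℕ}

theorem HasLap.norm_sub_rpow {z z0 : Euc n} {m : ℝ} (hm : (n : ℝ) = 2 * m + 2)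
    (hz : 0 < ‖z - z0‖ ^ 2) :
    ∃ a, HasLap (fun y : Euc n => (‖y - z0‖ ^ 2) ^ (-m)) z a 0 := by
  refine ((HasLap.normSq (z := z) z0 0).rpow (by simpa using hz) (-m)).of_eq
    (fun y => by simp) ?_
  simp only [zero_add, mul_pow]
  rw [← Finset.mul_sum, Euc.sum_sq, rpow_sub_two' hz, Real.rpow_sub_one hz.ne', hm]
  field_simp
  ring

theorem RescaledSol.hasNd {j : Fin n} {m c L : ℝ} {V Kh : Euc n → ℝ}
    (hV : RescaledSol n j m c L V Kh) {z : Euc n} (hz : z j = 0) (hzL : ‖z‖ < L) :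
    HasNd V (EuclideanSpace.single j (1:ℝ)) z (c * V z ^ ((m + 1) / m)) := by
  obtain ⟨G, hG, hGc⟩ := hV.flat z hz hzL
  rw [← hGc]
  unfold HasNd
  have hl' : HasDerivWithinAt (fun t : ℝ => z + t • (EuclideanSpace.single j (1:ℝ) : Euc n))
      (EuclideanSpace.single j (1:ℝ)) (Ici 0) 0 := by
    simpa using (((hasDerivAt_id (0:ℝ)).smul_const
      (EuclideanSpace.single j (1:ℝ) : Euc n)).const_add z).hasDerivWithinAt
  have hG' : HasFDerivWithinAt V G {y | 0 ≤ y j}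
    (z + (0:ℝ) • (EuclideanSpace.single j (1:ℝ) : Euc n)) := by simpa using hG
  refine hG'.comp_hasDerivWithinAt 0 hl' ?_
  intro t ht
  have ht' : 0 ≤ t := ht
  simpa [hz] using ht'

/-- Comparison of a positive solution with a fundamental solution centred outside the domain. -/
theorem RescaledSol.lower_bound {j : Fin n} {m c L : ℝ} {V Kh : Euc n → ℝ}
    (hV : RescaledSol n j m c L V Kh) (hm : (n : ℝ) = 2 * m + 2) (hm0 : 0 < m)
    {a r : ℝ} {z0 : Euc n} (ha : 0 < a) (hca : c * a < 2 * m) (hz0 : z0 j = 1)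
    (hz0r : ‖z0‖ < r) (hK : ∀ z : Euc n, 0 < z j → ‖z‖ < L → 0 < Kh z)
    (hr : ∀ z : Euc n, 0 ≤ z j → ‖z‖ = r → a ^ m * (‖z - z0‖ ^ 2) ^ (-m) ≤ V z)
    (hL : ∀ z : Euc n, 0 ≤ z j → ‖z‖ = L → a ^ m * (‖z - z0‖ ^ 2) ^ (-m) ≤ V z)
    {z : Euc n} (hzj : 0 ≤ z j) (hzr : r ≤ ‖z‖) (hzL : ‖z‖ ≤ L) :
    a ^ m * (‖z - z0‖ ^ 2) ^ (-m) ≤ V z := by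
  have hdist : ∀ y : Euc n, r ≤ ‖y‖ → 0 < ‖y - z0‖ ^ 2 := by
    intro y hy
    have : y - z0 ≠ 0 := by
      intro h
      rw [sub_eq_zero] at h
      rw [h] at hy
      linarith
    have := norm_pos_iff.2 this
    positivity
  set S : Set (Euc n) := {y | 0 ≤ y j ∧ r ≤ ‖y‖ ∧ ‖y‖ ≤ L} with hS
  have hcj : Continuous fun y : Euc n => y j := by fun_prop
  have hSc : IsCompact S := by
    refine (isCompact_closedBall (0 : Euc n) L).of_isClosed_subset ?_ ?_
    · exact (isClosed_le continuous_const hcj).inter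
        ((isClosed_le continuous_const continuous_norm).inter
          (isClosed_le continuous_norm continuous_const))
    · intro y hy; simpa using hy.2.2
  have hFc : ContinuousOn (fun y => V y - a ^ m * (‖y - z0‖ ^ 2) ^ (-m)) S := by
    refine (hV.cont.mono fun y hy => ⟨hy.1, hy.2.2⟩).sub (continuousOn_const.mul ?_)
    exact ContinuousOn.rpow_const (by fun_prop) fun y hy => Or.inl (hdist y hy.2.1).ne'
  obtain ⟨y, hyS, hy⟩ := hSc.exists_isMinOn ⟨z, hzj, hzr, hzL⟩ hFc
  have hmin : ∀ w ∈ S, V y - a ^ m * (‖y - z0‖ ^ 2) ^ (-m) ≤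
    V w - a ^ m * (‖w - z0‖ ^ 2) ^ (-m) := fun w hw => hy hw
  by_contra hcon
  push Not at hcon
  have hneg : V y < a ^ m * (‖y - z0‖ ^ 2) ^ (-m) := by
    have := hmin z ⟨hzj, hzr, hzL⟩
    linarith
  obtain ⟨hyj, hyr, hyL⟩ := hyS
  have hyr' : r < ‖y‖ := by
    rcases hyr.eq_or_lt with h | h
    · exact absurd (hr y hyj h.symm) (by linarith)
    · exact h
  have hyL' : ‖y‖ < L := by
    rcases hyL.eq_or_lt with h | h
    · exact absurd (hL y hyj h) (by linarith)
    · exact h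
  have hVy := hV.pos y hyj hyL
  have hD := hdist y hyr
  rcases hyj.eq_or_lt with hyj0 | hyj0
  · have k1 := hV.hasNd hyj0.symm hyL'
    set D := ‖y - z0‖ ^ 2 with hDd
    have eT : ∀ t : ℝ, ‖y + t • (EuclideanSpace.single j (1:ℝ) : Euc n) - z0‖ ^ 2
        = D + (t ^ 2 - 2 * t) := by
      intro t
      rw [show y + t • (EuclideanSpace.single j (1:ℝ) : Euc n) - z0
        = (y - z0) + t • (EuclideanSpace.single j (1:ℝ) : Euc n) by abel, norm_add_smul_single_sq]
      simp only [PiLp.sub_apply, ← hyj0, hz0]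
      ring
    have dT0 : HasDerivAt (fun t : ℝ => D + (t ^ 2 - 2 * t)) (-2) 0 := by
      simpa using (((hasDerivAt_id (0:ℝ)).pow 2).sub
        ((hasDerivAt_id (0:ℝ)).const_mul 2)).const_add D
    have k2 : HasNd (fun y => a ^ m * (‖y - z0‖ ^ 2) ^ (-m)) (EuclideanSpace.single j (1:ℝ)) y
        (a ^ m * (2 * m * D ^ (-m - 1))) := by
      have h1 := (dT0.rpow_const (p := -m) (Or.inl (by simpa using hD.ne'))).const_mul (a ^ m)
      unfold HasNd
      simp only [eT]
      refine h1.hasDerivWithinAt.congr_deriv ?_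
      norm_num
    have hd := (k1.sub k2).nonneg_of_min (by
      have hct : Continuous fun t : ℝ => y + t • (EuclideanSpace.single j (1:ℝ) : Euc n) := by
        fun_prop
      have e1 : ∀ᶠ t : ℝ in 𝓝[>] 0, ‖y + t • (EuclideanSpace.single j (1:ℝ) : Euc n)‖ < L :=
        ((hct.norm.tendsto 0).eventually (gt_mem_nhds (by simpa using hyL'))).filter_mono
          nhdsWithin_le_nhds
      have e2 : ∀ᶠ t : ℝ in 𝓝[>] 0, r < ‖y + t • (EuclideanSpace.single j (1:ℝ) : Euc n)‖ :=
        ((hct.norm.tendsto 0).eventually (lt_mem_nhds (by simpa using hyr'))).filter_mono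
          nhdsWithin_le_nhds
      filter_upwards [e1, e2, self_mem_nhdsWithin] with t ht1 ht2 (ht0 : 0 < t)
      have := hmin _ ⟨by simpa [← hyj0] using ht0.le, ht2.le, ht1.le⟩
      simpa using this)
    have e3 : (a ^ m * D ^ (-m)) ^ ((m + 1) / m) = a * (a ^ m * D ^ (-m - 1)) := by
      rw [Real.mul_rpow (by positivity) (by positivity), ← Real.rpow_mul ha.le,
        ← Real.rpow_mul hD.le, show m * ((m + 1) / m) = m + 1 by field_simp,
        show -m * ((m + 1) / m) = -m - 1 by field_simp; ring, Real.rpow_add_one ha.ne']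
      ring
    have hX : 0 < a ^ m * D ^ (-m - 1) := by positivity
    have hVq : 0 < V y ^ ((m + 1) / m) := by positivity
    rcases le_or_gt c 0 with hc | hc
    · nlinarith
    · have h4 : V y ^ ((m + 1) / m) ≤ (a ^ m * D ^ (-m)) ^ ((m + 1) / m) :=
        Real.rpow_le_rpow hVy.le hneg.le (by positivity)
      rw [e3] at h4
      nlinarith
  · obtain ⟨V', H, hV', hH, htr⟩ := hV.hess y hyj0 hyL'
    have k1 := HasLap.of_hessian hV' hH
    obtain ⟨a2, k2⟩ := HasLap.norm_sub_rpow hm hD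
    have k3 := (k1.sub (k2.const_mul (a ^ m))).nonneg_of_min (by
      have e1 : ∀ᶠ w : Euc n in 𝓝 y, ‖w‖ < L :=
        (continuous_norm.tendsto y).eventually (gt_mem_nhds hyL')
      have e2 : ∀ᶠ w : Euc n in 𝓝 y, r < ‖w‖ :=
        (continuous_norm.tendsto y).eventually (lt_mem_nhds hyr')
      have e3 : ∀ᶠ w : Euc n in 𝓝 y, 0 < w j :=
        (hcj.tendsto y).eventually (lt_mem_nhds hyj0)
      filter_upwards [e1, e2, e3] with w h1 h2 h3
      exact hmin w ⟨h3.le, h2.le, h1.le⟩)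
    rw [htr] at k3
    have h5 := mul_pos (hK y hyj0 hyL') (Real.rpow_pos_of_pos hVy ((m + 2) / m))
    linarith

theorem flux_bound {m c W f κ T : ℝ} (hm : 1 ≤ m) (hW : 0 < W) (hf : 0 ≤ f) (hT : 0 < T)
    (hκ : 0 < κ) (hWf : W + f ≤ 4 * κ ^ m * T ^ (-m)) (hc : 4 * κ * c ≤ 1) :
    c * ((W + f) ^ ((m + 1) / m) - W ^ ((m + 1) / m)) ≤ (m + 1) * (f / T) := by
  have hm0 : 0 < m := by linarith
  have hq0 : 0 < (m + 1) / m := by positivity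
  have hmono : W ^ ((m + 1) / m) ≤ (W + f) ^ ((m + 1) / m) :=
    Real.rpow_le_rpow hW.le (by linarith) hq0.le
  have hr : 0 ≤ (m + 1) * (f / T) := by positivity
  rcases le_or_gt c 0 with hc0 | hc0
  · nlinarith
  · have hq1 : 1 ≤ (m + 1) / m := by rw [le_div_iff₀ hm0]; linarith
    have h1 := rpow_tangent (show 0 < W + f by linarith) hW hq1
    have e1 : (m + 1) / m - 1 = 1 / m := by field_simp; ring
    rw [e1] at h1
    have h2 : (W + f) ^ (1 / m) ≤ 4 * κ / T := by
      calc (W + f) ^ (1 / m) ≤ (4 * κ ^ m * T ^ (-m)) ^ (1 / m) :=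
            Real.rpow_le_rpow (by linarith) hWf (by positivity)
        _ = 4 ^ (1 / m) * κ * T⁻¹ := by
            rw [Real.mul_rpow (by positivity) (by positivity),
              Real.mul_rpow (by positivity) (by positivity), ← Real.rpow_mul hκ.le,
              ← Real.rpow_mul hT.le, show m * (1 / m) = 1 by field_simp,
              show -m * (1 / m) = -1 by field_simp, Real.rpow_one, Real.rpow_neg_one]
        _ ≤ 4 ^ (1:ℝ) * κ * T⁻¹ := by
            gcongr
            · norm_num
            · rw [div_le_one hm0]; exact hm
        _ = _ := by rw [Real.rpow_one]; field_simp
    have h3 : (W + f) ^ ((m + 1) / m) - W ^ ((m + 1) / m) ≤ (m + 1) * (4 * κ / T) * f := by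
      have h4 : (m + 1) / m * (W + f) ^ (1 / m) * f ≤ (m + 1) * (4 * κ / T) * f := by
        have : (m + 1) / m ≤ m + 1 := div_le_self (by linarith) hm
        gcongr
      linarith
    calc c * ((W + f) ^ ((m + 1) / m) - W ^ ((m + 1) / m))
        ≤ c * ((m + 1) * (4 * κ / T) * f) := mul_le_mul_of_nonneg_left h3 hc0.le
      _ = (4 * κ * c) * ((m + 1) * (f / T)) := by ring
      _ ≤ 1 * ((m + 1) * (f / T)) := by gcongr
      _ = _ := one_mul _

theorem Geo.rhs_bound {j : Fin n} {m γ t0 R : ℝ} {e : Euc n} (g : Geo n j m γ t0 R e)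
    {l W : ℝ} {z : Euc n} (hl : 0 < l) (hlN : l ≤ ‖z‖ ^ 2)
    (hW1 : 1/2 * (γ / 4) ^ m * (4 + ‖z - ctrB j 1 R e‖ ^ 2) ^ (-m) ≤ W)
    (hW2 : W ≤ 2 * (22 / γ ^ 2) ^ m * (4 + ‖z - ctrB j 1 R e‖ ^ 2) ^ (-m)) :
    -((1 - l / ‖z‖ ^ 2) * (inner ℝ e z - ‖z‖ / 8) * W ^ ((m + 2) / m)) ≤
        - (‖z‖ ^ 2 - l) / (12 * R) * (1/2 * (γ / 4) ^ m) ^ ((m + 2) / m) *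
          (4 + ‖z - ctrB j 1 R e‖ ^ 2) ^ (-(m + 2)) ∨
      (‖z‖ ^ 2 ≤ 18 * (4 + ‖z - ctrB j 1 R e‖ ^ 2) ∧
        -((1 - l / ‖z‖ ^ 2) * (inner ℝ e z - ‖z‖ / 8) * W ^ ((m + 2) / m)) ≤
          2 * 18 ^ (m + 2) * (2 * (22 / γ ^ 2) ^ m) ^ ((m + 2) / m) *
            (‖z‖ ^ 2) ^ (-(m + 3/2))) := by
  have hR := g.R4
  have hγ := g.γ0
  have hm := g.m1
  have hm0 : 0 < m := by linarith
  have hN : 0 < ‖z‖ ^ 2 := by linarith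
  have hz0 : 0 < ‖z‖ := by
    rcases (norm_nonneg z).eq_or_lt with h | h
    · rw [← h] at hN; norm_num at hN
    · exact h
  have hT : 0 < 4 + ‖z - ctrB j 1 R e‖ ^ 2 := by positivity
  have hTp : ((4 + ‖z - ctrB j 1 R e‖ ^ 2) ^ (-m)) ^ ((m + 2) / m) =
      (4 + ‖z - ctrB j 1 R e‖ ^ 2) ^ (-(m + 2)) := by
    rw [← Real.rpow_mul hT.le]; congr 1; field_simp
  have hp0 : 0 ≤ (m + 2) / m := by positivity
  have p1 : (1/2 * (γ / 4) ^ m) ^ ((m + 2) / m) * (4 + ‖z - ctrB j 1 R e‖ ^ 2) ^ (-(m + 2))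
      ≤ W ^ ((m + 2) / m) := by
    rw [← hTp, ← Real.mul_rpow (by positivity) (by positivity)]
    exact Real.rpow_le_rpow (by positivity) hW1 hp0
  have hW0 : 0 < W := lt_of_lt_of_le (by positivity) hW1
  have p2 : W ^ ((m + 2) / m) ≤
      (2 * (22 / γ ^ 2) ^ m) ^ ((m + 2) / m) * (4 + ‖z - ctrB j 1 R e‖ ^ 2) ^ (-(m + 2)) := by
    rw [← hTp, ← Real.mul_rpow (by positivity) (by positivity)]
    exact Real.rpow_le_rpow hW0.le hW2 hp0
  have hWp : 0 < W ^ ((m + 2) / m) := by positivity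
  have hfr : 1 - l / ‖z‖ ^ 2 = (‖z‖ ^ 2 - l) / ‖z‖ ^ 2 := by field_simp
  have hfr0 : 0 ≤ 1 - l / ‖z‖ ^ 2 := by rw [hfr]; exact div_nonneg (by linarith) hN.le
  have hfr1 : 1 - l / ‖z‖ ^ 2 ≤ 1 := by have := div_pos hl hN; linarith
  have hRe : ‖R • e‖ = R := by rw [norm_smul, g.e1, mul_one, Real.norm_of_nonneg (by linarith)]
  have hez : inner ℝ e z = R + inner ℝ e (z - R • e) := by
    rw [inner_sub_right, inner_smul_right, real_inner_self_eq_norm_sq, g.e1]; ring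
  have hcs := abs_le.1 (abs_real_inner_le_norm e (z - R • e))
  have hcs2 := abs_le.1 (abs_real_inner_le_norm e z)
  rw [g.e1, one_mul] at hcs hcs2
  have htri : ‖z‖ ≤ ‖z - R • e‖ + R := by
    have := norm_add_le (z - R • e) (R • e)
    rw [hRe] at this
    simpa using this
  rcases le_or_gt ‖z - R • e‖ (R / 2) with hnear | hfar
  · left
    have h1 : R / 4 ≤ inner ℝ e z - ‖z‖ / 8 := by rw [hez]; linarith [hcs.1]
    have h2 : ‖z‖ ^ 2 ≤ 9 / 4 * R ^ 2 := by nlinarith [norm_nonneg z]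
    have h3 : (‖z‖ ^ 2 - l) / (12 * R) ≤ (1 - l / ‖z‖ ^ 2) * (inner ℝ e z - ‖z‖ / 8) := by
      calc (‖z‖ ^ 2 - l) / (12 * R) ≤ (‖z‖ ^ 2 - l) / ‖z‖ ^ 2 * (R / 4) := by
            rw [div_mul_eq_mul_div, div_le_div_iff₀ (by positivity) hN]
            have : 0 ≤ (‖z‖ ^ 2 - l) * (3 * R ^ 2 - ‖z‖ ^ 2) := by
              apply mul_nonneg <;> linarith
            linarith
        _ ≤ _ := by rw [hfr]; gcongr
    have h4 : 0 ≤ (‖z‖ ^ 2 - l) / (12 * R) := div_nonneg (by linarith) (by positivity)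
    have h5 := mul_le_mul h3 p1 (by positivity) (h4.trans h3)
    rw [neg_div]
    linarith
  · right
    have hd : ‖z - R • e‖ ≤ ‖z - ctrB j 1 R e‖ + 1 := by
      have := norm_add_le (z - ctrB j 1 R e) ((1:ℝ) • (EuclideanSpace.single j (1:ℝ) : Euc n))
      rw [norm_smul] at this
      have e : z - ctrB j 1 R e + (1:ℝ) • (EuclideanSpace.single j (1:ℝ) : Euc n) = z - R • e := by
        rw [ctrB]; abel
      rw [e] at this
      simpa using this
    have h1 : ‖z‖ ^ 2 ≤ 18 * (4 + ‖z - ctrB j 1 R e‖ ^ 2) := by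
      have h2 : ‖z‖ ≤ 3 * (‖z - ctrB j 1 R e‖ + 1) := by linarith
      nlinarith [sq_nonneg (‖z - ctrB j 1 R e‖ - 1), norm_nonneg (z - ctrB j 1 R e)]
    refine ⟨h1, ?_⟩
    have h2 : -(inner ℝ e z - ‖z‖ / 8) ≤ 2 * ‖z‖ := by linarith [hcs2.1]
    have hTN : (4 + ‖z - ctrB j 1 R e‖ ^ 2) ^ (-(m + 2)) ≤
        18 ^ (m + 2) * (‖z‖ ^ 2) ^ (-(m + 2)) := by
      have h3 : ((18:ℝ)⁻¹) ^ (-(m + 2)) = 18 ^ (m + 2) := by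
        rw [Real.inv_rpow (by norm_num), Real.rpow_neg (by norm_num), inv_inv]
      rw [← h3, ← Real.mul_rpow (by norm_num) hN.le]
      exact Real.rpow_le_rpow_of_nonpos (by positivity) (by linarith) (by linarith)
    have hzN : ‖z‖ * (‖z‖ ^ 2) ^ (-(m + 2)) = (‖z‖ ^ 2) ^ (-(m + 3/2)) := by
      have : ‖z‖ = (‖z‖ ^ 2) ^ (1/2 : ℝ) := by
        rw [← Real.sqrt_eq_rpow, Real.sqrt_sq hz0.le]
      nth_rewrite 1 [this]
      rw [← Real.rpow_add hN]; ring_nf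
    calc -((1 - l / ‖z‖ ^ 2) * (inner ℝ e z - ‖z‖ / 8) * W ^ ((m + 2) / m))
        = (1 - l / ‖z‖ ^ 2) * (-(inner ℝ e z - ‖z‖ / 8)) * W ^ ((m + 2) / m) := by ring
      _ ≤ (1 - l / ‖z‖ ^ 2) * (2 * ‖z‖) * W ^ ((m + 2) / m) := by gcongr
      _ ≤ 1 * (2 * ‖z‖) * ((2 * (22 / γ ^ 2) ^ m) ^ ((m + 2) / m) *
            (18 ^ (m + 2) * (‖z‖ ^ 2) ^ (-(m + 2)))) := by
          gcongr
          refine p2.trans ?_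
          gcongr
      _ = 2 * 18 ^ (m + 2) * (2 * (22 / γ ^ 2) ^ m) ^ ((m + 2) / m) *
            (‖z‖ * (‖z‖ ^ 2) ^ (-(m + 2))) := by ring
      _ = _ := by rw [hzN]

end

section

variable {n : ℕ}

theorem rpow_convex_gap {m γ A B : ℝ} (hm : 1 ≤ m) (hγ : 0 < γ) (hA : 0 < A) (hAB : A ≤ B) :
    γ ^ m * (B - A) * B ^ (-(m + 1)) ≤ (γ / A) ^ m - (γ / B) ^ m := by
  have hB : 0 < B := by linarith
  have h1 : B / A ≤ (B / A) ^ m := Real.self_le_rpow_of_one_le ((one_le_div hA).2 hAB) hm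
  have h2 : (γ / A) ^ m = (γ / B) ^ m * (B / A) ^ m := by
    rw [← Real.mul_rpow (by positivity) (by positivity)]; congr 1; field_simp
  have h3 : γ ^ m * (B - A) * B ^ (-(m + 1)) = (γ / B) ^ m * ((B - A) / B) := by
    rw [Real.div_rpow hγ.le hB.le, show -(m + 1) = -m - 1 by ring, Real.rpow_sub_one hB.ne',
      Real.rpow_neg hB.le]
    field_simp
  rw [h2, h3]
  have h4 : (B - A) / B ≤ B / A - 1 := by
    rw [show B / A - 1 = (B - A) / A by field_simp]
    exact div_le_div_of_nonneg_left (by linarith) hA hAB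
  have h5 : 0 < (γ / B) ^ m := by positivity
  nlinarith

/-- Smallness and largeness conditions used in the moving sphere argument. -/
structure Thr (m γ t0 R h0 R2 η ε : ℝ) : Prop where
  h00 : 0 < h0
  R2a : 3 * (R + 1) / lrel γ t0 R ≤ R2
  R2b : R + 1 + 8 / lrel γ t0 R ≤ R2
  R2c : 12 * lstar γ t0 R + 12 ≤ R2 ^ 2
  η0 : 0 < η
  ε0 : 0 < ε
  ε1 : ε ≤ 1
  s1 : η ≤ lrel γ t0 R / 2 * (γ / (20 * R2 ^ 2)) ^ m
  s2 : (1 + m) * η + ε * h0 ≤ γ ^ m * (4 * lrel γ t0 R) * (40 * R2 ^ 2) ^ (-(m + 1))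
  s3 : η * linit γ t0 R ^ m + ε * h0 * 4 ^ (m + 1) ≤
    (γ * (1 - lrel γ t0 R) / (1 + lrel γ t0 R)) ^ m - (γ / (1 + 3 * lrel γ t0 R)) ^ m
  s4 : 2 * η < γ ^ m * lwidth γ t0 R * (40 * (lstar γ t0 R + lwidth γ t0 R)) ^ (-(m + 1))
  s5 : ε * h0 * (2 * R ^ 2 + 4) ≤ 2

namespace Thr

variable {j : Fin n} {m γ t0 R h0 R2 η ε : ℝ} {e : Euc n}

theorem R2_facts (t : Thr m γ t0 R h0 R2 η ε) (g : Geo n j m γ t0 R e) :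
    2 * (R + 1) ≤ R2 ∧ R + 500 ≤ R2 := by
  obtain ⟨h1, h2, -⟩ := g.lrel_facts
  have hR := g.R4
  have h3 := t.R2a
  have h4 := t.R2b
  have h5 : 3 * (R + 1) * 1 ≤ 3 * (R + 1) / lrel γ t0 R := by
    rw [le_div_iff₀ h1]; nlinarith
  have h6 : 512 ≤ 8 / lrel γ t0 R := by rw [le_div_iff₀ h1]; linarith
  constructor <;> linarith

theorem bubble_lower (t : Thr m γ t0 R h0 R2 η ε) (g : Geo n j m γ t0 R e) {z : Euc n}
    (hz : ‖z‖ ≤ R2) : (γ / (20 * R2 ^ 2)) ^ m ≤ bubble m γ (ctrB j t0 R e) z := by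
  obtain ⟨g1, -, -, g4⟩ := g.geom z
  obtain ⟨h1, h2⟩ := t.R2_facts g
  have hR := g.R4
  have hγ := g.γ0
  have hm := g.m1
  unfold bubble
  refine Real.rpow_le_rpow (by positivity) ?_ (by linarith)
  have hA : 0 < γ ^ 2 + ‖z - ctrB j t0 R e‖ ^ 2 := by positivity
  refine div_le_div_of_nonneg_left hγ.le hA ?_
  have h5 : ‖z‖ ^ 2 ≤ R2 ^ 2 := by gcongr
  nlinarith

theorem eta_le (t : Thr m γ t0 R h0 R2 η ε) (g : Geo n j m γ t0 R e) {z : Euc n}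
    (hz : ‖z‖ ≤ R2) : η ≤ lrel γ t0 R / 2 * bubble m γ (ctrB j t0 R e) z ∧
      η ≤ 1/2 * bubble m γ (ctrB j t0 R e) z := by
  have h1 := t.bubble_lower g hz
  obtain ⟨h2, h3, -⟩ := g.lrel_facts
  have h4 := t.s1
  have hR2 := t.R2_facts g
  have hR := g.R4
  have hγ := g.γ0
  have h5 : 0 < (γ / (20 * R2 ^ 2)) ^ m := by
    have : 0 < R2 := by linarith
    positivity
  constructor <;> nlinarith

set_option maxHeartbeats 1600000 in
theorem start_inner (t : Thr m γ t0 R h0 R2 η ε) (g : Geo n j m γ t0 R e) {V : Euc n → ℝ}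
    (hD : ∀ z : Euc n, 0 ≤ z j → ‖z‖ ≤ R2 → |V z - bubble m γ (ctrB j t0 R e) z| ≤ η)
    (hDL : ∀ z w : Euc n, 0 ≤ z j → ‖z‖ ≤ R2 → 0 ≤ w j → ‖w‖ ≤ R2 →
      |(V z - bubble m γ (ctrB j t0 R e) z) - (V w - bubble m γ (ctrB j t0 R e) w)| ≤ η * ‖z - w‖)
    {z : Euc n} {f : ℝ} (hzj : 0 ≤ z j) (hz : ‖z‖ ≤ R2) (hlN : linit γ t0 R ≤ ‖z‖ ^ 2)
    (hf : f ≤ h0 * (‖z‖ ^ 2 - linit γ t0 R) * (4 + ‖z - ctrB j 1 R e‖ ^ 2) ^ (-(m + 1))) :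
    kel m (linit γ t0 R) V z + ε * f ≤ V z := by
  obtain ⟨l1, l2, l3, l4⟩ := g.linit_facts
  obtain ⟨r1, r2, -⟩ := g.lrel_facts
  obtain ⟨h1, h2⟩ := t.R2_facts g
  have hR := g.R4
  have hγ := g.γ0
  have hm := g.m1
  have hη := t.η0
  have hε := t.ε0
  have hh0 := t.h00
  set l := linit γ t0 R with hl
  have hl0 : 0 < l := lt_of_lt_of_le (by positivity) l1
  have hN : 0 < ‖z‖ ^ 2 := by linarith
  have hN1 : 1 ≤ ‖z‖ ^ 2 := by nlinarith
  have hz1 : 1 ≤ ‖z‖ := by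
    by_contra hcon
    push Not at hcon
    nlinarith [norm_nonneg z]
  have hq : 0 ≤ ‖z‖ ^ 2 - l := by linarith
  set w := (l / ‖z‖ ^ 2) • z with hw
  have hr1 : l / ‖z‖ ^ 2 ≤ 1 := (div_le_one hN).2 hlN
  have hr0 : 0 < l / ‖z‖ ^ 2 := by positivity
  have hwj : 0 ≤ w j := by rw [hw, PiLp.smul_apply, smul_eq_mul]; positivity
  have hwR : ‖w‖ ≤ R2 := by
    rw [hw, norm_smul, Real.norm_of_nonneg hr0.le]
    nlinarith [norm_nonneg z]
  have hzw : ‖z - w‖ ≤ ‖z‖ ^ 2 - l := by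
    have : z - w = (1 - l / ‖z‖ ^ 2) • z := by rw [hw, sub_smul, one_smul]
    rw [this, norm_smul, Real.norm_of_nonneg (by linarith)]
    have e2 : (1 - l / ‖z‖ ^ 2) * ‖z‖ = (‖z‖ ^ 2 - l) / ‖z‖ := by
      field_simp
    rw [e2]
    exact div_le_self hq hz1
  have d1 := abs_le.1 (hDL z w hzj hz hwj hwR)
  have d2 := abs_le.1 (hD w hwj hwR)
  have b1 : 1 - m * (‖z‖ ^ 2 - l) ≤ (l / ‖z‖ ^ 2) ^ m := by
    have := one_add_mul_self_le_rpow_one_add (s := l / ‖z‖ ^ 2 - 1) (by linarith) hm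
    rw [show 1 + (l / ‖z‖ ^ 2 - 1) = l / ‖z‖ ^ 2 by ring] at this
    have e : 1 - l / ‖z‖ ^ 2 ≤ ‖z‖ ^ 2 - l := by
      rw [show 1 - l / ‖z‖ ^ 2 = (‖z‖ ^ 2 - l) / ‖z‖ ^ 2 by field_simp]
      exact div_le_self hq hN1
    nlinarith
  have b2 : (l / ‖z‖ ^ 2) ^ m ≤ 1 := Real.rpow_le_one hr0.le hr1 (by linarith)
  have hk := g.kel_bubble hl0 hN
  have hBk : kel m l V z = kel m l (bubble m γ (ctrB j t0 R e)) z
      + (l / ‖z‖ ^ 2) ^ m * (V w - bubble m γ (ctrB j t0 R e) w) := by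
    unfold kel; ring
  have hsh := abs_le.1 (g.shift_bound l1 (by rw [abs_of_nonneg (by linarith)]; exact l4) hlN)
  have hs : (lstar γ t0 R - l) * (‖z‖ ^ 2 - l) / l = 4 * lrel γ t0 R * (‖z‖ ^ 2 - l) := by
    rw [l3]; field_simp
  rw [hs] at hk hsh
  obtain ⟨g1, -, -, g4⟩ := g.geom z
  have hA : 0 < γ ^ 2 + ‖z - ctrB j t0 R e‖ ^ 2 := by positivity
  have hs0 : 0 ≤ 4 * lrel γ t0 R * (‖z‖ ^ 2 - l) := by positivity
  have gap := rpow_convex_gap hm hγ hA (le_add_of_nonneg_right hs0)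
  have hR2 : ‖z‖ ^ 2 ≤ R2 ^ 2 := by gcongr
  have hB : (40 * R2 ^ 2) ^ (-(m + 1)) ≤ (γ ^ 2 + ‖z - ctrB j t0 R e‖ ^ 2
      + 4 * lrel γ t0 R * (‖z‖ ^ 2 - l)) ^ (-(m + 1)) := by
    refine Real.rpow_le_rpow_of_nonpos (by positivity) ?_ (by linarith)
    have hRR : R ^ 2 ≤ R2 ^ 2 := by gcongr; linarith
    have hR1 : 1 ≤ R2 ^ 2 := one_le_pow₀ (by linarith)
    linarith [hsh.2]
  have hU : bubble m γ (ctrB j t0 R e) z = (γ / (γ ^ 2 + ‖z - ctrB j t0 R e‖ ^ 2)) ^ m := rfl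
  rw [← hU, ← hk, add_sub_cancel_left] at gap
  have hf2 : f ≤ h0 * (‖z‖ ^ 2 - l) := by
    refine hf.trans (mul_le_of_le_one_right (by positivity) ?_)
    exact Real.rpow_le_one_of_one_le_of_nonpos (by linarith [sq_nonneg ‖z - ctrB j 1 R e‖])
      (by linarith)
  have gap2 : γ ^ m * (4 * lrel γ t0 R) * (40 * R2 ^ 2) ^ (-(m + 1)) * (‖z‖ ^ 2 - l) ≤
      bubble m γ (ctrB j t0 R e) z - kel m l (bubble m γ (ctrB j t0 R e)) z := by
    refine le_trans ?_ gap
    have := mul_le_mul_of_nonneg_left hB (show 0 ≤ γ ^ m * (4 * lrel γ t0 R * (‖z‖ ^ 2 - l)) by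
      positivity)
    linarith
  have hs2 := mul_le_mul_of_nonneg_right t.s2 hq
  have hD2 : (l / ‖z‖ ^ 2) ^ m * (V w - bubble m γ (ctrB j t0 R e) w) ≤
      (V w - bubble m γ (ctrB j t0 R e) w) + η * (m * (‖z‖ ^ 2 - l)) := by
    nlinarith [d2.1]
  have hη2 : η * ‖z - w‖ ≤ η * (‖z‖ ^ 2 - l) := by gcongr
  have hεf : ε * f ≤ ε * (h0 * (‖z‖ ^ 2 - l)) := by gcongr
  rw [hBk]
  linarith [d1.1]

theorem norm_ctr_le (g : Geo n j m γ t0 R e) :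
    ‖ctrB j 1 R e‖ ≤ R + 1 ∧ ‖ctrB j t0 R e‖ ≤ R + 1 := by
  have hR := g.R4
  have hγ := g.γ0
  have hγ1 := g.γ1
  have ht := g.hγt
  constructor
  · have := g.norm_ctr_sq 1
    exact le_of_sq_le_sq (by linarith) (by linarith)
  · have h := g.norm_ctr_sq t0
    exact le_of_sq_le_sq (by linarith [sq_nonneg γ]) (by linarith)

set_option maxHeartbeats 1600000 in
theorem lower_of_outer (t : Thr m γ t0 R h0 R2 η ε) (g : Geo n j m γ t0 R e) {V Kh : Euc n → ℝ}
    {c L : ℝ} (hV : RescaledSol n j m c L V Kh) (hc : c ≤ 1)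
    (hD : ∀ z : Euc n, 0 ≤ z j → ‖z‖ ≤ R2 → |V z - bubble m γ (ctrB j t0 R e) z| ≤ η)
    (hK : ∀ z : Euc n, 0 < z j → ‖z‖ < L → 0 < Kh z)
    (hL : R2 ≤ L) (hout : ∀ z : Euc n, 0 ≤ z j → ‖z‖ = L → (4:ℝ) ^ m * L ^ (-(2 * m)) ≤ V z)
    {z : Euc n} (hzj : 0 ≤ z j) (hz : R2 ≤ ‖z‖) (hzL : ‖z‖ ≤ L) :
    (γ * (1 - lrel γ t0 R)) ^ m * (‖z - ctrB j 1 R e‖ ^ 2) ^ (-m) ≤ V z := by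
  obtain ⟨r1, r2, -⟩ := g.lrel_facts
  obtain ⟨h1, h2⟩ := t.R2_facts g
  have hR := g.R4
  have hγ := g.γ0
  have hγ1 := g.γ1
  have hm := g.m1
  have hR2b := t.R2b
  have heta : ∀ y : Euc n, ‖y‖ ≤ R2 → η ≤ lrel γ t0 R / 2 * bubble m γ (ctrB j t0 R e) y :=
    fun y hy => (t.eta_le g hy).1
  obtain ⟨n1, nb⟩ := norm_ctr_le g
  set ϑ := lrel γ t0 R with hϑ
  have ha : 0 < γ * (1 - ϑ) := mul_pos hγ (by linarith)
  have ha1 : γ * (1 - ϑ) ≤ 1 := by nlinarith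
  refine hV.lower_bound g.hm (by linarith) ha ?_ (g.ctr_j 1) (r := R2) (by linarith) hK ?_ ?_
    hzj hz hzL
  · nlinarith
  · intro y hyj hyR
    have d1 := abs_le.1 (hD y hyj hyR.le)
    have d2 := heta y hyR.le
    set ρ := ‖y - ctrB j 1 R e‖ with hρ
    have hρ1 : 8 / ϑ ≤ ρ := by
      have := norm_sub_norm_le y (ctrB j 1 R e)
      linarith
    have hρ2 : 8 ≤ ρ * ϑ := by rwa [div_le_iff₀ r1] at hρ1
    have hρ0 : 512 ≤ ρ := by
      by_contra hcon
      push Not at hcon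
      have : ρ * ϑ ≤ ρ * (1 / 64) := mul_le_mul_of_nonneg_left (by linarith) (norm_nonneg _)
      linarith
    have htri : ‖y - ctrB j t0 R e‖ ≤ ρ + 3/2 := by
      have s1 := norm_sub_le_norm_sub_add_norm_sub y (ctrB j 1 R e) (ctrB j t0 R e)
      have ht := abs_le.1 g.ht
      have d2 : ‖ctrB j 1 R e - ctrB j t0 R e‖ ≤ 3/2 := by
        rw [Geo.dist_ctr, abs_le]; constructor <;> linarith [ht.1, ht.2]
      linarith
    have hA : γ ^ 2 + ‖y - ctrB j t0 R e‖ ^ 2 ≤ ρ ^ 2 * (1 + ϑ / 2) := by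
      have h7 : ‖y - ctrB j t0 R e‖ ^ 2 ≤ (ρ + 3/2) ^ 2 := by gcongr
      have h8 : ρ * 8 ≤ ρ * (ρ * ϑ) := mul_le_mul_of_nonneg_left hρ2 (norm_nonneg _)
      have h9 : γ ^ 2 ≤ 1 := pow_le_one₀ hγ.le hγ1
      linarith
    have hA0 : 0 < γ ^ 2 + ‖y - ctrB j t0 R e‖ ^ 2 := by positivity
    have hρp : 0 < ρ := by linarith
    have hχ : (γ * (1 - ϑ)) ^ m * (ρ ^ 2) ^ (-m) ≤ (1 - ϑ / 2) * bubble m γ (ctrB j t0 R e) y := by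
      have e1 : (γ * (1 - ϑ)) ^ m * (ρ ^ 2) ^ (-m) = (γ * (1 - ϑ) / ρ ^ 2) ^ m := by
        rw [Real.div_rpow ha.le (by positivity), Real.rpow_neg (by positivity), div_eq_mul_inv]
      rw [e1]
      have e2 : γ * (1 - ϑ) / ρ ^ 2 ≤
          (1 - ϑ / 2) * (γ / (γ ^ 2 + ‖y - ctrB j t0 R e‖ ^ 2)) := by
        rw [← mul_div_assoc, div_le_div_iff₀ (by positivity) hA0]
        have e3 : (1 - ϑ) * (γ ^ 2 + ‖y - ctrB j t0 R e‖ ^ 2) ≤ (1 - ϑ / 2) * ρ ^ 2 := by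
          have := mul_le_mul_of_nonneg_left hA (show 0 ≤ 1 - ϑ by linarith)
          nlinarith [sq_nonneg ρ]
        have := mul_le_mul_of_nonneg_left e3 hγ.le
        linarith
      calc (γ * (1 - ϑ) / ρ ^ 2) ^ m
          ≤ ((1 - ϑ / 2) * (γ / (γ ^ 2 + ‖y - ctrB j t0 R e‖ ^ 2))) ^ m :=
            Real.rpow_le_rpow (by positivity) e2 (by linarith)
        _ = (1 - ϑ / 2) ^ m * bubble m γ (ctrB j t0 R e) y := by
            rw [Real.mul_rpow (by linarith) (by positivity)]; rfl
        _ ≤ (1 - ϑ / 2) * bubble m γ (ctrB j t0 R e) y := by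
            have : (1 - ϑ / 2) ^ m ≤ 1 - ϑ / 2 :=
              Real.rpow_le_self_of_le_one (by linarith) (by linarith) hm
            have hb : 0 < bubble m γ (ctrB j t0 R e) y := by unfold bubble; positivity
            gcongr
    linarith [d1.1]
  · intro y hyj hyL
    refine le_trans ?_ (hout y hyj hyL)
    have hρ : L / 2 ≤ ‖y - ctrB j 1 R e‖ := by
      have := norm_sub_norm_le y (ctrB j 1 R e)
      linarith
    have hL0 : 0 < L := by linarith
    have e1 : (‖y - ctrB j 1 R e‖ ^ 2) ^ (-m) ≤ ((L / 2) ^ 2) ^ (-m) :=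
      Real.rpow_le_rpow_of_nonpos (by positivity) (by gcongr) (by linarith)
    have e2 : ((L / 2) ^ 2) ^ (-m) = 4 ^ m * L ^ (-(2 * m)) := by
      rw [show (L / 2) ^ 2 = 4⁻¹ * L ^ 2 by ring, Real.mul_rpow (by norm_num) (by positivity),
        Real.inv_rpow (by norm_num), Real.rpow_neg (by norm_num), inv_inv,
        ← Real.rpow_natCast L, ← Real.rpow_mul hL0.le]
      congr 2; push_cast; ring
    have e3 : (γ * (1 - ϑ)) ^ m ≤ 1 := Real.rpow_le_one ha.le ha1 (by linarith)
    rw [e2] at e1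
    calc _ ≤ 1 * (4 ^ m * L ^ (-(2 * m))) := by gcongr
      _ = _ := one_mul _

set_option maxHeartbeats 1600000 in
theorem start_outer (t : Thr m γ t0 R h0 R2 η ε) (g : Geo n j m γ t0 R e) {V Kh : Euc n → ℝ}
    {c L : ℝ} (hV : RescaledSol n j m c L V Kh) (hc : c ≤ 1)
    (hD : ∀ z : Euc n, 0 ≤ z j → ‖z‖ ≤ R2 → |V z - bubble m γ (ctrB j t0 R e) z| ≤ η)
    (hK : ∀ z : Euc n, 0 < z j → ‖z‖ < L → 0 < Kh z)
    (hL : R2 ≤ L) (hout : ∀ z : Euc n, 0 ≤ z j → ‖z‖ = L → (4:ℝ) ^ m * L ^ (-(2 * m)) ≤ V z)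
    {z : Euc n} {f : ℝ} (hzj : 0 ≤ z j) (hz : R2 ≤ ‖z‖) (hzL : ‖z‖ ≤ L)
    (hf : f ≤ h0 * (‖z‖ ^ 2 - linit γ t0 R) * (4 + ‖z - ctrB j 1 R e‖ ^ 2) ^ (-(m + 1))) :
    kel m (linit γ t0 R) V z + ε * f ≤ V z := by
  refine le_trans ?_ (t.lower_of_outer g hV hc hD hK hL hout hzj hz hzL)
  obtain ⟨n1, nb⟩ := norm_ctr_le g
  obtain ⟨l1, l2, l3, l4⟩ := g.linit_facts
  obtain ⟨r1, r2, -⟩ := g.lrel_facts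
  obtain ⟨h1, h2⟩ := t.R2_facts g
  have hR := g.R4
  have hγ := g.γ0
  have hγ1 := g.γ1
  have hm := g.m1
  have hη := t.η0
  have hε := t.ε0
  have hh0 := t.h00
  have hR2a := t.R2a
  have hR2c := t.R2c
  have hs3 := t.s3
  set ϑ := lrel γ t0 R with hϑ
  set l := linit γ t0 R with hl
  rw [div_le_iff₀ r1] at hR2a
  have hl0 : 0 < l := lt_of_lt_of_le (by positivity) l1
  have hz0 : 0 < ‖z‖ := by linarith
  have hN : 0 < ‖z‖ ^ 2 := by positivity
  have hzR : 3 * (R + 1) ≤ ‖z‖ * ϑ := by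
    have : R2 * ϑ ≤ ‖z‖ * ϑ := by gcongr
    linarith
  have hNl : 12 * l ≤ ‖z‖ ^ 2 := by
    have : R2 ^ 2 ≤ ‖z‖ ^ 2 := by gcongr; linarith
    linarith
  set w := (l / ‖z‖ ^ 2) • z with hw
  have hr1 : l / ‖z‖ ^ 2 ≤ 1 := (div_le_one hN).2 (by linarith)
  have hr0 : 0 < l / ‖z‖ ^ 2 := by positivity
  have hwj : 0 ≤ w j := by rw [hw, PiLp.smul_apply, smul_eq_mul]; positivity
  have hwR : ‖w‖ ≤ R2 := by
    have h3 : ‖w‖ ^ 2 ≤ R2 ^ 2 := by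
      rw [hw, norm_smul, Real.norm_of_nonneg hr0.le, mul_pow, div_pow]
      have : l ^ 2 / (‖z‖ ^ 2) ^ 2 * ‖z‖ ^ 2 = l * (l / ‖z‖ ^ 2) := by field_simp
      rw [this]
      exact (mul_le_of_le_one_right hl0.le hr1).trans (by linarith)
    exact le_of_sq_le_sq h3 (by linarith)
  have d2 := abs_le.1 (hD w hwj hwR)
  have hk := g.kel_bubble hl0 hN
  have hBk : kel m l V z = kel m l (bubble m γ (ctrB j t0 R e)) z
      + (l / ‖z‖ ^ 2) ^ m * (V w - bubble m γ (ctrB j t0 R e) w) := by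
    unfold kel; ring
  have hs : (lstar γ t0 R - l) * (‖z‖ ^ 2 - l) / l = 4 * ϑ * (‖z‖ ^ 2 - l) := by
    rw [l3]; field_simp
  rw [hs] at hk
  have hNm : (‖z‖ ^ 2) ^ (-m) = ((‖z‖ ^ 2) ^ m)⁻¹ := Real.rpow_neg hN.le m
  have hB : ‖z‖ ^ 2 * (1 + 3 * ϑ) ≤ γ ^ 2 + ‖z - ctrB j t0 R e‖ ^ 2 + 4 * ϑ * (‖z‖ ^ 2 - l) := by
    have h3 := norm_sub_norm_le z (ctrB j t0 R e)
    have h4 : (‖z‖ - (R + 1)) ^ 2 ≤ ‖z - ctrB j t0 R e‖ ^ 2 := by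
      have : 0 ≤ ‖z‖ - (R + 1) := by linarith
      gcongr
      linarith
    have h5 : 3 * (R + 1) * ‖z‖ ≤ ‖z‖ * ϑ * ‖z‖ := mul_le_mul_of_nonneg_right hzR hz0.le
    have h6 : 12 * l * ϑ ≤ ‖z‖ ^ 2 * ϑ := mul_le_mul_of_nonneg_right hNl r1.le
    have h7 := sq_nonneg γ
    have h8 := sq_nonneg (R + 1)
    linarith
  have hρ : ‖z - ctrB j 1 R e‖ ^ 2 ≤ ‖z‖ ^ 2 * (1 + ϑ) := by
    have h3 := norm_sub_le z (ctrB j 1 R e)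
    have h4 : ‖z - ctrB j 1 R e‖ ^ 2 ≤ (‖z‖ + (R + 1)) ^ 2 := by
      gcongr; linarith
    have h5 : (R + 1) * (R + 1) ≤ (R + 1) * ‖z‖ :=
      mul_le_mul_of_nonneg_left (by linarith) (by linarith)
    have h6 : 3 * (R + 1) * ‖z‖ ≤ ‖z‖ * ϑ * ‖z‖ := mul_le_mul_of_nonneg_right hzR hz0.le
    linarith
  have hρ0 : 0 < ‖z - ctrB j 1 R e‖ ^ 2 := by
    have := norm_sub_norm_le z (ctrB j 1 R e)
    have : 0 < ‖z - ctrB j 1 R e‖ := by linarith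
    positivity
  have k1 : kel m l (bubble m γ (ctrB j t0 R e)) z ≤
      (γ / (1 + 3 * ϑ)) ^ m * (‖z‖ ^ 2) ^ (-m) := by
    rw [hk, hNm, ← Real.inv_rpow hN.le, ← Real.mul_rpow (by positivity) (by positivity)]
    refine Real.rpow_le_rpow ?_ ?_ (by linarith)
    · refine div_nonneg hγ.le (le_trans ?_ hB); positivity
    · rw [← div_eq_mul_inv, div_div]
      refine div_le_div_of_nonneg_left hγ.le (by positivity) ?_
      linarith
  have k2 : (γ * (1 - ϑ) / (1 + ϑ)) ^ m * (‖z‖ ^ 2) ^ (-m) ≤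
      (γ * (1 - ϑ)) ^ m * (‖z - ctrB j 1 R e‖ ^ 2) ^ (-m) := by
    have ha : 0 < γ * (1 - ϑ) := mul_pos hγ (by linarith)
    rw [Real.div_rpow ha.le (by linarith), div_mul_eq_mul_div, mul_div_assoc]
    gcongr
    rw [div_eq_mul_inv, ← Real.rpow_neg (by linarith), ← Real.mul_rpow hN.le (by linarith)]
    exact Real.rpow_le_rpow_of_nonpos hρ0 hρ (by linarith)
  have k3 : (l / ‖z‖ ^ 2) ^ m * (V w - bubble m γ (ctrB j t0 R e) w) ≤
      η * l ^ m * (‖z‖ ^ 2) ^ (-m) := by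
    rw [Real.div_rpow hl0.le hN.le, hNm, div_eq_mul_inv]
    have h3 : 0 ≤ l ^ m * ((‖z‖ ^ 2) ^ m)⁻¹ := by positivity
    have := mul_le_mul_of_nonneg_left d2.2 h3
    linarith
  have k4 : ε * f ≤ ε * h0 * 4 ^ (m + 1) * (‖z‖ ^ 2) ^ (-m) := by
    have h3 : ‖z‖ ^ 2 / 4 ≤ 4 + ‖z - ctrB j 1 R e‖ ^ 2 := by
      have h3 := norm_sub_norm_le z (ctrB j 1 R e)
      have h4 : (‖z‖ / 2) ^ 2 ≤ ‖z - ctrB j 1 R e‖ ^ 2 := by gcongr; linarith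
      linarith
    have h4 : (4 + ‖z - ctrB j 1 R e‖ ^ 2) ^ (-(m + 1)) ≤ 4 ^ (m + 1) * (‖z‖ ^ 2) ^ (-(m + 1)) := by
      refine (Real.rpow_le_rpow_of_nonpos (by positivity) h3 (by linarith)).trans_eq ?_
      rw [div_eq_mul_inv, Real.mul_rpow hN.le (by norm_num), Real.inv_rpow (by norm_num),
        Real.rpow_neg (by norm_num : (0:ℝ) ≤ 4), inv_inv, mul_comm]
    have h5 : ‖z‖ ^ 2 * (‖z‖ ^ 2) ^ (-(m + 1)) = (‖z‖ ^ 2) ^ (-m) := by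
      rw [mul_comm, ← Real.rpow_add_one hN.ne']; ring_nf
    have h6 : f ≤ h0 * ‖z‖ ^ 2 * (4 ^ (m + 1) * (‖z‖ ^ 2) ^ (-(m + 1))) := by
      refine hf.trans ?_
      gcongr
      linarith
    calc ε * f ≤ ε * (h0 * ‖z‖ ^ 2 * (4 ^ (m + 1) * (‖z‖ ^ 2) ^ (-(m + 1)))) := by gcongr
      _ = ε * h0 * 4 ^ (m + 1) * (‖z‖ ^ 2 * (‖z‖ ^ 2) ^ (-(m + 1))) := by ring
      _ = _ := by rw [h5]
  have hp : 0 < (‖z‖ ^ 2) ^ (-m) := by positivity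
  have k5 := mul_le_mul_of_nonneg_right hs3 hp.le
  rw [hBk]
  linarith

end Thr

end

section

variable {n : ℕ}

theorem exists_barrierParams {m c1 A1 : ℝ} (hm : 1 ≤ m) (hc1 : 0 < c1) (hA1 : 0 < A1) :
    ∃ β h0 A2 R : ℝ, 4 ≤ R ∧ BarrierParams m β h0 A1 A2 R c1 := by
  set C2 : ℝ := 8 * 10 ^ (m + 1) with hC2
  have hC0 : 0 < C2 := by positivity
  set X : ℝ := 16 * (m + 1) * (m + 2) + 4 * (m + 2) with hX
  have hX0 : 0 < X := by positivity
  set β : ℝ := min (1/2) (c1 / (12 * (C2 * A1 * X))) with hβ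
  have hβ0 : 0 < β := by rw [hβ]; positivity
  have hβ1 : C2 * A1 * X * β ≤ c1 / 12 := by
    have h1 : β ≤ c1 / (12 * (C2 * A1 * X)) := min_le_right _ _
    calc C2 * A1 * X * β ≤ C2 * A1 * X * (c1 / (12 * (C2 * A1 * X))) := by gcongr
      _ = c1 / 12 := by field_simp
  have t1 : ∀ᶠ R : ℝ in atTop, R ^ (-(2 * β)) < (8 * 10 ^ (m + 1) * (3 * 18 ^ (m + 3)))⁻¹ :=
    (tendsto_rpow_neg_atTop (by positivity : 0 < 2 * β)).eventually_lt_const (by positivity)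
  have hq : 0 < (1/2) * (1 - (4:ℝ) ^ (-β)) * 2 ^ (-((m + 1) / β)) := by
    have : (4:ℝ) ^ (-β) < 1 := Real.rpow_lt_one_of_one_lt_of_neg (by norm_num) (by linarith)
    have : 0 < 1 - (4:ℝ) ^ (-β) := by linarith
    positivity
  have t2 : ∀ᶠ R : ℝ in atTop, R ^ (-(2 * (m + 1))) <
      (1/2) * (1 - (4:ℝ) ^ (-β)) * 2 ^ (-((m + 1) / β)) :=
    (tendsto_rpow_neg_atTop (by positivity : 0 < 2 * (m + 1))).eventually_lt_const hq
  obtain ⟨R, h1, h2, h3, h4⟩ := (t1.and (t2.and ((eventually_ge_atTop 4).and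
    (eventually_ge_atTop (C2 * ((16 * (m + 1) * (m + 2)) * 18 ^ (m + 3))))))).exists
  have hR0 : 0 < R := by linarith
  refine ⟨β, C2 * A1 / R, 3 * 18 ^ (m + 3) * (C2 * A1 / R), R, h3, ?_⟩
  have e10 : (10:ℝ) ^ (-(m + 1)) = (10 ^ (m + 1))⁻¹ := Real.rpow_neg (by norm_num) _
  constructor
  · exact hm
  · exact hβ0
  · exact min_le_left _ _
  · linarith
  · positivity
  · exact hA1
  · rfl
  · have : C2 * A1 / R * β * X = C2 * A1 * X * β / R := by ring
    rw [this, show c1 / (12 * R) = c1 / 12 / R by rw [div_div]]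
    gcongr
  · have : C2 * A1 / R * (16 * (m + 1) * (m + 2)) * 18 ^ (m + 3) =
        A1 * (C2 * ((16 * (m + 1) * (m + 2)) * 18 ^ (m + 3))) / R := by ring
    rw [this, div_le_iff₀ hR0]
    gcongr
  · rw [e10]
    have e1 : A1 / R = 1/8 * (C2 * A1 / R) * (10 ^ (m + 1))⁻¹ := by
      rw [hC2]; field_simp
    have e2 : 3 * 18 ^ (m + 3) * (C2 * A1 / R) * R ^ (-(2 * β)) ≤
        1/8 * (C2 * A1 / R) * (10 ^ (m + 1))⁻¹ := by
      calc _ ≤ 3 * 18 ^ (m + 3) * (C2 * A1 / R) * (8 * 10 ^ (m + 1) * (3 * 18 ^ (m + 3)))⁻¹ := by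
            gcongr
        _ = _ := by field_simp
    linarith
  · refine le_trans ?_ h2.le
    have : (10:ℝ) ^ (-(m + 1)) ≤ 1 :=
      Real.rpow_le_one_of_one_le_of_nonpos (by norm_num) (by linarith)
    exact mul_le_of_le_one_left (by positivity) (by linarith)

theorem eventually_mul_lt {a b : ℝ} (hb : 0 < b) : ∀ᶠ x : ℝ in 𝓝[>] 0, x * a < b := by
  have h : Tendsto (fun x : ℝ => x * a) (𝓝[>] 0) (𝓝 0) := by
    have : Tendsto (fun x : ℝ => x * a) (𝓝 0) (𝓝 (0 * a)) :=
      (continuous_id.mul continuous_const).tendsto 0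
    rw [zero_mul] at this
    exact this.mono_left nhdsWithin_le_nhds
  exact h.eventually_lt_const hb

theorem exists_thr {j : Fin n} {m γ t0 R h0 : ℝ} {e : Euc n} (g : Geo n j m γ t0 R e)
    (hh0 : 0 < h0) : ∃ R2 η ε0 : ℝ, 0 < ε0 ∧
      ∀ ε, 0 < ε → ε ≤ ε0 → Thr m γ t0 R h0 R2 η ε := by
  obtain ⟨r1, r2, -⟩ := g.lrel_facts
  obtain ⟨w1, -⟩ := g.lwidth_facts
  have hls := g.lstar_pos.2
  have hγ := g.γ0
  have hm := g.m1
  set ϑ := lrel γ t0 R with hϑ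
  obtain ⟨R2, a1, a2, a3, a4⟩ := ((eventually_ge_atTop (3 * (R + 1) / ϑ)).and
    ((eventually_ge_atTop (R + 1 + 8 / ϑ)).and ((eventually_ge_atTop (1:ℝ)).and
      (eventually_ge_atTop (12 * lstar γ t0 R + 12))))).exists
  have hR2 : 0 < R2 := by linarith
  have b1 : 0 < ϑ / 2 * (γ / (20 * R2 ^ 2)) ^ m := by positivity
  have b2 : 0 < γ ^ m * (4 * ϑ) * (40 * R2 ^ 2) ^ (-(m + 1)) := by positivity
  have b3 : 0 < (γ * (1 - ϑ) / (1 + ϑ)) ^ m - (γ / (1 + 3 * ϑ)) ^ m := by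
    refine sub_pos.2 (Real.rpow_lt_rpow (by positivity) ?_ (by linarith))
    rw [div_lt_div_iff₀ (by positivity) (by positivity), mul_assoc]
    refine mul_lt_mul_of_pos_left ?_ hγ
    nlinarith
  have b4 : 0 < γ ^ m * lwidth γ t0 R * (40 * (lstar γ t0 R + lwidth γ t0 R)) ^ (-(m + 1)) := by
    positivity
  obtain ⟨η, c1, c2, c3, c4, c0⟩ := ((eventually_mul_lt (a := 1) b1).and
    ((eventually_mul_lt (a := 1 + m) (half_pos b2)).and
      ((eventually_mul_lt (a := linit γ t0 R ^ m) (half_pos b3)).and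
        ((eventually_mul_lt (a := 2) b4).and eventually_mem_nhdsWithin)))).exists
  have hev : ∀ᶠ ε : ℝ in 𝓝[>] 0, ε * 1 < 1 ∧
      ε * h0 < γ ^ m * (4 * ϑ) * (40 * R2 ^ 2) ^ (-(m + 1)) / 2 ∧
      ε * (h0 * 4 ^ (m + 1)) < ((γ * (1 - ϑ) / (1 + ϑ)) ^ m - (γ / (1 + 3 * ϑ)) ^ m) / 2 ∧
      ε * (h0 * (2 * R ^ 2 + 4)) < 2 ∧ ε ∈ Ioi (0:ℝ) :=
    (eventually_mul_lt one_pos).and ((eventually_mul_lt (half_pos b2)).and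
      ((eventually_mul_lt (half_pos b3)).and
        ((eventually_mul_lt two_pos).and eventually_mem_nhdsWithin)))
  obtain ⟨ε0, d1, d2, d3, d4, d0⟩ := hev.exists
  refine ⟨R2, η, ε0, d0, fun ε hε hle => ?_⟩
  have f1 : ε * h0 ≤ ε0 * h0 := by gcongr
  have f2 : ε * (h0 * 4 ^ (m + 1)) ≤ ε0 * (h0 * 4 ^ (m + 1)) := by gcongr
  have f3 : ε * (h0 * (2 * R ^ 2 + 4)) ≤ ε0 * (h0 * (2 * R ^ 2 + 4)) := by gcongr
  constructor
  · exact hh0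
  · exact a1
  · exact a2
  · have : R2 * 1 ≤ R2 * R2 := by gcongr
    linarith
  · exact c0
  · exact hε
  · linarith
  · linarith
  · linarith
  · linarith
  · linarith
  · linarith

end

section

variable {n : ℕ}

namespace Thr

variable {j : Fin n} {m γ t0 R h0 R2 η ε : ℝ} {e : Euc n}

/-- Two-sided bounds for the Kelvin transform of an approximate bubble. -/
theorem kel_two_sided (t : Thr m γ t0 R h0 R2 η ε) (g : Geo n j m γ t0 R e) {V : Euc n → ℝ}
    (hD : ∀ z : Euc n, 0 ≤ z j → ‖z‖ ≤ R2 → |V z - bubble m γ (ctrB j t0 R e) z| ≤ η)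
    {l : ℝ} (hl : l ∈ Icc (linit γ t0 R) (lstar γ t0 R + lwidth γ t0 R)) {z : Euc n}
    (hzj : 0 ≤ z j) (hlN : l ≤ ‖z‖ ^ 2) :
    1/2 * (γ / 4) ^ m * (4 + ‖z - ctrB j 1 R e‖ ^ 2) ^ (-m) ≤ kel m l V z ∧
      kel m l V z ≤ 2 * (22 / γ ^ 2) ^ m * (4 + ‖z - ctrB j 1 R e‖ ^ 2) ^ (-m) := by
  obtain ⟨l1, l2, l3, l4⟩ := g.linit_facts
  obtain ⟨w1, w2, -⟩ := g.lwidth_facts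
  have hR := g.R4
  have hR2 := t.R2_facts g
  have hR2c := t.R2c
  have hl0 : 0 < l := lt_of_lt_of_le (by positivity) (l1.trans hl.1)
  have hγ2 : γ ^ 2 ≤ 1 := pow_le_one₀ g.γ0.le g.γ1
  have hls := g.lstar_pos.2
  have hN : 0 < ‖z‖ ^ 2 := by linarith
  have hwj : 0 ≤ ((l / ‖z‖ ^ 2) • z) j := by rw [PiLp.smul_apply, smul_eq_mul]; positivity
  have hlR2 : l < (R2 + 1) ^ 2 := by linarith [hl.2]
  have hwR : ‖(l / ‖z‖ ^ 2) • z‖ ≤ R2 := by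
    have h1 := (inv_mem hl0 hlR2 (by linarith) hlN).1
    refine le_of_sq_le_sq (h1.trans ?_) (by linarith)
    linarith [hl.2]
  have d := abs_le.1 (hD _ hwj hwR)
  have d2 := (t.eta_le g hwR).2
  refine g.kel_bounds (l1.trans hl.1) ?_ hlN (by linarith [d.1]) (by linarith [d.2])
  rw [abs_le]
  constructor <;> linarith [hl.1, hl.2]

/-- At the final radius the reflected bubble is too large. -/
theorem final_gap (t : Thr m γ t0 R h0 R2 η ε) (g : Geo n j m γ t0 R e) {V : Euc n → ℝ}
    (hD : ∀ z : Euc n, 0 ≤ z j → ‖z‖ ≤ R2 → |V z - bubble m γ (ctrB j t0 R e) z| ≤ η)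
    {l : ℝ} (hl : l = lstar γ t0 R + lwidth γ t0 R) {z : Euc n} (hzj : 0 ≤ z j)
    (hz : ‖z‖ ^ 2 = 2 * l) : V z < kel m l V z := by
  obtain ⟨w1, w2, -⟩ := g.lwidth_facts
  have hR := g.R4
  have hγ := g.γ0
  have hm := g.m1
  have hR2 := t.R2_facts g
  have hR2c := t.R2c
  have hη := t.η0
  have hγ2 : γ ^ 2 ≤ 1 := pow_le_one₀ g.γ0.le g.γ1
  obtain ⟨ls1, hls⟩ := g.lstar_pos
  have hRR : 16 ≤ R ^ 2 := by nlinarith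
  have hl0 : 0 < l := by linarith
  have hN : 0 < ‖z‖ ^ 2 := by linarith
  have hzR : ‖z‖ ≤ R2 := le_of_sq_le_sq (by linarith) (by linarith)
  have hr : l / ‖z‖ ^ 2 = 1/2 := by rw [hz]; field_simp
  have hwj : 0 ≤ ((l / ‖z‖ ^ 2) • z) j := by rw [PiLp.smul_apply, smul_eq_mul]; positivity
  have hwR : ‖(l / ‖z‖ ^ 2) • z‖ ≤ R2 := by
    rw [hr, norm_smul, Real.norm_of_nonneg (by norm_num)]
    linarith [norm_nonneg z]
  have d1 := abs_le.1 (hD _ hwj hwR)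
  have d2 := abs_le.1 (hD _ hzj hzR)
  have hk := g.kel_bubble hl0 hN
  have e1 : (lstar γ t0 R - l) * (‖z‖ ^ 2 - l) / l = - lwidth γ t0 R := by
    rw [hz, hl]; field_simp; ring
  rw [e1] at hk
  obtain ⟨g1, -, -, g4⟩ := g.geom z
  have hA0 : 0 < γ ^ 2 + ‖z - ctrB j t0 R e‖ ^ 2 + - lwidth γ t0 R := by
    have h1 : 0 < γ ^ 2 := by positivity
    have h2 := sq_nonneg ‖z - ctrB j t0 R e‖
    linarith
  have gap := rpow_convex_gap hm hγ hA0
    (show _ ≤ γ ^ 2 + ‖z - ctrB j t0 R e‖ ^ 2 by linarith)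
  have hA1 : γ ^ 2 + ‖z - ctrB j t0 R e‖ ^ 2 ≤ 40 * (lstar γ t0 R + lwidth γ t0 R) := by
    linarith [sq_nonneg γ]
  have hp : (40 * (lstar γ t0 R + lwidth γ t0 R)) ^ (-(m + 1)) ≤
      (γ ^ 2 + ‖z - ctrB j t0 R e‖ ^ 2) ^ (-(m + 1)) :=
    Real.rpow_le_rpow_of_nonpos (by linarith) hA1 (by linarith)
  have hU : bubble m γ (ctrB j t0 R e) z = (γ / (γ ^ 2 + ‖z - ctrB j t0 R e‖ ^ 2)) ^ m := rfl
  rw [← hU, ← hk] at gap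
  have e2 : γ ^ 2 + ‖z - ctrB j t0 R e‖ ^ 2 - (γ ^ 2 + ‖z - ctrB j t0 R e‖ ^ 2 + - lwidth γ t0 R)
      = lwidth γ t0 R := by ring
  rw [e2] at gap
  have h5 := mul_le_mul_of_nonneg_left hp (show 0 ≤ γ ^ m * lwidth γ t0 R by positivity)
  have hs4 := t.s4
  have hBk : kel m l V z = kel m l (bubble m γ (ctrB j t0 R e)) z
      + (l / ‖z‖ ^ 2) ^ m * (V ((l / ‖z‖ ^ 2) • z)
        - bubble m γ (ctrB j t0 R e) ((l / ‖z‖ ^ 2) • z)) := by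
    unfold kel; ring
  have hr1 : (l / ‖z‖ ^ 2) ^ m ≤ 1 :=
    Real.rpow_le_one (by positivity) (by rw [hr]; norm_num) (by linarith)
  have hr0 : 0 ≤ (l / ‖z‖ ^ 2) ^ m := by positivity
  have h6 : -η ≤ (l / ‖z‖ ^ 2) ^ m * (V ((l / ‖z‖ ^ 2) • z)
        - bubble m γ (ctrB j t0 R e) ((l / ‖z‖ ^ 2) • z)) := by
    have := mul_le_mul_of_nonneg_left d1.1 hr0
    have h7 : (l / ‖z‖ ^ 2) ^ m * η ≤ 1 * η := by gcongr
    linarith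
  rw [hBk]
  linarith [d2.2]

end Thr

/-- The constant in the gradient term of the barrier. -/
def bconst (m γ : ℝ) : ℝ := 2 * 18 ^ (m + 2) * (2 * (22 / γ ^ 2) ^ m) ^ ((m + 2) / m)

/-- The constant in the lower bound for the forcing term. -/
def fconst (m γ : ℝ) : ℝ := (1/2 * (γ / 4) ^ m) ^ ((m + 2) / m)

/-- The constant required in the lower bound on the outer boundary. -/
def oconst (m γ h0 : ℝ) : ℝ := 2 * (22 / γ ^ 2) ^ m * 4 ^ m + h0 * 4 ^ (m + 1) + 4 ^ m

set_option maxHeartbeats 1600000 in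
/-- The moving sphere contradiction: a rescaled solution close to a bubble cannot have a
coefficient with a large tangential slope. -/
theorem moving_sphere_contradiction {j : Fin n} {m γ t0 R h0 R2 η ε β A2 c L Kmax : ℝ} {e : Euc n}
    (g : Geo n j m γ t0 R e) (t : Thr m γ t0 R h0 R2 η ε)
    (hb : BarrierParams m β h0 (bconst m γ) A2 R (fconst m γ)) {V Kh : Euc n → ℝ}
    (hV : RescaledSol n j m c L V Kh) (hc : c ≤ γ ^ 2 / 88)
    (hK : ∀ z : Euc n, 0 < z j → ‖z‖ < L → 0 < Kh z ∧ Kh z ≤ Kmax)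
    (hKd : ∀ l, R ^ 2 ≤ l → ∀ z : Euc n, 0 < z j → l < ‖z‖ ^ 2 → ‖z‖ < L →
      ε * ((1 - l / ‖z‖ ^ 2) * (inner ℝ e z - ‖z‖ / 8)) ≤ Kh z - Kh ((l / ‖z‖ ^ 2) • z))
    (hL : R2 < L) (hout : ∀ z : Euc n, 0 ≤ z j → ‖z‖ = L →
      oconst m γ h0 * L ^ (-(2 * m)) ≤ V z)
    (hD : ∀ z : Euc n, 0 ≤ z j → ‖z‖ ≤ R2 → |V z - bubble m γ (ctrB j t0 R e) z| ≤ η)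
    (hDL : ∀ z w : Euc n, 0 ≤ z j → ‖z‖ ≤ R2 → 0 ≤ w j → ‖w‖ ≤ R2 →
      |(V z - bubble m γ (ctrB j t0 R e) z) - (V w - bubble m γ (ctrB j t0 R e) w)|
        ≤ η * ‖z - w‖) : False := by
  obtain ⟨l1, l2, l3, l4⟩ := g.linit_facts
  obtain ⟨w1, w2, -⟩ := g.lwidth_facts
  obtain ⟨n1, nb⟩ := Thr.norm_ctr_le g
  have hR := g.R4
  have hγ := g.γ0
  have hm := g.m1
  have hR2 := t.R2_facts g
  have hR2c := t.R2c
  have hε := t.ε0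
  have hε1 := t.ε1
  have hh0 := t.h00
  have hγ2 : γ ^ 2 ≤ 1 := pow_le_one₀ g.γ0.le g.γ1
  have hγ20 : 0 < γ ^ 2 := by positivity
  have hls := g.lstar_pos.2
  have hL0 : 0 < L := by linarith
  have hRR : 16 ≤ R ^ 2 := by nlinarith
  have hctr := g.norm_ctr_sq 1
  have hctrj := g.ctr_j 1
  have hlt : lstar γ t0 R ≤ R ^ 2 + 5/4 := by unfold lstar; linarith [g.hγt]
  set z0 := ctrB j 1 R e with hz0
  set κ : ℝ := 22 / γ ^ 2 with hκ
  have hκ1 : 1 ≤ κ := by rw [hκ, le_div_iff₀ hγ20]; linarith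
  have hκm : 1 ≤ κ ^ m := Real.one_le_rpow hκ1 (by linarith)
  set lend := lstar γ t0 R + lwidth γ t0 R with hlend
  have hA1 : 0 < bconst m γ := hb.A10
  set f : ℝ → Euc n → ℝ := fun l z => ε * barrier m β h0 (bconst m γ) A2 z0 l z with hf
  have hRl : ∀ l ∈ Icc (linit γ t0 R) lend, R ^ 2 ≤ l := fun l hl => l1.trans hl.1
  have hTN : ∀ l ∈ Icc (linit γ t0 R) lend, ∀ z : Euc n, l ≤ ‖z‖ ^ 2 →
      4 + ‖z - z0‖ ^ 2 ≤ 10 * ‖z‖ ^ 2 := by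
    intro l hl z hz
    obtain ⟨-, -, -, g4⟩ := g.geom z
    linarith [hRl l hl]
  have hT0 : ∀ z : Euc n, 4 ≤ 4 + ‖z - z0‖ ^ 2 := fun z => by
    linarith [sq_nonneg ‖z - z0‖]
  have hf0 : ∀ l ∈ Icc (linit γ t0 R) lend, ∀ z : Euc n, l ≤ ‖z‖ ^ 2 → 0 ≤ f l z := by
    intro l hl z hz
    exact mul_nonneg hε.le (hb.bounds (hRl l hl) hz (hTN l hl z hz)).1
  have hfs : ∀ l ∈ Icc (linit γ t0 R) lend, ∀ z : Euc n, l ≤ ‖z‖ ^ 2 →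
      barrier m β h0 (bconst m γ) A2 z0 l z ≤
        h0 * (‖z‖ ^ 2 - l) * (4 + ‖z - z0‖ ^ 2) ^ (-(m + 1)) := fun l hl z hz =>
    hb.le_simple (hRl l hl) hz (hTN l hl z hz)
  have hκL : lend < L ^ 2 := by
    have : R2 ^ 2 ≤ L ^ 2 := by
      have : 0 ≤ R2 := by linarith
      gcongr
    linarith
  have hc1 : c ≤ 1 := by linarith
  have key : ∀ {l : ℝ}, l ∈ Icc (linit γ t0 R) lend → ∀ {z : Euc n}, 0 ≤ z j → l ≤ ‖z‖ ^ 2 →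
      ‖z‖ ≤ L → kel m l V z + f l z ≤ V z := by
    intro l hl z hzj hlz hzL
    refine hV.moving_spheres g.hm (by linarith) hL0 (l0 := linit γ t0 R) (l1 := lend)
      (Kmax := Kmax) (μ := ε * (bconst m γ * (L ^ 2) ^ (-(m + 3/2)))) (Wmax := 2 * κ ^ m)
      (by linarith) hκL (by positivity) (by positivity) (fun z h1 h2 => ⟨(hK z h1 h2).1.le,
        (hK z h1 h2).2⟩) f (fun l hl z _ h _ => hf0 l hl z h) ?_ ?_ ?_ ?_ ?_ ?_ ?_ hl hzj hlz hzL
    · intro l hl z _ hz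
      simp only [hf]
      rw [barrier_eq_zero (by linarith [hRl l hl]) hz, mul_zero]
    · refine continuousOn_const.mul (barrier_continuousOn ?_)
      rintro p ⟨hp1, -, hp2, -⟩
      exact ⟨by linarith [hRl _ hp1], hp2⟩
    · intro l hl z hzj hlz hzL
      have hl0 : 0 < l := by linarith [hRl l hl]
      have hk := t.kel_two_sided g hD hl hzj.le hlz.le
      have hkp : 0 < kel m l V z := by
        refine lt_of_lt_of_le ?_ hk.1
        have : 0 < 4 + ‖z - z0‖ ^ 2 := by linarith [hT0 z]
        positivity
      obtain ⟨a, ℓ, h1, h2⟩ := hb.lap_ge g.hm (z := z) (z0 := z0)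
        (by linarith [hRl l hl]) hlz.le (by linarith [hl.2])
        (g.rhs_bound hl0 hlz.le hk.1 hk.2)
      refine ⟨_, _, h1.const_mul ε, ?_⟩
      have h3 := hKd l (hRl l hl) z hzj hlz hzL
      have h4 : 0 < kel m l V z ^ ((m + 2) / m) := by positivity
      have h5 := mul_le_mul_of_nonneg_right h3 h4.le
      have hN : 0 < ‖z‖ ^ 2 := by linarith
      have h6 : (L ^ 2) ^ (-(m + 3/2)) ≤ (‖z‖ ^ 2) ^ (-(m + 3/2)) :=
        Real.rpow_le_rpow_of_nonpos hN (by gcongr) (by linarith)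
      have h7 : bconst m γ * (L ^ 2) ^ (-(m + 3/2)) ≤ bconst m γ * (‖z‖ ^ 2) ^ (-(m + 3/2)) := by
        gcongr
      have h8 := mul_le_mul_of_nonneg_left (add_le_add_right h7
        (-((1 - l / ‖z‖ ^ 2) * (inner ℝ e z - ‖z‖ / 8) * kel m l V z ^ ((m + 2) / m)))) hε.le
      have h9 := mul_le_mul_of_nonneg_left h2 hε.le
      linarith
    · intro l hl z hzj hlz hzL
      have hk := t.kel_two_sided g hD hl hzj.ge hlz.le
      have hT : 0 < 4 + ‖z - z0‖ ^ 2 := by linarith [hT0 z]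
      have hkp : 0 < kel m l V z := lt_of_lt_of_le (by positivity) hk.1
      obtain ⟨d, h1, h2⟩ := hb.hasNd hzj hctrj (hRl l hl) hlz.le (hTN l hl z hlz.le)
      have hfz := hf0 l hl z hlz.le
      have hb0 := (hb.bounds (hRl l hl) hlz.le (hTN l hl z hlz.le)).1
      refine ⟨ε * d, HasDerivWithinAt.const_mul ε h1, mul_nonneg hε.le (le_trans (by positivity) h2), ?_⟩
      refine (flux_bound hm hkp hfz hT (κ := κ) (by linarith) ?_ ?_).trans ?_
      · have h3 := mul_le_mul_of_nonneg_left (hfs l hl z hlz.le) hε.le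
        have h4 : ‖z‖ ^ 2 - l ≤ (2 * R ^ 2 + 4) * (4 + ‖z - z0‖ ^ 2) := by
          have h5 : ‖z‖ ≤ ‖z - z0‖ + ‖z0‖ := by simpa using norm_add_le (z - z0) z0
          have h6 : ‖z‖ ^ 2 ≤ (‖z - z0‖ + ‖z0‖) ^ 2 := by gcongr
          have h7 : 0 ≤ R ^ 2 * ‖z - z0‖ ^ 2 := by positivity
          linarith [sq_nonneg (‖z - z0‖ - ‖z0‖), sq_nonneg ‖z - z0‖, hRl l hl]
        have h5 : (4 + ‖z - z0‖ ^ 2) * (4 + ‖z - z0‖ ^ 2) ^ (-(m + 1))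
            = (4 + ‖z - z0‖ ^ 2) ^ (-m) := by
          rw [mul_comm, ← Real.rpow_add_one hT.ne']; ring_nf
        have h6 : ε * (h0 * (‖z‖ ^ 2 - l) * (4 + ‖z - z0‖ ^ 2) ^ (-(m + 1))) ≤
            2 * (4 + ‖z - z0‖ ^ 2) ^ (-m) := by
          calc _ ≤ ε * (h0 * ((2 * R ^ 2 + 4) * (4 + ‖z - z0‖ ^ 2)) *
                  (4 + ‖z - z0‖ ^ 2) ^ (-(m + 1))) := by gcongr
            _ = ε * h0 * (2 * R ^ 2 + 4) * ((4 + ‖z - z0‖ ^ 2) *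
                  (4 + ‖z - z0‖ ^ 2) ^ (-(m + 1))) := by ring
            _ ≤ 2 * (4 + ‖z - z0‖ ^ 2) ^ (-m) := by
                rw [h5]; gcongr; exact t.s5
        have h7 : 1 * (4 + ‖z - z0‖ ^ 2) ^ (-m) ≤ κ ^ m * (4 + ‖z - z0‖ ^ 2) ^ (-m) := by gcongr
        have h8 : f l z = ε * barrier m β h0 (bconst m γ) A2 z0 l z := rfl
        linarith [hk.2]
      · have : 4 * κ * c ≤ 4 * κ * (γ ^ 2 / 88) := by gcongr
        refine this.trans_eq ?_
        rw [hκ]; field_simp; norm_num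
      · have h3 := mul_le_mul_of_nonneg_left h2 hε.le
        refine le_trans (le_of_eq ?_) h3
        simp only [hf]; ring
    · intro l hl z hzj hlz hzL
      refine (t.kel_two_sided g hD hl hzj hlz).2.trans ?_
      have : (4 + ‖z - z0‖ ^ 2) ^ (-m) ≤ 1 :=
        Real.rpow_le_one_of_one_le_of_nonpos (by linarith [hT0 z]) (by linarith)
      exact mul_le_of_le_one_right (by positivity) this
    · intro l hl z hzj hzL
      have hlz : l ≤ ‖z‖ ^ 2 := by rw [hzL]; linarith [hl.2]
      have hk := (t.kel_two_sided g hD hl hzj hlz).2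
      have h2 := hfs l hl z hlz
      have hT : L ^ 2 / 4 ≤ 4 + ‖z - z0‖ ^ 2 := by
        have h3 := norm_sub_norm_le z z0
        have h4 : (L / 2) ^ 2 ≤ ‖z - z0‖ ^ 2 := by gcongr; linarith
        linarith
      have hconv : ∀ s : ℝ, 0 < s → (4 + ‖z - z0‖ ^ 2) ^ (-s) ≤ 4 ^ s * L ^ (-(2 * s)) := by
        intro s hs
        refine (Real.rpow_le_rpow_of_nonpos (by positivity) hT (by linarith)).trans_eq ?_
        rw [show L ^ 2 / 4 = 4⁻¹ * L ^ 2 by ring, Real.mul_rpow (by norm_num) (by positivity),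
          Real.inv_rpow (by norm_num), Real.rpow_neg (by norm_num), inv_inv,
          ← Real.rpow_natCast L, ← Real.rpow_mul hL0.le]
        congr 2; push_cast; ring
      have h3 := hconv m (by linarith)
      have h4 := hconv (m + 1) (by linarith)
      have h5 : L ^ 2 * L ^ (-(2 * (m + 1))) = L ^ (-(2 * m)) := by
        rw [← Real.rpow_natCast L, ← Real.rpow_add hL0]; congr 1; push_cast; ring
      have h6 : f l z ≤ h0 * 4 ^ (m + 1) * L ^ (-(2 * m)) := by
        have h7 := hf0 l hl z hlz
        have hb0 := (hb.bounds (hRl l hl) hlz (hTN l hl z hlz)).1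
        calc f l z ≤ barrier m β h0 (bconst m γ) A2 z0 l z := mul_le_of_le_one_left hb0 hε1
          _ ≤ h0 * (‖z‖ ^ 2 - l) * (4 + ‖z - z0‖ ^ 2) ^ (-(m + 1)) := h2
          _ ≤ h0 * L ^ 2 * (4 ^ (m + 1) * L ^ (-(2 * (m + 1)))) := by
              have : ‖z‖ ^ 2 - l ≤ L ^ 2 := by rw [hzL]; linarith [hRl l hl]
              gcongr
          _ = h0 * 4 ^ (m + 1) * (L ^ 2 * L ^ (-(2 * (m + 1)))) := by ring
          _ = _ := by rw [h5]
      have h7 : 2 * κ ^ m * (4 + ‖z - z0‖ ^ 2) ^ (-m) ≤ 2 * κ ^ m * (4 ^ m * L ^ (-(2 * m))) := by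
        gcongr
      have h8 := hout z hzj hzL
      unfold oconst at h8
      have h9 : 0 < (4:ℝ) ^ m * L ^ (-(2 * m)) := by positivity
      linarith
    · intro z hzj hlz hzL
      have hmem : linit γ t0 R ∈ Icc (linit γ t0 R) lend := ⟨le_rfl, by linarith⟩
      have h1 := hfs _ hmem z hlz
      rcases le_total ‖z‖ R2 with h2 | h2
      · exact t.start_inner g hD hDL hzj h2 hlz h1
      · refine t.start_outer g hV hc1 hD (fun z a b => (hK z a b).1) hL.le ?_ hzj h2 hzL h1
        intro y hyj hyL
        refine le_trans ?_ (hout y hyj hyL)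
        have h3 : (4:ℝ) ^ m ≤ oconst m γ h0 := by
          unfold oconst
          have : 0 ≤ 2 * (22 / γ ^ 2) ^ m * 4 ^ m + h0 * 4 ^ (m + 1) := by positivity
          linarith
        gcongr
  -- contradiction at the final radius
  have hl0 : 0 < lend := by linarith
  set z1 : Euc n := Real.sqrt (2 * lend) • e with hz1
  have hz1n : ‖z1‖ ^ 2 = 2 * lend := by
    rw [hz1, norm_smul, g.e1, mul_one, Real.norm_of_nonneg (Real.sqrt_nonneg _),
      Real.sq_sqrt (by linarith)]
  have hz1j : 0 ≤ z1 j := by rw [hz1, PiLp.smul_apply, g.ej, smul_zero]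
  have hmem : lend ∈ Icc (linit γ t0 R) lend := ⟨by linarith, le_rfl⟩
  have hz1L : ‖z1‖ ≤ L := by
    have : ‖z1‖ ≤ R2 := le_of_sq_le_sq (by linarith) (by linarith)
    linarith
  have h1 := key hmem hz1j (by linarith) hz1L
  have h2 := hf0 lend hmem z1 (by linarith)
  have h3 := t.final_gap g hD hlend hz1j hz1n
  linarith

end

section

variable {n : ℕ}

theorem convex_upperHalf (h0 : 0 < n) : Convex ℝ (upperHalf n h0) :=
  convex_halfSpace_gt (EuclideanSpace.proj (𝕜 := ℝ) (lastIdx n h0)).isLinear 0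

theorem isOpen_upperHalf (h0 : 0 < n) : IsOpen (upperHalf n h0) :=
  isOpen_lt continuous_const (EuclideanSpace.proj (𝕜 := ℝ) (lastIdx n h0)).continuous

theorem add_smul_single_apply (x : Euc n) (j : Fin n) (t : ℝ) :
    (x + t • (EuclideanSpace.single j (1:ℝ) : Euc n)) j = x j + t := by simp

theorem tendsto_add_smul_single (x : Euc n) (j : Fin n) :
    Tendsto (fun t : ℝ => x + t • (EuclideanSpace.single j (1:ℝ) : Euc n)) (𝓝[>] 0) (𝓝 x) := by
  have : Continuous (fun t : ℝ => x + t • (EuclideanSpace.single j (1:ℝ) : Euc n)) := by fun_prop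
  have h := this.tendsto 0
  simp only [zero_smul, add_zero] at h
  exact h.mono_left nhdsWithin_le_nhds

theorem closure_upperHalf (h0 : 0 < n) : closure (upperHalf n h0) = {x | 0 ≤ x (lastIdx n h0)} := by
  refine Subset.antisymm (closure_minimal (fun x (hx : 0 < x (lastIdx n h0)) => hx.le)
    (isClosed_le continuous_const (EuclideanSpace.proj (𝕜 := ℝ) (lastIdx n h0)).continuous)) ?_
  intro x hx
  refine mem_closure_of_tendsto (tendsto_add_smul_single x (lastIdx n h0)) ?_
  filter_upwards [eventually_mem_nhdsWithin] with t ht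
  change 0 < (x + t • (EuclideanSpace.single (lastIdx n h0) (1:ℝ) : Euc n)) (lastIdx n h0)
  rw [add_smul_single_apply]
  exact add_pos_of_nonneg_of_pos hx ht

theorem mem_closure_halfBall (h0 : 0 < n) {r : ℝ} {x : Euc n} (hx : ‖x‖ < r)
    (hx0 : 0 ≤ x (lastIdx n h0)) : x ∈ closure (halfBall n h0 r) := by
  refine mem_closure_of_tendsto (tendsto_add_smul_single x (lastIdx n h0)) ?_
  filter_upwards [eventually_mem_nhdsWithin, (tendsto_add_smul_single x (lastIdx n h0)).norm.eventually_lt_const hx]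
    with t ht hlt
  refine ⟨by simpa using hlt, ?_⟩
  change 0 < (x + t • (EuclideanSpace.single (lastIdx n h0) (1:ℝ) : Euc n)) (lastIdx n h0)
  rw [add_smul_single_apply]
  exact add_pos_of_nonneg_of_pos hx0 ht

theorem isOpen_halfBall (h0 : 0 < n) (r : ℝ) : IsOpen (halfBall n h0 r) :=
  isOpen_ball.inter (isOpen_upperHalf h0)

theorem convex_closure_halfBall (h0 : 0 < n) (r : ℝ) : Convex ℝ (closure (halfBall n h0 r)) :=
  ((convex_ball 0 r).inter (convex_upperHalf h0)).closure

theorem isCompact_closure_halfBall (h0 : 0 < n) (r : ℝ) : IsCompact (closure (halfBall n h0 r)) :=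
  (isBounded_ball.subset inter_subset_left).isCompact_closure

theorem uniqueDiffOn_closure_halfBall (h0 : 0 < n) :
    UniqueDiffOn ℝ (closure (halfBall n h0 1)) := by
  refine uniqueDiffOn_convex (convex_closure_halfBall h0 1) ?_
  refine Nonempty.mono (interior_maximal subset_closure (isOpen_halfBall h0 1)) ?_
  refine ⟨(1/2 : ℝ) • EuclideanSpace.single (lastIdx n h0) (1:ℝ), ?_, ?_⟩
  · rw [mem_ball_zero_iff, norm_smul]; norm_num
  · change 0 < ((1/2 : ℝ) • EuclideanSpace.single (lastIdx n h0) (1:ℝ) : Euc n) (lastIdx n h0)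
    simp

theorem closure_halfBall_mem_nhdsWithin (h0 : 0 < n) {x : Euc n} (hx : ‖x‖ < 1) :
    closure (halfBall n h0 1) ∈ 𝓝[{y | 0 ≤ y (lastIdx n h0)}] x := by
  have h1 : ball (0 : Euc n) 1 ∈ 𝓝 x := isOpen_ball.mem_nhds (by simpa using hx)
  filter_upwards [mem_nhdsWithin_of_mem_nhds h1, self_mem_nhdsWithin] with y hy hy0
  exact mem_closure_halfBall h0 (by simpa using hy) hy0

theorem closure_halfBall_mem_nhds (h0 : 0 < n) {x : Euc n} (hx : ‖x‖ < 1)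
    (hx0 : 0 < x (lastIdx n h0)) : closure (halfBall n h0 1) ∈ 𝓝 x :=
  mem_of_superset ((isOpen_halfBall h0 1).mem_nhds ⟨by simpa using hx, hx0⟩) subset_closure

/-- A solution of the boundary Yamabe system, rescaled about a boundary point. -/
theorem RescaledSol.of_isYamabeSol (h0 : 0 < n) {m : ℝ} (hm : (n : ℝ) = 2 * m + 2) (hm0 : 0 < m)
    {K u : Euc n → ℝ} {c M Γ L : ℝ} (hu : IsYamabeSol n h0 K (fun _ => c) u) (hM : 0 < M)
    (hΓ : Γ = M ^ (1 / m)) {a : Euc n} (ha : a (lastIdx n h0) = 0)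
    (hmap : ∀ z : Euc n, ‖z‖ ≤ L → ‖a + Γ⁻¹ • z‖ < 1) :
    RescaledSol n (lastIdx n h0) m c L (fun z => u (a + Γ⁻¹ • z) / M)
      (fun z => K (a + Γ⁻¹ • z)) := by
  obtain ⟨hu2, hupos, hulap, hunor⟩ := hu
  have hΓ0 : 0 < Γ := by rw [hΓ]; positivity
  have hS := uniqueDiffOn_closure_halfBall h0
  have hj : ∀ z : Euc n, (a + Γ⁻¹ • z) (lastIdx n h0) = Γ⁻¹ * z (lastIdx n h0) := by
    intro z; simp [ha]
  have hmem : ∀ z : Euc n, 0 ≤ z (lastIdx n h0) → ‖z‖ ≤ L →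
      a + Γ⁻¹ • z ∈ closure (halfBall n h0 1) := by
    intro z hz hzL
    refine mem_closure_halfBall h0 (hmap z hzL) ?_
    rw [hj]; positivity
  have haff : ∀ z : Euc n, HasFDerivAt (fun z : Euc n => a + Γ⁻¹ • z)
      (Γ⁻¹ • ContinuousLinearMap.id ℝ (Euc n)) z := fun z =>
    ((hasFDerivAt_id z).const_smul Γ⁻¹).const_add a
  have haffc : Continuous (fun z : Euc n => a + Γ⁻¹ • z) := by fun_prop
  have hq : ((n:ℝ) + 2) / ((n:ℝ) - 2) = (m + 2) / m := by
    rw [hm, div_eq_div_iff (by linarith) (by linarith)]; ring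
  have hq2 : (n:ℝ) / ((n:ℝ) - 2) = (m + 1) / m := by
    rw [hm, div_eq_div_iff (by linarith) (by linarith)]; ring
  refine ⟨?_, ?_, ?_, ?_⟩
  · refine ContinuousOn.div_const ?_ _
    exact hu2.continuousOn.comp haffc.continuousOn (fun z hz => hmem z hz.1 hz.2)
  · intro z hz hzL
    exact div_pos (hupos _ (hmem z hz hzL)) hM
  · intro z hz hzL
    set S := closure (halfBall n h0 1) with hSdef
    have hpos : ∀ y : Euc n, 0 < y (lastIdx n h0) → ‖y‖ < L → S ∈ 𝓝 (a + Γ⁻¹ • y) := by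
      intro y hy hyL
      refine closure_halfBall_mem_nhds h0 (hmap y hyL.le) ?_
      rw [hj]; positivity
    have hnear : ∀ᶠ y : Euc n in 𝓝 z, 0 < y (lastIdx n h0) ∧ ‖y‖ < L :=
      Eventually.and (show ∀ᶠ y in 𝓝 z, y ∈ upperHalf n h0 from (isOpen_upperHalf h0).mem_nhds hz)
        (continuous_norm.continuousAt.eventually_lt_const hzL)
    have hd : DifferentiableOn ℝ u S := hu2.differentiableOn (by norm_num)
    have hd2 : DifferentiableOn ℝ (fderivWithin ℝ u S) S :=
      (hu2.fderivWithin hS (m := 1) (by norm_num)).differentiableOn (by norm_num)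
    have hξ := hmem z hz.le hzL.le
    refine ⟨fun y => M⁻¹ • Γ⁻¹ • fderivWithin ℝ u S (a + Γ⁻¹ • y),
      M⁻¹ • Γ⁻¹ • Γ⁻¹ • fderivWithin ℝ (fderivWithin ℝ u S) S (a + Γ⁻¹ • z), ?_, ?_, ?_⟩
    · filter_upwards [hnear] with y hy
      have h1 := ((hd _ (hmem y hy.1.le hy.2.le)).hasFDerivWithinAt.hasFDerivAt
        (hpos y hy.1 hy.2)).comp y (haff y)
      have h2 := h1.const_mul M⁻¹
      refine (h2.congr_fderiv ?_).congr_of_eventuallyEq (Eventually.of_forall fun w => ?_)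
      · ext w; simp
      · simp [div_eq_inv_mul]
    · have h1 := ((hd2 _ hξ).hasFDerivWithinAt.hasFDerivAt (hpos z hz hzL)).comp z (haff z)
      have h2 := (h1.const_smul Γ⁻¹).const_smul M⁻¹
      refine (h2.congr_fderiv ?_).congr_of_eventuallyEq (Eventually.of_forall fun w => ?_)
      · ext w; simp
      · rfl
    · have h1 := hulap (a + Γ⁻¹ • z) ⟨by simpa using hmap z hzL.le, by
        change 0 < (a + Γ⁻¹ • z) (lastIdx n h0)
        rw [hj]; positivity⟩
      unfold lapWithin at h1
      rw [hq] at h1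
      have h2 : ∑ i : Fin n, fderivWithin ℝ (fderivWithin ℝ u S) S (a + Γ⁻¹ • z)
          (EuclideanSpace.single i (1:ℝ)) (EuclideanSpace.single i (1:ℝ)) =
          - (K (a + Γ⁻¹ • z) * u (a + Γ⁻¹ • z) ^ ((m + 2) / m)) := by
        rw [← add_eq_zero_iff_eq_neg, ← h1]
        congr 1
        refine Finset.sum_congr rfl fun i _ => ?_
        rw [iteratedFDerivWithin_two_apply u hS hξ]
        rfl
      have hu0 := hupos _ hξ
      have h3 : M ^ ((m + 2) / m) = M * (Γ * Γ) := by
        rw [hΓ, ← Real.rpow_add hM, show (m + 2) / m = 1 + (1 / m + 1 / m) by field_simp; ring,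
          Real.rpow_add hM, Real.rpow_one]
      rw [Real.div_rpow hu0.le hM.le, h3]
      calc ∑ i, (M⁻¹ • Γ⁻¹ • Γ⁻¹ • fderivWithin ℝ (fderivWithin ℝ u S) S (a + Γ⁻¹ • z))
            (EuclideanSpace.single i (1:ℝ)) (EuclideanSpace.single i (1:ℝ))
          = M⁻¹ * (Γ⁻¹ * Γ⁻¹) * ∑ i, fderivWithin ℝ (fderivWithin ℝ u S) S (a + Γ⁻¹ • z)
            (EuclideanSpace.single i (1:ℝ)) (EuclideanSpace.single i (1:ℝ)) := by
            rw [Finset.mul_sum]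
            refine Finset.sum_congr rfl fun i _ => ?_
            simp only [_root_.smul_apply, smul_eq_mul]; ring
        _ = _ := by rw [h2]; field_simp
  · intro z hz hzL
    set S := closure (halfBall n h0 1) with hSdef
    have hξ := hmem z hz.ge hzL.le
    have hd : DifferentiableOn ℝ u S := hu2.differentiableOn (by norm_num)
    have h1 := (hd _ hξ).hasFDerivWithinAt
    have h2 : HasFDerivWithinAt u (fderivWithin ℝ u S (a + Γ⁻¹ • z)) {y | 0 ≤ y (lastIdx n h0)}
        (a + Γ⁻¹ • z) :=
      h1.mono_of_mem_nhdsWithin (closure_halfBall_mem_nhdsWithin h0 (hmap z hzL.le))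
    have h3 := (h2.comp z (haff z).hasFDerivWithinAt (s := {y | 0 ≤ y (lastIdx n h0)})
      (fun y hy => by
        change 0 ≤ (a + Γ⁻¹ • y) (lastIdx n h0)
        rw [hj]
        have : 0 ≤ y (lastIdx n h0) := hy
        positivity)).const_mul M⁻¹
    refine ⟨M⁻¹ • Γ⁻¹ • fderivWithin ℝ u S (a + Γ⁻¹ • z), ?_, ?_⟩
    · refine (h3.congr_fderiv ?_).congr (fun w _ => ?_) ?_
      · ext w; simp
      · simp [div_eq_inv_mul]
      · simp [div_eq_inv_mul]
    · have h4 := hunor (a + Γ⁻¹ • z) ⟨by simpa using hmap z hzL.le, by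
        change (a + Γ⁻¹ • z) (lastIdx n h0) = 0
        rw [hj, hz, mul_zero]⟩
      unfold normalDerivWithin at h4
      rw [hq2] at h4
      have h5 : M ^ ((m + 1) / m) = M * Γ := by
        rw [hΓ, show (m + 1) / m = 1 + 1 / m by field_simp, Real.rpow_add hM, Real.rpow_one]
      have hu0 := hupos _ hξ
      simp only [_root_.smul_apply, smul_eq_mul]
      rw [Real.div_rpow hu0.le hM.le, h5, h4]
      field_simp

end

section

variable {n : ℕ}

theorem contDiffOn_two_of_condK1 {h0 : 0 < n} (hn : 4 ≤ n) {C₀ : ℝ} {K : Euc n → ℝ}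
    (h1 : CondK1 n h0 C₀ K) : ContDiffOn ℝ 2 K (closure (halfBall n h0 1)) :=
  h1.1.of_le (by
    have : 2 ≤ n - 2 := by omega
    exact_mod_cast this)

theorem norm_fderivWithin_le_of_condK2 {h0 : 0 < n} (hn : 4 ≤ n) {Λ : ℝ} {K : Euc n → ℝ}
    (h2 : CondK2 n h0 Λ K) {x : Euc n} (hx : x ∈ closure (halfBall n h0 1)) :
    ‖fderivWithin ℝ K (closure (halfBall n h0 1)) x‖ ≤ Λ := by
  rw [← norm_iteratedFDerivWithin_one K (uniqueDiffOn_closure_halfBall h0 x hx)]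
  exact (h2 x hx).2 1 le_rfl (by omega)

theorem norm_fderivWithin_sub_le {h0 : 0 < n} (hn : 4 ≤ n) {C₀ Λ : ℝ} {K : Euc n → ℝ}
    (h1 : CondK1 n h0 C₀ K) (h2 : CondK2 n h0 Λ K) {x y : Euc n}
    (hx : x ∈ closure (halfBall n h0 1)) (hy : y ∈ closure (halfBall n h0 1)) :
    ‖fderivWithin ℝ K (closure (halfBall n h0 1)) y
      - fderivWithin ℝ K (closure (halfBall n h0 1)) x‖ ≤ Λ * ‖y - x‖ := by
  have hS := uniqueDiffOn_closure_halfBall h0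
  have hd : DifferentiableOn ℝ (fderivWithin ℝ K (closure (halfBall n h0 1)))
      (closure (halfBall n h0 1)) :=
    ((contDiffOn_two_of_condK1 hn h1).fderivWithin hS (m := 1) (by norm_num)).differentiableOn
      (by norm_num)
  refine (convex_closure_halfBall h0 1).norm_image_sub_le_of_norm_fderivWithin_le hd ?_ hx hy
  intro z hz
  rw [← norm_iteratedFDerivWithin_one _ (hS z hz), norm_iteratedFDerivWithin_fderivWithin hS hz]
  exact (h2 z hz).2 2 (by norm_num) (by omega)

/-- First-order Taylor estimate for `K` about `x`. -/
theorem taylor_of_condK {h0 : 0 < n} (hn : 4 ≤ n) {C₀ Λ r : ℝ} (hΛ : 0 < Λ) {K : Euc n → ℝ}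
    (h1 : CondK1 n h0 C₀ K) (h2 : CondK2 n h0 Λ K) {x y z : Euc n}
    (hx : x ∈ closure (halfBall n h0 1)) (hy : y ∈ closure (halfBall n h0 1))
    (hz : z ∈ closure (halfBall n h0 1)) (hyr : ‖y - x‖ ≤ r) (hzr : ‖z - x‖ ≤ r) :
    fderivWithin ℝ K (closure (halfBall n h0 1)) x (y - z) - Λ * r * ‖y - z‖ ≤ K y - K z := by
  set S := closure (halfBall n h0 1) with hSdef
  set φ := fderivWithin ℝ K S x with hφ
  have hd : DifferentiableOn ℝ K S :=
    (contDiffOn_two_of_condK1 hn h1).differentiableOn (by norm_num)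
  have hderiv : ∀ w ∈ S ∩ closedBall x r, HasFDerivWithinAt (fun w => K w - φ w)
      (fderivWithin ℝ K S w - φ) (S ∩ closedBall x r) w := fun w hw =>
    ((hd w hw.1).hasFDerivWithinAt.mono inter_subset_left).sub φ.hasFDerivWithinAt
  have hb : ∀ w ∈ S ∩ closedBall x r, ‖fderivWithin ℝ K S w - φ‖ ≤ Λ * r := by
    intro w hw
    refine (norm_fderivWithin_sub_le hn h1 h2 hx hw.1).trans ?_
    have := mem_closedBall_iff_norm.1 hw.2
    gcongr
  have hfin := ((convex_closure_halfBall h0 1).inter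
    (convex_closedBall x r)).norm_image_sub_le_of_norm_hasFDerivWithin_le hderiv hb
    ⟨hz, mem_closedBall_iff_norm.2 hzr⟩ ⟨hy, mem_closedBall_iff_norm.2 hyr⟩
  rw [Real.norm_eq_abs] at hfin
  have := (abs_le.1 hfin).1
  rw [map_sub]
  linarith

/-- The gradient of a function satisfying `CondK3` at a flat boundary point is tangential. -/
theorem fderivWithin_single_eq_zero {h0 : 0 < n} (hn : 4 ≤ n) {C₀ : ℝ} {K : Euc n → ℝ}
    (h1 : CondK1 n h0 C₀ K) (h3 : CondK3 n h0 K) {x : Euc n} (hx : ‖x‖ < 1)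
    (hx0 : x (lastIdx n h0) = 0) :
    fderivWithin ℝ K (closure (halfBall n h0 1)) x
      (EuclideanSpace.single (lastIdx n h0) (1:ℝ)) = 0 := by
  set S := closure (halfBall n h0 1) with hSdef
  set E : Euc n := EuclideanSpace.single (lastIdx n h0) (1:ℝ) with hE
  have hxS : x ∈ S := mem_closure_halfBall h0 hx hx0.ge
  have hd : DifferentiableOn ℝ K S :=
    (contDiffOn_two_of_condK1 hn h1).differentiableOn (by norm_num)
  have hK : HasFDerivWithinAt K (fderivWithin ℝ K S x) {y | 0 ≤ y (lastIdx n h0)} x :=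
    (hd x hxS).hasFDerivWithinAt.mono_of_mem_nhdsWithin (closure_halfBall_mem_nhdsWithin h0 hx)
  have hlin : HasDerivWithinAt (fun t : ℝ => x + t • E) E (Ici 0) 0 := by
    simpa using ((hasDerivWithinAt_id (0:ℝ) (Ici 0)).smul_const E).const_add x
  have hj : ∀ t : ℝ, (x + t • E) (lastIdx n h0) = t := by
    intro t; rw [hE, add_smul_single_apply, hx0, zero_add]
  have h4 : HasDerivWithinAt (fun t : ℝ => K (x + t • E)) (fderivWithin ℝ K S x E) (Ici 0) 0 := by
    have hK' : HasFDerivWithinAt K (fderivWithin ℝ K S x) {y | 0 ≤ y (lastIdx n h0)}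
        (x + (0:ℝ) • E) := by simpa using hK
    refine hK'.comp_hasDerivWithinAt (0:ℝ) hlin ?_
    intro t ht
    change 0 ≤ (x + t • E) (lastIdx n h0)
    rw [hj]; exact ht
  have h5 : HasDerivWithinAt (fun t : ℝ => K (x + t • E)) 0 (Ici 0) 0 := by
    refine (hasDerivWithinAt_const (0:ℝ) (Ici 0) (K x)).congr_of_eventuallyEq ?_ (by simp)
    have hc : Tendsto (fun t : ℝ => x + t • E) (𝓝 0) (𝓝 x) := by
      have : Continuous (fun t : ℝ => x + t • E) := by fun_prop
      simpa using this.tendsto 0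
    have hev : ∀ᶠ t : ℝ in 𝓝[Ici 0] 0, ‖x + t • E‖ < 1 :=
      (hc.norm.eventually_lt_const hx).filter_mono nhdsWithin_le_nhds
    filter_upwards [hev, self_mem_nhdsWithin] with t ht ht0
    refine h3 _ (mem_closure_halfBall h0 ht ?_) x hxS ?_
    · rw [hj]; exact ht0
    · intro i hi
      simp [hE, hi]
  exact (uniqueDiffOn_Ici (0:ℝ) 0 self_mem_Ici).eq_deriv _ h4 h5

/-- The direction of the gradient. -/
theorem exists_direction {φ : Euc n →L[ℝ] ℝ} (hφ : 0 < ‖φ‖) {j : Fin n}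
    (hj : φ (EuclideanSpace.single j (1:ℝ)) = 0) :
    ∃ e : Euc n, ‖e‖ = 1 ∧ e j = 0 ∧ ∀ v, φ v = ‖φ‖ * inner ℝ e v := by
  set w := (InnerProductSpace.toDual ℝ (Euc n)).symm φ with hw
  have hin : ∀ v, inner ℝ w v = φ v := fun v => InnerProductSpace.toDual_symm_apply
  have hwn : ‖w‖ = ‖φ‖ := LinearIsometryEquiv.norm_map _ _
  refine ⟨‖φ‖⁻¹ • w, ?_, ?_, ?_⟩
  · rw [norm_smul, hwn, norm_inv, norm_norm, inv_mul_cancel₀ hφ.ne']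
  · have h1 := hin (EuclideanSpace.single j (1:ℝ))
    rw [hj, EuclideanSpace.inner_single_right] at h1
    have h2 : w j = 0 := by simpa using h1
    rw [PiLp.smul_apply, h2, smul_zero]
  · intro v
    rw [inner_smul_left, hin]
    simp only [map_inv₀, conj_trivial]
    field_simp

/-- Monotonicity of the rescaled coefficient along rays, in the direction of its gradient. -/
theorem rescaled_coeff_gap {h0 : 0 < n} (hn : 4 ≤ n) {C₀ Λ r κ Γ L : ℝ} (hΛ : 0 < Λ)
    (hΓ : 0 < Γ) {K : Euc n → ℝ} (h1 : CondK1 n h0 C₀ K) (h2 : CondK2 n h0 Λ K) {x a e : Euc n}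
    (hx : x ∈ closure (halfBall n h0 1))
    (hmem : ∀ z : Euc n, 0 ≤ z (lastIdx n h0) → ‖z‖ ≤ L →
      a + Γ⁻¹ • z ∈ closure (halfBall n h0 1) ∧ ‖a + Γ⁻¹ • z - x‖ ≤ r)
    (he : ∀ v, fderivWithin ℝ K (closure (halfBall n h0 1)) x v = κ * inner ℝ e v)
    (hκ : Λ * r ≤ κ / 8) {l : ℝ} (hl : 0 < l) {z : Euc n} (hz : 0 < z (lastIdx n h0))
    (hlz : l < ‖z‖ ^ 2) (hzL : ‖z‖ < L) :
    κ / Γ * ((1 - l / ‖z‖ ^ 2) * (inner ℝ e z - ‖z‖ / 8)) ≤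
      K (a + Γ⁻¹ • z) - K (a + Γ⁻¹ • (l / ‖z‖ ^ 2) • z) := by
  have hN : 0 < ‖z‖ ^ 2 := hl.trans hlz
  have hr1 : l / ‖z‖ ^ 2 < 1 := (div_lt_one hN).2 hlz
  have hr0 : 0 < l / ‖z‖ ^ 2 := by positivity
  have m1 := hmem z hz.le hzL.le
  have m2 := hmem ((l / ‖z‖ ^ 2) • z) (by rw [PiLp.smul_apply, smul_eq_mul]; positivity) (by
    rw [norm_smul, Real.norm_of_nonneg hr0.le]
    exact (mul_le_of_le_one_left (norm_nonneg z) hr1.le).trans hzL.le)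
  have ht := taylor_of_condK hn hΛ h1 h2 hx m1.1 m2.1 m1.2 m2.2
  have hsub : a + Γ⁻¹ • z - (a + Γ⁻¹ • (l / ‖z‖ ^ 2) • z) = (Γ⁻¹ * (1 - l / ‖z‖ ^ 2)) • z := by
    module
  have hpos : 0 ≤ Γ⁻¹ * (1 - l / ‖z‖ ^ 2) := mul_nonneg (by positivity) (by linarith)
  rw [hsub, he, inner_smul_right, norm_smul, Real.norm_of_nonneg hpos] at ht
  refine le_trans ?_ ht
  have h3 := mul_le_mul_of_nonneg_right hκ
    (show 0 ≤ Γ⁻¹ * (1 - l / ‖z‖ ^ 2) * ‖z‖ from mul_nonneg hpos (norm_nonneg z))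
  rw [div_eq_mul_inv κ Γ]
  linarith

theorem differentiable_bubble {m γ : ℝ} (hγ : 0 < γ) (zb : Euc n) :
    Differentiable ℝ (bubble m γ zb) := by
  intro z
  have h1 : 0 < γ ^ 2 + ‖z - zb‖ ^ 2 := by positivity
  unfold bubble
  refine DifferentiableAt.rpow_const ?_ (Or.inl (by positivity))
  have h2 : DifferentiableAt ℝ (fun z : Euc n => γ ^ 2 + ‖z - zb‖ ^ 2) z :=
    ((differentiableAt_id.sub_const zb).norm_sq ℝ).const_add (γ ^ 2)
  simp only [div_eq_mul_inv]
  exact (h2.inv h1.ne').const_mul γ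

/-- Uniform `C¹` closeness to the limit on large half-balls. -/
theorem TendstoC2LocOn.eventually_close {h0 : 0 < n} {v : ℕ → Euc n → ℝ} {U : Euc n → ℝ}
    (hv : TendstoC2LocOn n v U (closure (upperHalf n h0))) {ρ η : ℝ} (hη : 0 < η)
    (hU : Differentiable ℝ U)
    (hdv : ∀ᶠ i in atTop, ∀ y : Euc n, 0 ≤ y (lastIdx n h0) → ‖y‖ ≤ ρ →
      DifferentiableWithinAt ℝ (v i) (closure (upperHalf n h0)) y) :
    ∀ᶠ i in atTop, (∀ y : Euc n, 0 ≤ y (lastIdx n h0) → ‖y‖ ≤ ρ → |v i y - U y| ≤ η) ∧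
      ∀ y w : Euc n, 0 ≤ y (lastIdx n h0) → ‖y‖ ≤ ρ → 0 ≤ w (lastIdx n h0) → ‖w‖ ≤ ρ →
        |(v i y - U y) - (v i w - U w)| ≤ η * ‖y - w‖ := by
  set D := closure (upperHalf n h0) with hD
  have hDeq : D = {x | 0 ≤ x (lastIdx n h0)} := closure_upperHalf h0
  set P : Set (Euc n) := D ∩ closedBall 0 ρ with hP
  have hPc : IsCompact P := (isCompact_closedBall 0 ρ).inter_left isClosed_closure
  have hPconv : Convex ℝ P := ((convex_upperHalf h0).closure).inter (convex_closedBall 0 ρ)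
  have hPmem : ∀ y : Euc n, 0 ≤ y (lastIdx n h0) → ‖y‖ ≤ ρ → y ∈ P := fun y h1 h2 =>
    ⟨by rw [hDeq]; exact h1, by simpa using h2⟩
  obtain ⟨c0, c1, -⟩ := hv P hPc inter_subset_left
  have e0 := Metric.tendstoUniformlyOn_iff.1 c0 η hη
  have e1 := Metric.tendstoUniformlyOn_iff.1 c1 η hη
  filter_upwards [e0, e1, hdv] with i h2 h3 h4
  constructor
  · intro y hy hyρ
    have := h2 y (hPmem y hy hyρ)
    rw [dist_comm, Real.dist_eq] at this
    exact this.le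
  · intro y w hy hyρ hw hwρ
    have hderiv : ∀ z ∈ P, HasFDerivWithinAt (fun z => v i z - U z)
        (fderivWithin ℝ (v i) D z - fderivWithin ℝ U D z) P z := by
      intro z hz
      have hz0 : 0 ≤ z (lastIdx n h0) := by have := hz.1; rwa [hDeq] at this
      have a1 := (h4 z hz0 (by simpa using hz.2)).hasFDerivWithinAt.mono
        (inter_subset_left (t := closedBall (0 : Euc n) ρ))
      have a2 := ((hU z).differentiableWithinAt (s := D)).hasFDerivWithinAt.mono
        (inter_subset_left (t := closedBall (0 : Euc n) ρ))
      exact a1.sub a2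
    have hb : ∀ z ∈ P, ‖fderivWithin ℝ (v i) D z - fderivWithin ℝ U D z‖ ≤ η := by
      intro z hz
      have := h3 z hz
      rw [dist_comm, dist_eq_norm] at this
      exact this.le
    have := hPconv.norm_image_sub_le_of_norm_hasFDerivWithin_le hderiv hb (hPmem w hw hwρ)
      (hPmem y hy hyρ)
    rwa [Real.norm_eq_abs] at this

end

section

variable {n : ℕ}

theorem bubble_add_right (m γ : ℝ) (a z y : Euc n) :
    bubble m γ (a + y) z = bubble m γ y (z - a) := by
  unfold bubble
  rw [sub_sub]

theorem Geo.with_direction {j : Fin n} {m γ t0 R : ℝ} {e e' : Euc n} (g : Geo n j m γ t0 R e)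
    (h1 : ‖e'‖ = 1) (hj : e' j = 0) : Geo n j m γ t0 R e' :=
  ⟨g.hm, g.m1, g.γ0, g.γ1, g.ht, g.hγt, g.R4, h1, hj⟩

/-- A sufficiently concentrated solution cannot have a coefficient with a large gradient at the
projected concentration point. -/
theorem false_of_concentrated {h0 : 0 < n} (hn : 4 ≤ n)
    {C₀ Λ m γ t0 R hb R2 η ε0 β A2 δ ρ M Γ c : ℝ} {e0 p : Euc n} {K u : Euc n → ℝ}
    (hΛ : 0 < Λ) (g0 : Geo n (lastIdx n h0) m γ t0 R e0)
    (hthr : ∀ ε, 0 < ε → ε ≤ ε0 → Thr m γ t0 R hb R2 η ε)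
    (hbar : BarrierParams m β hb (bconst m γ) A2 R (fconst m γ))
    (h1 : CondK1 n h0 C₀ K) (h2 : CondK2 n h0 Λ K) (h3 : CondK3 n h0 K)
    (hu : IsYamabeSol n h0 K (fun _ => c) u) (hM : 0 < M) (hΓ : Γ = M ^ (1 / m))
    (hp : ‖p‖ < 1 / 2) (hp0 : p (lastIdx n h0) = 0) (hδ : 0 < δ)
    (hδK : δ ≤ ‖fderivWithin ℝ K (closure (halfBall n h0 1)) p‖) (hρ0 : 0 < ρ) (hρ : ρ ≤ 1 / 16)
    (hρδ : Λ * (2 * ρ) ≤ δ / 8) (hc : c ≤ γ ^ 2 / 88) (hΓR : R / Γ ≤ ρ) (hΓε : Λ / Γ ≤ ε0)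
    (hR2L : R2 < ρ * Γ)
    (hout : ∀ ξ : Euc n, 0 ≤ ξ (lastIdx n h0) → ‖ξ‖ < 2 / 3 →
      oconst m γ hb * (ρ * Γ) ^ (-(2 * m)) ≤ u ξ / M)
    (hD : ∀ y : Euc n, 0 ≤ y (lastIdx n h0) → ‖y‖ ≤ R2 + R →
      |u (p + Γ⁻¹ • y) / M - bubble m γ (t0 • EuclideanSpace.single (lastIdx n h0) (1:ℝ)) y| ≤ η)
    (hDL : ∀ y w : Euc n, 0 ≤ y (lastIdx n h0) → ‖y‖ ≤ R2 + R → 0 ≤ w (lastIdx n h0) →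
      ‖w‖ ≤ R2 + R →
      |(u (p + Γ⁻¹ • y) / M - bubble m γ (t0 • EuclideanSpace.single (lastIdx n h0) (1:ℝ)) y) -
        (u (p + Γ⁻¹ • w) / M - bubble m γ (t0 • EuclideanSpace.single (lastIdx n h0) (1:ℝ)) w)|
          ≤ η * ‖y - w‖) : False := by
  have hm1 := g0.m1
  have hΓ0 : 0 < Γ := by rw [hΓ]; positivity
  have hR := g0.R4
  set j := lastIdx n h0 with hj
  set S := closure (halfBall n h0 1) with hS
  have hpS : p ∈ S := mem_closure_halfBall h0 (by linarith) hp0.ge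
  set φ := fderivWithin ℝ K S p with hφ
  have hκΛ : ‖φ‖ ≤ Λ := norm_fderivWithin_le_of_condK2 hn h2 hpS
  have hκ0 : 0 < ‖φ‖ := hδ.trans_le hδK
  obtain ⟨e, he1, hej, he⟩ := exists_direction hκ0
    (fderivWithin_single_eq_zero hn h1 h3 (by linarith) hp0)
  change e j = 0 at hej
  have g := g0.with_direction he1 hej
  set a := p - Γ⁻¹ • R • e with ha
  have haj : a j = 0 := by
    simp [ha, hp0, hej]
  have hshift : ∀ z : Euc n, a + Γ⁻¹ • z = p + Γ⁻¹ • (z - R • e) := by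
    intro z; rw [ha]; module
  have hdist : ∀ z : Euc n, ‖z‖ ≤ ρ * Γ → ‖a + Γ⁻¹ • z - p‖ ≤ 2 * ρ := by
    intro z hz
    have e1 : a + Γ⁻¹ • z - p = Γ⁻¹ • z - Γ⁻¹ • R • e := by rw [ha]; module
    have e2 : ‖Γ⁻¹ • z‖ ≤ ρ := by
      rw [norm_smul, Real.norm_of_nonneg (by positivity), inv_mul_le_iff₀ hΓ0]
      linarith
    have e3 : ‖Γ⁻¹ • R • e‖ ≤ ρ := by
      rw [norm_smul, norm_smul, he1, Real.norm_of_nonneg (by positivity),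
        Real.norm_of_nonneg (by linarith), mul_one, inv_mul_eq_div]
      exact hΓR
    rw [e1]
    linarith [norm_sub_le (Γ⁻¹ • z) (Γ⁻¹ • R • e)]
  have hnorm : ∀ z : Euc n, ‖z‖ ≤ ρ * Γ → ‖a + Γ⁻¹ • z‖ < 2 / 3 := by
    intro z hz
    have e1 := hdist z hz
    have e2 := norm_le_norm_add_norm_sub' (a + Γ⁻¹ • z) p
    linarith
  have hzj : ∀ z : Euc n, (a + Γ⁻¹ • z) j = Γ⁻¹ * z j := by
    intro z; simp [haj]
  have hmem : ∀ z : Euc n, 0 ≤ z j → ‖z‖ ≤ ρ * Γ →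
      a + Γ⁻¹ • z ∈ S ∧ ‖a + Γ⁻¹ • z - p‖ ≤ 2 * ρ := by
    intro z hz hzL
    refine ⟨mem_closure_halfBall h0 ((hnorm z hzL).trans (by norm_num)) ?_, hdist z hzL⟩
    change 0 ≤ (a + Γ⁻¹ • z) j
    rw [hzj]; positivity
  have hbub : ∀ z : Euc n, bubble m γ (ctrB j t0 R e) z =
      bubble m γ (t0 • EuclideanSpace.single j (1:ℝ)) (z - R • e) := fun z =>
    bubble_add_right m γ (R • e) z _
  have hsj : ∀ z : Euc n, (z - R • e) j = z j := by intro z; simp [hej]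
  have hsn : ∀ z : Euc n, ‖z‖ ≤ R2 → ‖z - R • e‖ ≤ R2 + R := by
    intro z hz
    have := norm_sub_le z (R • e)
    rw [norm_smul, he1, Real.norm_of_nonneg (by linarith), mul_one] at this
    linarith
  have hKc : ContinuousOn K S := (contDiffOn_two_of_condK1 hn h1).continuousOn
  obtain ⟨Kmax, hKmax⟩ := (isCompact_closure_halfBall h0 1).bddAbove_image hKc
  refine moving_sphere_contradiction (L := ρ * Γ) (c := c) (Kmax := Kmax) (ε := ‖φ‖ / Γ)
    (V := fun z => u (a + Γ⁻¹ • z) / M) (Kh := fun z => K (a + Γ⁻¹ • z)) g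
    (hthr _ (by positivity) ((div_le_div_of_nonneg_right hκΛ hΓ0.le).trans hΓε)) hbar
    (RescaledSol.of_isYamabeSol h0 g0.hm (by linarith) hu hM hΓ haj
      fun z hz => (hnorm z hz).trans (by norm_num)) hc ?_ ?_ hR2L ?_ ?_ ?_
  · intro z hz hzL
    have hzS := (hmem z hz.le hzL.le).1
    exact ⟨(by positivity : (0:ℝ) < 1 / Λ).trans_le (h2 _ hzS).1,
      hKmax (mem_image_of_mem K hzS)⟩
  · intro l hl z hz hlz hzL
    exact rescaled_coeff_gap hn hΛ hΓ0 h1 h2 hpS hmem he (by linarith)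
      (lt_of_lt_of_le (by positivity) hl) hz hlz hzL
  · intro z hz hzL
    refine hout _ ?_ (hnorm z hzL.le)
    rw [hzj]; positivity
  · intro z hz hzR
    have := hD (z - R • e) (by rw [hsj]; exact hz) (hsn z hzR)
    rw [← hbub, ← hshift] at this
    exact this
  · intro z w hz hzR hw hwR
    have := hDL (z - R • e) (w - R • e) (by rw [hsj]; exact hz) (hsn z hzR)
      (by rw [hsj]; exact hw) (hsn w hwR)
    rw [← hbub, ← hshift, ← hbub, ← hshift, sub_sub_sub_cancel_right] at this
    exact this

end

section

variable {n : ℕ}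

/-- The parameters of the limiting bubble are admissible. -/
theorem bubble_params {c₀ d γ t₀ : ℝ} (hd : 2 ≤ d) (hc : c₀ < 1 / 100)
    (hγ : γ = if c₀ ≤ 0 then (1 + c₀ ^ 2 / d ^ 2)⁻¹ else 1) (ht : t₀ = γ * c₀ / d) :
    0 < γ ∧ γ ≤ 1 ∧ |t₀| ≤ 1 / 2 ∧ γ ^ 2 + t₀ ^ 2 ≤ 5 / 4 ∧ c₀ < γ ^ 2 / 88 := by
  set s := c₀ / d with hs
  have ht' : t₀ = γ * s := by rw [ht, hs]; ring
  rcases le_or_gt c₀ 0 with h | h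
  · have hγ' : γ * (1 + s ^ 2) = 1 := by
      rw [hγ, if_pos h, hs, div_pow]
      exact inv_mul_cancel₀ (by positivity)
    have hγ0 : 0 < γ := by
      rw [hγ, if_pos h]; positivity
    have hγ1 : γ ≤ 1 := by nlinarith [mul_nonneg hγ0.le (sq_nonneg s)]
    have h1 : γ ^ 2 + t₀ ^ 2 = γ := by
      rw [ht']; linear_combination γ * hγ'
    refine ⟨hγ0, hγ1, abs_le_of_sq_le_sq ?_ (by norm_num), by linarith,
      h.trans_lt (by positivity)⟩
    nlinarith [sq_nonneg (γ - 1 / 2)]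
  · have hγ' : γ = 1 := by rw [hγ, if_neg h.not_ge]
    have hs0 : 0 ≤ s := by positivity
    have hs1 : s ≤ 1 / 200 := by
      rw [hs, div_le_iff₀ (by linarith)]; linarith
    rw [ht', hγ', one_mul]
    refine ⟨one_pos, le_rfl, by rw [abs_of_nonneg hs0]; linarith, by nlinarith, by linarith⟩

/-- Differentiability of a rescaled solution up to the flat boundary. -/
theorem differentiableWithinAt_rescaled {h0 : 0 < n} {u : Euc n → ℝ} {p y : Euc n} {M r : ℝ}
    (hu : DifferentiableOn ℝ u (closure (halfBall n h0 1))) (hr : 0 ≤ r)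
    (hp0 : p (lastIdx n h0) = 0) (hy : 0 ≤ y (lastIdx n h0)) (hyn : ‖p + r • y‖ < 1) :
    DifferentiableWithinAt ℝ (fun y => u (p + r • y) / M) (closure (upperHalf n h0)) y := by
  rw [closure_upperHalf]
  have hj : ∀ z : Euc n, 0 ≤ z (lastIdx n h0) → 0 ≤ (p + r • z) (lastIdx n h0) := by
    intro z hz
    simp only [PiLp.add_apply, PiLp.smul_apply, smul_eq_mul, hp0]
    positivity
  have h1 : DifferentiableWithinAt ℝ u {z | 0 ≤ z (lastIdx n h0)} (p + r • y) :=
    (hu _ (mem_closure_halfBall h0 hyn (hj y hy))).mono_of_mem_nhdsWithin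
      (closure_halfBall_mem_nhdsWithin h0 hyn)
  have h2 : DifferentiableWithinAt ℝ (fun z : Euc n => p + r • z) {z | 0 ≤ z (lastIdx n h0)} y :=
    DifferentiableAt.differentiableWithinAt (by fun_prop)
  have h3 : MapsTo (fun z : Euc n => p + r • z) {z | 0 ≤ z (lastIdx n h0)}
      {z | 0 ≤ z (lastIdx n h0)} := hj
  simp only [div_eq_inv_mul]
  exact (h1.comp y h2 h3).const_mul M⁻¹

/-- A real sequence with no subsequence tending to zero is eventually bounded away from it. -/
theorem exists_subseq_tendsto_zero_or {a : ℕ → ℝ} (ha : ∀ i, 0 ≤ a i) :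
    (∃ φ : ℕ → ℕ, StrictMono φ ∧ Tendsto (fun k => a (φ k)) atTop (𝓝 0)) ∨
      ∃ δ > 0, ∀ᶠ i in atTop, δ ≤ a i := by
  by_cases h : ∀ k : ℕ, ∃ᶠ i in atTop, a i < 1 / ((k : ℝ) + 1)
  · obtain ⟨φ, hφ, h'⟩ := extraction_forall_of_frequently h
    exact Or.inl ⟨φ, hφ, squeeze_zero (fun k => ha _) (fun k => (h' k).le)
      tendsto_one_div_add_atTop_nhds_zero_nat⟩
  · push Not at h
    obtain ⟨k, hk⟩ := h
    exact Or.inr ⟨1 / ((k : ℝ) + 1), by positivity, hk⟩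

end

/-- in the blow-up framework with bounded `T_i`, the gradient of `K_i`
at the projected blow-up points vanishes along a subsequence. -/
theorem gradK_vanishes_Ti_bounded (n : ℕ) (hn : 4 ≤ n) (h0 : 0 < n)
    (C₀ Λ : ℝ) (hC₀ : 0 < C₀) (hΛ : 0 < Λ) :
    ∃ ε : ℝ, 0 < ε ∧
      ∀ (K : ℕ → Euc n → ℝ) (c : ℕ → ℝ) (c₀ : ℝ) (u : ℕ → Euc n → ℝ)
        (x x' : ℕ → Euc n) (σ : ℕ → ℝ) (M Γ : ℕ → ℝ) (Tbar γ t₀ : ℝ)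
        (v : ℕ → Euc n → ℝ) (U : Euc n → ℝ),
        (∀ i, CondK1 n h0 C₀ (K i)) →
        (∀ i, CondK2 n h0 Λ (K i)) →
        (∀ i, CondK3 n h0 (K i)) →
        Filter.Tendsto (fun i => K i (x i)) Filter.atTop (nhds ((n : ℝ) * ((n : ℝ) - 2))) →
        Filter.Tendsto c Filter.atTop (nhds c₀) →
        c₀ < ε →
        (∀ i, IsYamabeSol n h0 (K i) (fun _ => c i) (u i)) →
        (∀ i, x i ∈ closure (upperHalf n h0) ∩ Metric.ball (0 : Euc n) (1/2)) →
        (∀ i, M i = u i (x i)) →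
        (∀ i, Γ i = M i ^ ((2 : ℝ) / ((n : ℝ) - 2))) →
        (∀ i, sSup (u i '' closure (halfBall n h0 (1/3))) ≤ M i) →
        Filter.Tendsto σ Filter.atTop (nhds 0) →
        (∀ i, ∀ z ∈ Metric.ball (x i) (σ i) ∩ upperHalf n h0, u i z ≤ M i) →
        Filter.Tendsto (fun i => Γ i * σ i) Filter.atTop Filter.atTop →
        (∀ i : ℕ, (i : ℝ) < M i * sInf (u i '' closure (halfBall n h0 (2/3)))) →
        (0 ≤ Tbar) →
        Filter.Tendsto (fun i => x i (lastIdx n h0) * Γ i) Filter.atTop (nhds Tbar) →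
        (∀ i, x' i = x i - x i (lastIdx n h0) • EuclideanSpace.single (lastIdx n h0) (1 : ℝ)) →
        (γ = if c₀ ≤ 0 then (1 + c₀ ^ 2 / ((n : ℝ) - 2) ^ 2)⁻¹ else 1) →
        (t₀ = γ * c₀ / ((n : ℝ) - 2)) →
        (∀ y : Euc n, U y =
          (γ / (γ ^ 2 + ‖y - t₀ • EuclideanSpace.single (lastIdx n h0) (1 : ℝ)‖ ^ 2))
            ^ (((n : ℝ) - 2) / 2)) →
        (∀ i y, v i y = u i (x' i + (Γ i)⁻¹ • y) / M i) →
        TendstoC2LocOn n v U (closure (upperHalf n h0)) →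
        ∃ φ : ℕ → ℕ, StrictMono φ ∧
          Filter.Tendsto
            (fun k =>
              ‖iteratedFDerivWithin ℝ 1 (K (φ k)) (closure (halfBall n h0 1)) (x' (φ k))‖)
            Filter.atTop (nhds 0) := by
  have hn4 : (4:ℝ) ≤ n := by exact_mod_cast hn
  refine ⟨1 / 100, by norm_num, ?_⟩
  intro K c c₀ u x x' σ M Γ Tbar γ t₀ v U h1 h2 h3 _ hc hc0 hu hx hM hΓ _ _ _ _ hmin _ _ hx'
    hγ ht hU hv hconv
  rcases exists_subseq_tendsto_zero_or (a := fun i =>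
    ‖iteratedFDerivWithin ℝ 1 (K i) (closure (halfBall n h0 1)) (x' i)‖)
    (fun i => norm_nonneg _) with hgood | ⟨δ, hδ, hδK⟩
  · exact hgood
  exfalso
  set j := lastIdx n h0 with hj
  obtain ⟨m, hm⟩ : ∃ m : ℝ, m = ((n:ℝ) - 2) / 2 := ⟨_, rfl⟩
  have hnm : (n:ℝ) = 2 * m + 2 := by linarith
  have hm1 : 1 ≤ m := by linarith
  obtain ⟨p1, p2, p3, p4, p5⟩ := bubble_params (by linarith) hc0 hγ ht
  -- projected points
  have hxj : ∀ i, 0 ≤ x i j := by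
    intro i
    have := (hx i).1
    rwa [closure_upperHalf] at this
  have hxn : ∀ i, ‖x i‖ < 1 / 2 := fun i => mem_ball_zero_iff.1 (hx i).2
  have hpj : ∀ i, x' i j = 0 := by
    intro i
    rw [hx' i, sub_eq_add_neg, ← neg_smul, add_smul_single_apply, add_neg_cancel]
  have hpn : ∀ i, ‖x' i‖ < 1 / 2 := by
    intro i
    refine lt_of_le_of_lt ?_ (hxn i)
    refine le_of_sq_le_sq ?_ (norm_nonneg _)
    rw [hx' i, sub_eq_add_neg, ← neg_smul, norm_add_smul_single_sq]
    nlinarith [sq_nonneg (x i j)]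
  -- blow-up of the scales
  have hMpos : ∀ i, 0 < M i := by
    intro i
    rw [hM i]
    exact (hu i).2.1 _ (mem_closure_halfBall h0 ((hxn i).trans (by norm_num)) (hxj i))
  have hbdd : ∀ i, BddBelow (u i '' closure (halfBall n h0 (2/3))) := by
    intro i
    refine ⟨0, ?_⟩
    rintro _ ⟨y, hy, rfl⟩
    refine ((hu i).2.1 _ (closure_mono ?_ hy)).le
    exact inter_subset_inter_left _ (ball_subset_ball (by norm_num))
  have hlow : ∀ i : ℕ, ∀ ξ : Euc n, 0 ≤ ξ j → ‖ξ‖ < 2 / 3 → (i:ℝ) < M i * u i ξ := by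
    intro i ξ h4 h5
    refine (hmin i).trans_le (mul_le_mul_of_nonneg_left ?_ (hMpos i).le)
    exact csInf_le (hbdd i) (mem_image_of_mem _ (mem_closure_halfBall h0 h5 h4))
  have hMsq : Tendsto (fun i => M i ^ (2:ℝ)) atTop atTop := by
    refine tendsto_atTop_mono (fun i => ?_) tendsto_natCast_atTop_atTop
    have := hlow i (x i) (hxj i) ((hxn i).trans (by norm_num))
    rw [← hM i, ← sq] at this
    rw [Real.rpow_two]
    exact this.le
  have hΓm : ∀ i, Γ i = M i ^ (1 / m) := by
    intro i
    rw [hΓ i, hm]; congr 1; field_simp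
  have hΓlim : Tendsto Γ atTop atTop := by
    have h4 := (tendsto_rpow_atTop (y := 1 / (2 * m)) (by positivity)).comp hMsq
    refine h4.congr fun i => ?_
    change (M i ^ (2:ℝ)) ^ (1 / (2 * m)) = Γ i
    rw [hΓm i, ← Real.rpow_mul (hMpos i).le]
    congr 1; field_simp
  -- choice of parameters
  obtain ⟨β, hb, A2, R, hR4, hbar⟩ := exists_barrierParams (m := m) (c1 := fconst m γ)
    (A1 := bconst m γ) hm1 (by unfold fconst; positivity) (by unfold bconst; positivity)
  have g0 : Geo n j m γ t₀ R (EuclideanSpace.single (⟨0, h0⟩ : Fin n) (1:ℝ)) := by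
    refine ⟨hnm, hm1, p1, p2, p3, p4, hR4, by simp, ?_⟩
    have : j ≠ ⟨0, h0⟩ := by
      rw [hj, lastIdx, Ne, Fin.mk.injEq]; omega
    simp [this]
  obtain ⟨R2, η, ε0, hε0, hthr⟩ := exists_thr g0 hbar.h00
  have hη : 0 < η := (hthr ε0 hε0 le_rfl).η0
  have hR2 : 2 * (R + 1) ≤ R2 := ((hthr ε0 hε0 le_rfl).R2_facts g0).1
  obtain ⟨ρ, hρ⟩ : ∃ ρ : ℝ, ρ = min (1 / 16) (δ / (16 * Λ)) := ⟨_, rfl⟩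
  have hρ0 : 0 < ρ := by rw [hρ]; exact lt_min (by norm_num) (by positivity)
  have hρ1 : ρ ≤ 1 / 16 := by rw [hρ]; exact min_le_left _ _
  have hρ2 : Λ * (2 * ρ) ≤ δ / 8 := by
    have : ρ ≤ δ / (16 * Λ) := by rw [hρ]; exact min_le_right _ _
    rw [le_div_iff₀ (by positivity)] at this
    linarith
  have hUb : U = bubble m γ (t₀ • EuclideanSpace.single j (1:ℝ)) := by
    funext y
    rw [hU y, ← hm]; rfl
  have hΓ0 : ∀ i, 0 < Γ i := by
    intro i
    rw [hΓm i]
    exact Real.rpow_pos_of_pos (hMpos i) _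
  have hvf : ∀ i, v i = fun y => u i (x' i + (Γ i)⁻¹ • y) / M i := fun i => funext (hv i)
  have hclose := hconv.eventually_close (ρ := R2 + R) hη
    (by rw [hUb]; exact differentiable_bubble p1 _) (by
      filter_upwards [hΓlim.eventually_ge_atTop (4 * (R2 + R))] with i hi y hy hyn
      rw [hvf i]
      refine differentiableWithinAt_rescaled ((hu i).1.differentiableOn (by norm_num))
        (inv_nonneg.2 (hΓ0 i).le) (hpj i) hy ?_
      have h4 : ‖(Γ i)⁻¹ • y‖ ≤ 1 / 4 := by
        rw [norm_smul, Real.norm_of_nonneg (inv_nonneg.2 (hΓ0 i).le), inv_mul_le_iff₀ (hΓ0 i)]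
        linarith
      linarith [norm_add_le (x' i) ((Γ i)⁻¹ • y), hpn i])
  have hfin := hclose.and (hδK.and ((hΓlim.eventually_ge_atTop (R / ρ)).and
    ((hΓlim.eventually_ge_atTop (Λ / ε0)).and ((hΓlim.eventually_gt_atTop (R2 / ρ)).and
    ((hc.eventually_lt_const p5).and
      (tendsto_natCast_atTop_atTop.eventually_ge_atTop (oconst m γ hb * ρ ^ (-(2 * m)))))))))
  obtain ⟨i, ⟨q1, q2⟩, q3, q4, q5, q6, q7, q8⟩ := hfin.exists
  have hpS : x' i ∈ closure (halfBall n h0 1) :=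
    mem_closure_halfBall h0 ((hpn i).trans (by norm_num)) (hpj i).ge
  rw [norm_iteratedFDerivWithin_one _ (uniqueDiffOn_closure_halfBall h0 _ hpS)] at q3
  refine false_of_concentrated (M := M i) (Γ := Γ i) (c := c i) hn hΛ g0 hthr hbar (h1 i) (h2 i)
    (h3 i) (hu i) (hMpos i) (hΓm i) (hpn i) (hpj i) hδ q3 hρ0 hρ1 hρ2 q7.le ?_ ?_ ?_ ?_ ?_ ?_
  · rw [div_le_comm₀ (hΓ0 i) hρ0]; exact q4
  · rw [div_le_comm₀ (hΓ0 i) hε0]; exact q5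
  · rw [div_lt_iff₀ hρ0] at q6; linarith
  · intro ξ h4 h5
    have h6 := hlow i ξ h4 h5
    have h7 : (ρ * Γ i) ^ (-(2 * m)) = ρ ^ (-(2 * m)) / M i ^ 2 := by
      rw [Real.mul_rpow hρ0.le (hΓ0 i).le, hΓm i, ← Real.rpow_mul (hMpos i).le,
        show 1 / m * -(2 * m) = -(2:ℝ) by field_simp, Real.rpow_neg (hMpos i).le, Real.rpow_two,
        div_eq_mul_inv]
    rw [h7, ← mul_div_assoc, div_le_div_iff₀ (pow_pos (hMpos i) 2) (hMpos i)]
    have h8 : oconst m γ hb * ρ ^ (-(2 * m)) ≤ M i * u i ξ := q8.trans h6.le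
    have := mul_le_mul_of_nonneg_right h8 (hMpos i).le
    linarith
  · rw [hUb, hvf i] at q1
    exact q1
  · rw [hUb, hvf i] at q2
    exact q2
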